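/- Let n ≥ 2 and α ∈ (0,1). There exist positive constants β₁, β̃₁, C depending only on n and α, with β₁ ≥ β̃₁, such that the following holds. Let r, b, b′, δ, λ, Λ, C_α > 0 and let w, w′ be smooth functions on the open ball B_r ⊆ ℝⁿ satisfying: |b w − b′ w′| ≤ δ on B_r; det D²w = det D²w′ = 1 on B_r; λ I ≤ D²w ≤ Λ I and λ I ≤ D²w′ ≤ Λ I on B_r (as symmetric matrices); and the α-Hölder seminorms of D²w and D²w′ on B_r are both at most C_α. Then for every r₀ ∈ (0, r) and for ℓ = 2, 3: r₀^ℓ · sup_{B_{r−r₀}} |Dℓ(w − w′)| + r₀^{ℓ+α} · [Dℓ(w − w′)]_{C^α(B_{r−r₀})} ≤ C λ^{−β̃₁} Λ^{β₁−β̃₁} (1 + r^α C_α) (δ + r²|b − b′|)/(b + b′), where Dℓ denotes the ℓ-th derivative. -/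

import Mathlib

open scoped RealInnerProductSpace
noncomputable section

abbrev Euc (n : ℕ) := EuclideanSpace ℝ (Fin n)

/-- Hessian matrix of `u` at `x`. -/
def hessianMatrix {n : ℕ} (u : Euc n → ℝ) (x : Euc n) : Matrix (Fin n) (Fin n) ℝ :=
  Matrix.of fun i j =>
    iteratedFDeriv ℝ 2 u x ![EuclideanSpace.single i 1, EuclideanSpace.single j 1]

/-- Determinant of the Hessian of `u` at `x`. -/
def hessDet {n : ℕ} (u : Euc n → ℝ) (x : Euc n) : ℝ := (hessianMatrix u x).det

def ee {n : ℕ} (i : Fin n) : Euc n := EuclideanSpace.single i 1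

def pd {n : ℕ} (i : Fin n) (u : Euc n → ℝ) : Euc n → ℝ := fun x => fderiv ℝ u x (ee i)

abbrev Sm {n : ℕ} (u : Euc n → ℝ) : Prop := ContDiff ℝ (⊤ : ℕ∞) u

def nd {n : ℕ} (k : ℕ) (u : Euc n → ℝ) (x : Euc n) : ℝ := ‖iteratedFDeriv ℝ k u x‖

lemma norm_ee {n : ℕ} (i : Fin n) : ‖ee i‖ = 1 := by simp [ee]

lemma Sm.diff {n : ℕ} {u : Euc n → ℝ} (h : Sm u) (x : Euc n) : DifferentiableAt ℝ u x :=
  h.differentiable (by simp) x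

lemma Sm.fd {n : ℕ} {u : Euc n → ℝ} (h : Sm u) : ContDiff ℝ (⊤ : ℕ∞) (fderiv ℝ u) :=
  h.fderiv_right (by simp)

lemma Sm.pd {n : ℕ} {u : Euc n → ℝ} (h : Sm u) (i : Fin n) : Sm (pd i u) :=
  h.fd.clm_apply contDiff_const

lemma Sm.sum {n : ℕ} {ι : Type*} {s : Finset ι} {f : ι → Euc n → ℝ} (h : ∀ i ∈ s, Sm (f i)) :
    Sm (fun x => ∑ i ∈ s, f i x) := ContDiff.sum h

lemma pd_add {n : ℕ} {u v : Euc n → ℝ} (hu : Sm u) (hv : Sm v) (i : Fin n) :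
    pd i (fun x => u x + v x) = fun x => pd i u x + pd i v x := by
  ext x; simp only [pd]; rw [fderiv_fun_add (hu.diff x) (hv.diff x)]; rfl

lemma pd_sub {n : ℕ} {u v : Euc n → ℝ} (hu : Sm u) (hv : Sm v) (i : Fin n) :
    pd i (fun x => u x - v x) = fun x => pd i u x - pd i v x := by
  ext x; simp only [pd]; rw [fderiv_fun_sub (hu.diff x) (hv.diff x)]; rfl

lemma pd_mul {n : ℕ} {u v : Euc n → ℝ} (hu : Sm u) (hv : Sm v) (i : Fin n) :
    pd i (fun x => u x * v x) = fun x => pd i u x * v x + u x * pd i v x := by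
  ext x; simp only [pd]; rw [fderiv_fun_mul (hu.diff x) (hv.diff x)]; simp; ring

lemma pd_sum {n : ℕ} {ι : Type*} {s : Finset ι} {f : ι → Euc n → ℝ} (h : ∀ i ∈ s, Sm (f i))
    (i : Fin n) : pd i (fun x => ∑ j ∈ s, f j x) = fun x => ∑ j ∈ s, pd i (f j) x := by
  ext x; simp only [pd]; rw [fderiv_fun_sum (fun j hj => (h j hj).diff x)]; simp

lemma pd_const {n : ℕ} (c : ℝ) (i : Fin n) : pd i (fun _ : Euc n => c) = fun _ => 0 := by
  ext x; simp [pd]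

lemma pd_pd_eq {n : ℕ} {u : Euc n → ℝ} (h : Sm u) (i j : Fin n) (x : Euc n) :
    pd i (pd j u) x = fderiv ℝ (fderiv ℝ u) x (ee i) (ee j) := by
  have : pd j u = fun y => fderiv ℝ u y (ee j) := rfl
  rw [this]; simp only [pd]
  rw [fderiv_clm_apply (h.fd.differentiable (by simp) x) (by fun_prop)]
  simp

lemma pd_comm {n : ℕ} {u : Euc n → ℝ} (h : Sm u) (i j : Fin n) :
    pd i (pd j u) = pd j (pd i u) := by
  ext x
  rw [pd_pd_eq h, pd_pd_eq h]
  have := (h.contDiffAt (x := x)).isSymmSndFDerivAt (by simp; exact WithTop.coe_le_coe.mpr (le_top : (2 : ℕ∞) ≤ ⊤))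
  exact this _ _

lemma pd_congr {n : ℕ} {u v : Euc n → ℝ} {U : Set (Euc n)} (hU : IsOpen U)
    (h : ∀ x ∈ U, u x = v x) (i : Fin n) : ∀ x ∈ U, pd i u x = pd i v x := by
  intro x hx
  have : u =ᶠ[nhds x] v := Filter.eventuallyEq_of_mem (hU.mem_nhds hx) h
  simp only [pd, this.fderiv_eq]

lemma nd_congr {n : ℕ} {u v : Euc n → ℝ} {U : Set (Euc n)} (hU : IsOpen U)
    (h : ∀ x ∈ U, u x = v x) (k : ℕ) : ∀ x ∈ U, nd k u x = nd k v x := by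
  intro x hx
  have : u =ᶠ[nhds x] v := Filter.eventuallyEq_of_mem (hU.mem_nhds hx) h
  simp only [nd, (this.iteratedFDeriv ℝ k).eq_of_nhds]

lemma nd_nonneg {n : ℕ} (k : ℕ) (u : Euc n → ℝ) (x : Euc n) : 0 ≤ nd k u x := norm_nonneg _

lemma nd_zero {n : ℕ} (u : Euc n → ℝ) (x : Euc n) : nd 0 u x = |u x| := by
  simp [nd, norm_iteratedFDeriv_zero]

lemma nd_zero_fun {n : ℕ} (k : ℕ) (x : Euc n) : nd k (fun _ : Euc n => (0:ℝ)) x = 0 := by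
  simp only [nd]
  rw [iteratedFDeriv_fun_zero]; simp

lemma nd_add_le {n : ℕ} {u v : Euc n → ℝ} (hu : Sm u) (hv : Sm v) (k : ℕ) (x : Euc n) :
    nd k (fun x => u x + v x) x ≤ nd k u x + nd k v x := by
  simp only [nd]
  rw [fun_iteratedFDeriv_add_apply (hu.of_le (by exact_mod_cast le_top)).contDiffAt
    (hv.of_le (by exact_mod_cast le_top)).contDiffAt]
  exact norm_add_le _ _

lemma nd_sub_le {n : ℕ} {u v : Euc n → ℝ} (hu : Sm u) (hv : Sm v) (k : ℕ) (x : Euc n) :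
    nd k (fun x => u x - v x) x ≤ nd k u x + nd k v x := by
  simp only [nd]
  rw [fun_iteratedFDeriv_sub_apply (hu.of_le (by exact_mod_cast le_top)).contDiffAt
    (hv.of_le (by exact_mod_cast le_top)).contDiffAt]
  exact norm_sub_le _ _

lemma nd_sum_le {n : ℕ} {ι : Type*} {s : Finset ι} {f : ι → Euc n → ℝ} (h : ∀ i ∈ s, Sm (f i))
    (k : ℕ) (x : Euc n) :
    nd k (fun x => ∑ j ∈ s, f j x) x ≤ ∑ j ∈ s, nd k (f j) x := by
  classical
  induction s using Finset.induction_on with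
  | empty => simp [nd_zero_fun]
  | insert a s ha ih =>
    simp only [Finset.sum_insert ha]
    refine (nd_add_le (h a (by simp)) (Sm.sum fun i hi => h i (by simp [hi])) k x).trans ?_
    gcongr
    exact ih fun i hi => h i (by simp [hi])

lemma nd_mul_le {n : ℕ} {u v : Euc n → ℝ} (hu : Sm u) (hv : Sm v) (k : ℕ) (x : Euc n) :
    nd k (fun x => u x * v x) x ≤
      ∑ i ∈ Finset.range (k + 1), (k.choose i : ℝ) * nd i u x * nd (k - i) v x :=
  norm_iteratedFDeriv_mul_le hu hv x (by exact_mod_cast le_top)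

lemma nd_pd {n : ℕ} {u : Euc n → ℝ} (h : Sm u) (k : ℕ) (i : Fin n) (x : Euc n) :
    nd k (pd i u) x ≤ nd (k + 1) u x := by
  simp only [nd]
  rw [← norm_iteratedFDeriv_fderiv]
  have := (ContinuousLinearMap.apply ℝ ℝ (ee i)).norm_iteratedFDeriv_comp_left
    (h.fd.contDiffAt (x := x)) (n := k) (by exact_mod_cast le_top)
  refine this.trans ?_
  refine mul_le_of_le_one_left (norm_nonneg _) ?_
  refine ContinuousLinearMap.opNorm_le_bound _ zero_le_one fun f => ?_
  have := f.le_opNorm (ee i)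
  simpa [norm_ee] using this

lemma fderiv_eq_sum {n : ℕ} (u : Euc n → ℝ) (x v : Euc n) :
    fderiv ℝ u x v = ∑ i, v i * pd i u x := by
  conv_lhs => rw [← (EuclideanSpace.basisFun (Fin n) ℝ).sum_repr v]
  simp [pd, ee]

lemma nd_succ_le {n : ℕ} {u : Euc n → ℝ} (h : Sm u) (k : ℕ) (x : Euc n) :
    nd (k + 1) u x ≤ ∑ i, nd k (pd i u) x := by
  have e : fderiv ℝ u = fun y => ∑ i, pd i u y • (EuclideanSpace.proj i : Euc n →L[ℝ] ℝ) := by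
    ext y v
    rw [fderiv_eq_sum]
    simp [mul_comm]
  have h1 : ∀ i, ContDiff ℝ (⊤ : ℕ∞) fun y => pd i u y • (EuclideanSpace.proj i : Euc n →L[ℝ] ℝ) :=
    fun i => (h.pd i).smul contDiff_const
  simp only [nd]
  rw [← norm_iteratedFDeriv_fderiv, e]
  rw [iteratedFDeriv_fun_sum_apply (fun i _ => ((h1 i).of_le (by exact_mod_cast le_top)).contDiffAt)]
  refine (norm_sum_le _ _).trans ?_
  refine Finset.sum_le_sum fun i _ => ?_
  have := ((ContinuousLinearMap.id ℝ ℝ).smulRight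
    (EuclideanSpace.proj i : Euc n →L[ℝ] ℝ)).norm_iteratedFDeriv_comp_left
    ((h.pd i).contDiffAt (x := x)) (n := k) (by exact_mod_cast le_top)
  refine this.trans ?_
  refine mul_le_of_le_one_left (norm_nonneg _) ?_
  rw [ContinuousLinearMap.norm_smulRight_apply]
  refine mul_le_one₀ ContinuousLinearMap.norm_id_le (norm_nonneg _) ?_
  refine ContinuousLinearMap.opNorm_le_bound _ zero_le_one fun f => ?_
  simpa using PiLp.norm_apply_le f i

/-- iterated partial derivatives -/
def pdI {n : ℕ} : (m : ℕ) → (Fin m → Fin n) → (Euc n → ℝ) → (Euc n → ℝ)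
  | 0, _, u => u
  | (m + 1), I, u => pdI m (Fin.tail I) (pd (I 0) u)

lemma Sm.pdI {n : ℕ} {u : Euc n → ℝ} (h : Sm u) (m : ℕ) (I : Fin m → Fin n) : Sm (pdI m I u) := by
  induction m generalizing u with
  | zero => exact h
  | succ m ih => exact ih (h.pd _) _

lemma pd_pdI {n : ℕ} {u : Euc n → ℝ} (h : Sm u) (m : ℕ) (I : Fin m → Fin n) (k : Fin n) :
    pd k (pdI m I u) = pdI m I (pd k u) := by
  induction m generalizing u with
  | zero => rfl
  | succ m ih => simp only [pdI]; rw [ih (h.pd _), pd_comm h]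

lemma nd_pdI {n : ℕ} {u : Euc n → ℝ} (h : Sm u) (k m : ℕ) (I : Fin m → Fin n) (x : Euc n) :
    nd k (pdI m I u) x ≤ nd (k + m) u x := by
  induction m generalizing u with
  | zero => exact le_rfl
  | succ m ih => exact (ih (h.pd _) _).trans (nd_pd h _ _ _)

lemma abs_pdI_le {n : ℕ} {u : Euc n → ℝ} (h : Sm u) (m : ℕ) (I : Fin m → Fin n) (x : Euc n) :
    |pdI m I u x| ≤ nd m u x := by
  rw [← nd_zero]; simpa using nd_pdI h 0 m I x

lemma nd_le_sum_pdI {n : ℕ} {u : Euc n → ℝ} (h : Sm u) (m : ℕ) (x : Euc n) :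
    nd m u x ≤ ∑ I : Fin m → Fin n, |pdI m I u x| := by
  induction m generalizing u with
  | zero => simp [pdI, nd_zero]
  | succ m ih =>
    refine (nd_succ_le h m x).trans ?_
    rw [← (Fin.consEquiv (fun _ : Fin (m+1) => Fin n)).sum_comp, Fintype.sum_prod_type]
    refine Finset.sum_le_sum fun i _ => ?_
    refine (ih (h.pd i)).trans (le_of_eq ?_)
    simp [Fin.consEquiv, pdI]

lemma sdt {f f' : ℝ → ℝ} {f2 : ℝ} (h1 : ∀ᶠ t in nhds 0, HasDerivAt f (f' t) t)
    (h2 : HasDerivAt f' f2 0) (hm : IsLocalMax f 0) : f2 ≤ 0 := by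
  by_contra hc
  push Not at hc
  have e1 : deriv f =ᶠ[nhds 0] f' := h1.mono fun t ht => ht.deriv
  have e2 : deriv (deriv f) 0 = f2 := by rw [e1.deriv_eq]; exact h2.deriv
  have hmin := isLocalMin_of_deriv_deriv_pos (f := f) (x₀ := 0) (by rw [e2]; exact hc)
    hm.deriv_eq_zero h1.self_of_nhds.continuousAt
  have e3 : f =ᶠ[nhds 0] fun _ => f 0 := by
    filter_upwards [hm, hmin] with t h3 h4
    exact le_antisymm h3 h4
  have e4 : deriv f =ᶠ[nhds 0] fun _ => 0 := by
    filter_upwards [e3.eventuallyEq_nhds] with t ht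
    rw [ht.deriv_eq]; simp
  rw [e4.deriv_eq] at e2
  simp at e2; linarith

lemma barrier {E : Type*} [NormedAddCommGroup E] [InnerProductSpace ℝ E] (Q ρ : ℝ) (hQ : 0 ≤ Q)
    (k : ℕ) (y v : E) (hy : ‖y‖ < ρ) :
    ∃ (h' : ℝ → ℝ) (h2 : ℝ),
      (∀ᶠ t in nhds (0:ℝ), HasDerivAt (fun t : ℝ => Q * ((ρ^2 - ‖y + t • v‖^2)⁻¹)^k) (h' t) t) ∧
      HasDerivAt h' h2 0 ∧
      h2 ≤ Q * (4 * k * (k+1) + 2 * k) * ρ^2 * ‖v‖^2 * ((ρ^2 - ‖y‖^2)⁻¹)^(k+2) := by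
  have hρ : 0 ≤ ‖y‖ := norm_nonneg y
  have hs0 : 0 < ρ^2 - ‖y‖^2 := by nlinarith
  set s : ℝ → ℝ := fun t => ρ^2 - ‖y‖^2 - 2 * t * inner ℝ y v - t^2 * ‖v‖^2 with hs
  set p : ℝ → ℝ := fun t => 2 * inner ℝ y v + 2 * t * ‖v‖^2 with hp
  have es : (fun t : ℝ => Q * ((ρ^2 - ‖y + t • v‖^2)⁻¹)^k) = fun t => Q * ((s t)⁻¹)^k := by
    ext t
    have h0 : ρ^2 - ‖y + t • v‖^2 = s t := by
      rw [norm_add_sq_real, inner_smul_right, norm_smul, mul_pow, Real.norm_eq_abs, sq_abs]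
      simp only [hs]; ring
    rw [h0]
  have ds : ∀ t, HasDerivAt s (-p t) t := by
    intro t
    have h1 := ((hasDerivAt_id t).const_mul 2).mul_const (inner ℝ y v)
    have h2 := (hasDerivAt_pow 2 t).mul_const (‖v‖^2)
    have := ((hasDerivAt_const t (ρ^2 - ‖y‖^2)).sub h1).sub h2
    refine this.congr_deriv ?_
    simp [hp]; ring
  have dp : ∀ t, HasDerivAt p (2 * ‖v‖^2) t := by
    intro t
    have h1 := ((hasDerivAt_id t).const_mul 2).mul_const (‖v‖^2)
    refine (h1.const_add (2 * inner ℝ y v)).congr_deriv ?_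
    simp
  have s0 : s 0 = ρ^2 - ‖y‖^2 := by simp [hs]
  have dr : ∀ t, s t ≠ 0 → HasDerivAt (fun t => (s t)⁻¹) (p t * ((s t)⁻¹)^2) t := by
    intro t ht
    refine ((ds t).inv ht).congr_deriv ?_
    field_simp
  have hev : ∀ᶠ t in nhds (0:ℝ), s t ≠ 0 :=
    (ds 0).continuousAt.eventually_ne (by rw [s0]; exact hs0.ne')
  have dpow : ∀ t, s t ≠ 0 → ∀ j : ℕ, HasDerivAt (fun t => ((s t)⁻¹)^j)
      (j * ((s t)⁻¹)^(j+1) * p t) t := by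
    intro t ht j
    refine ((dr t ht).pow j).congr_deriv ?_
    rcases j with _ | j
    · simp
    · simp only [Nat.add_sub_cancel]; ring
  refine ⟨fun t => Q * (k * ((s t)⁻¹)^(k+1) * p t),
    Q * (k * (((k+1:ℕ):ℝ) * ((s 0)⁻¹)^(k+1+1) * p 0) * p 0 + k * ((s 0)⁻¹)^(k+1) * (2*‖v‖^2)),
    ?_, ?_, ?_⟩
  · rw [es]
    filter_upwards [hev] with t ht
    exact (dpow t ht k).const_mul Q
  · exact (((dpow 0 (by rw [s0]; exact hs0.ne') (k+1)).const_mul (k:ℝ)).mul (dp 0)).const_mul Q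
  · rw [s0]
    have hp0 : p 0 = 2 * inner ℝ y v := by simp [hp]
    have hcs : (inner ℝ y v)^2 ≤ ρ^2 * ‖v‖^2 := by
      have h := abs_real_inner_le_norm y v
      have h2 : |inner ℝ y v|^2 ≤ (‖y‖*‖v‖)^2 := by gcongr
      rw [sq_abs] at h2
      calc _ ≤ (‖y‖*‖v‖)^2 := h2
        _ = ‖y‖^2 * ‖v‖^2 := by ring
        _ ≤ _ := by gcongr
    set S := ρ^2 - ‖y‖^2 with hS
    have hSi : 0 < S⁻¹ := inv_pos.mpr hs0
    have e : Q * (k * (((k+1:ℕ):ℝ) * (S⁻¹)^(k+1+1) * p 0) * p 0 + k * (S⁻¹)^(k+1) * (2*‖v‖^2))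
       = Q * ((S⁻¹)^(k+2) * (k*(k+1) * 4 * (inner ℝ y v)^2 + 2 * k * ‖v‖^2 * S)) := by
      rw [hp0]
      have : (S⁻¹)^(k+1) = (S⁻¹)^(k+2) * S := by
        rw [pow_succ _ (k+1), mul_assoc, inv_mul_cancel₀ hs0.ne', mul_one]
      rw [this]; push_cast; ring
    rw [e]
    have hSρ : S ≤ ρ^2 := by rw [hS]; nlinarith
    calc Q * ((S⁻¹)^(k+2) * (k*(k+1) * 4 * (inner ℝ y v)^2 + 2 * k * ‖v‖^2 * S))
        ≤ Q * ((S⁻¹)^(k+2) * (k*(k+1) * 4 * (ρ^2 * ‖v‖^2) + 2 * k * ‖v‖^2 * ρ^2)) := by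
          gcongr
      _ = _ := by ring

lemma exists_max {X : Type*} [TopologicalSpace X] (D : Set X) (F s : X → ℝ)
    (hF : Continuous F) (hs : Continuous s) (Q : ℝ) (hQ : 0 < Q) (k : ℕ) (hk : k ≠ 0)
    (hs0 : ∀ x ∈ D, 0 ≤ s x)
    (hc : ∀ m > 0, IsCompact {x | x ∈ D ∧ Q ≤ (F x - m) * s x ^ k})
    (x₁ : X) (h1 : x₁ ∈ D) (h2 : 0 < s x₁) (h3 : Q * ((s x₁)⁻¹)^k < F x₁) :
    ∃ x₀ ∈ D, 0 < s x₀ ∧ Q * ((s x₀)⁻¹)^k < F x₀ ∧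
      ∀ x ∈ D, 0 < s x → F x - Q * ((s x)⁻¹)^k ≤ F x₀ - Q * ((s x₀)⁻¹)^k := by
  set m := F x₁ - Q * ((s x₁)⁻¹)^k with hm
  have hm0 : 0 < m := by linarith
  have key : ∀ x, 0 < s x → (Q ≤ (F x - m) * s x ^ k ↔ m ≤ F x - Q * ((s x)⁻¹)^k) := by
    intro x hx
    have : 0 < s x ^ k := by positivity
    rw [← div_le_iff₀ this, inv_pow, ← div_eq_mul_inv]
    constructor <;> intro h <;> linarith
  have hpos : ∀ x, x ∈ D ∧ Q ≤ (F x - m) * s x ^ k → 0 < s x := by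
    rintro x ⟨hx, hx2⟩
    rcases (hs0 x hx).lt_or_eq with h | h
    · exact h
    · rw [← h, zero_pow hk, mul_zero] at hx2; linarith
  have hcont : ContinuousOn (fun x => F x - Q * ((s x)⁻¹)^k)
      {x | x ∈ D ∧ Q ≤ (F x - m) * s x ^ k} := by
    refine hF.continuousOn.sub (continuousOn_const.mul ((hs.continuousOn.inv₀ ?_).pow k))
    intro x hx; exact (hpos x hx).ne'
  obtain ⟨x₀, hx₀, hmax⟩ := (hc m hm0).exists_isMaxOn
    ⟨x₁, h1, (key x₁ h2).2 le_rfl⟩ hcont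
  have h4 := (key x₀ (hpos x₀ hx₀)).1 hx₀.2
  refine ⟨x₀, hx₀.1, hpos x₀ hx₀, by linarith, ?_⟩
  intro x hx hsx
  by_cases hxx : Q ≤ (F x - m) * s x ^ k
  · exact hmax (show x ∈ {x | x ∈ D ∧ Q ≤ (F x - m) * s x ^ k} from ⟨hx, hxx⟩)
  · have := (key x hsx).not.1 hxx
    linarith

def Lop {n : ℕ} (a : Fin n → Fin n → Euc n → ℝ) (u : Euc n → ℝ) : Euc n → ℝ :=
  fun x => ∑ i, ∑ j, a i j x * pd i (pd j u) x

lemma fderiv2_eq_sum {n : ℕ} {u : Euc n → ℝ} (h : Sm u) (x v v' : Euc n) :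
    fderiv ℝ (fderiv ℝ u) x v v' = ∑ i, ∑ j, v i * v' j * pd i (pd j u) x := by
  have e : ∀ z : Euc n, z = ∑ i, z i • ee i := by
    intro z
    conv_lhs => rw [← (EuclideanSpace.basisFun (Fin n) ℝ).sum_repr z]
    simp [ee]
  conv_lhs => rw [e v, e v']
  simp only [map_sum, map_smul, sum_apply, smul_apply,
    smul_eq_mul, pd_pd_eq h, Finset.mul_sum]
  rw [Finset.sum_comm]
  refine Finset.sum_congr rfl fun i _ => Finset.sum_congr rfl fun j _ => by ring

lemma line_deriv1 {n : ℕ} {u : Euc n → ℝ} (h : Sm u) (x v : Euc n) (t : ℝ) :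
    HasDerivAt (fun t : ℝ => u (x + t • v)) (fderiv ℝ u (x + t • v) v) t := by
  have h1 : HasDerivAt (fun t : ℝ => x + t • v) v t := by
    simpa using ((hasDerivAt_id t).smul_const v).const_add x
  exact (h.diff _).hasFDerivAt.comp_hasDerivAt t h1

lemma line_deriv2 {n : ℕ} {u : Euc n → ℝ} (h : Sm u) (x v : Euc n) (t : ℝ) :
    HasDerivAt (fun t : ℝ => fderiv ℝ u (x + t • v) v)
      (fderiv ℝ (fderiv ℝ u) (x + t • v) v v) t := by
  have h1 : HasDerivAt (fun t : ℝ => x + t • v) v t := by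
    simpa using ((hasDerivAt_id t).smul_const v).const_add x
  have h2 := ((h.fd.differentiable (by simp)) (x + t • v)).hasFDerivAt.comp_hasDerivAt t h1
  have h3 := h2.clm_apply (hasDerivAt_const t v)
  simpa using h3

open scoped MatrixOrder in
lemma psd_sq {n : ℕ} {A : Matrix (Fin n) (Fin n) ℝ} (h : A.PosSemidef) :
    ∃ R : Matrix (Fin n) (Fin n) ℝ, A = R.conjTranspose * R := by
  obtain ⟨R, hR, -, h2⟩ := CFC.exists_sqrt_of_isSelfAdjoint_of_quasispectrumRestricts h.isHermitian
          (QuasispectrumRestricts.nnreal_of_nonneg h.nonneg)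
  refine ⟨R, ?_⟩
  rw [← Matrix.star_eq_conjTranspose, hR.star_eq, ← h2]

lemma max_principle {n : ℕ} (a : Fin n → Fin n → Euc n → ℝ) (c : Euc n) (ρ T κ B : ℝ)
    (hρ : 0 < ρ) (hρ1 : ρ ≤ 1) (hκ : 0 < κ) (hκ1 : κ ≤ 1) (hT : 0 ≤ T) (hB : 0 ≤ B)
    (ha : ∀ x ∈ Metric.ball c ρ, (Matrix.of fun i j => a i j x).PosSemidef)
    (hTr : ∀ x ∈ Metric.ball c ρ, ∑ i, a i i x ≤ T)
    (F : Euc n → ℝ) (hF : Sm F)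
    (hL : ∀ x ∈ Metric.ball c ρ, 0 ≤ F x → κ * F x ^ 2 - B ≤ Lop a F x) :
    F c ≤ (28 * T + B + 1) / (κ * ρ^4) := by
  by_contra hcon
  push Not at hcon
  set Q := (28 * T + B + 1) / κ with hQdef
  have hQ : 0 < Q := by positivity
  have hQ1 : 1 ≤ Q := by rw [hQdef, le_div_iff₀ hκ]; linarith
  have hκQ : κ * Q = 28 * T + B + 1 := by rw [hQdef]; field_simp
  set s : Euc n → ℝ := fun x => ρ^2 - ‖x - c‖^2 with hs
  have hsc : Continuous s := by fun_prop
  have hsD : ∀ x, 0 < s x → x ∈ Metric.ball c ρ := by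
    intro x hx
    rw [mem_ball_iff_norm]
    simp only [hs] at hx
    exact lt_of_pow_lt_pow_left₀ 2 hρ.le (by linarith)
  obtain ⟨x₀, -, hs0, hgt, hmax⟩ := exists_max (Metric.closedBall c ρ) F s hF.continuous hsc Q hQ 2
    (by norm_num) (by
      intro x hx
      rw [mem_closedBall_iff_norm] at hx
      simp only [hs]
      have := norm_nonneg (x - c)
      nlinarith) (by
      intro m hm
      refine (isCompact_closedBall c ρ).inter_right (t := {x | Q ≤ (F x - m) * s x ^ 2}) ?_
      exact isClosed_le continuous_const ((hF.continuous.sub continuous_const).mul (hsc.pow 2))) c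
      (by simp [hρ.le]) (by simp [hs]; positivity) (by
        simp only [hs, sub_self, norm_zero]
        refine lt_of_le_of_lt (le_of_eq ?_) hcon
        simp only [hQdef]; field_simp; ring)
  have hx0 := hsD x₀ hs0
  have hF0 : 0 < F x₀ := lt_of_le_of_lt (by positivity) hgt
  -- directional inequality
  have hdir : ∀ v : Euc n, fderiv ℝ (fderiv ℝ F) x₀ v v ≤
      28 * Q * ρ^2 * ‖v‖^2 * ((s x₀)⁻¹)^4 := by
    intro v
    obtain ⟨h', h2, hh1, hh2, hh3⟩ := barrier Q ρ hQ.le 2 (x₀ - c) v (by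
      rwa [mem_ball_iff_norm] at hx0)
    have := sdt (f := fun t : ℝ => F (x₀ + t • v) - Q * ((ρ^2 - ‖x₀ - c + t • v‖^2)⁻¹)^2)
      (f' := fun t => fderiv ℝ F (x₀ + t • v) v - h' t) (f2 := fderiv ℝ (fderiv ℝ F) x₀ v v - h2)
      (by
        filter_upwards [hh1] with t ht
        exact (line_deriv1 hF x₀ v t).sub ht)
      (by
        have := line_deriv2 hF x₀ v 0
        simp only [zero_smul, add_zero] at this
        exact this.sub hh2)
      (by
        have hcl : Continuous fun t : ℝ => s (x₀ + t • v) := by fun_prop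
        have : ∀ᶠ t : ℝ in nhds 0, 0 < s (x₀ + t • v) :=
          hcl.continuousAt.eventually (lt_mem_nhds (by simpa using hs0))
        filter_upwards [this] with t ht
        have h5 := hmax _ (Metric.ball_subset_closedBall (hsD _ ht)) ht
        have e : s (x₀ + t • v) = ρ^2 - ‖x₀ - c + t • v‖^2 := by
          simp only [hs]; congr 3; abel
        rw [e] at h5
        simpa [hs] using h5)
    have e : ρ^2 - ‖x₀ - c‖^2 = s x₀ := rfl
    rw [e] at hh3
    have e2 : Q * (4 * ((2:ℕ):ℝ) * (((2:ℕ):ℝ)+1) + 2 * ((2:ℕ):ℝ)) * ρ^2 * ‖v‖^2 * ((s x₀)⁻¹)^(2+2)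
      = 28 * Q * ρ^2 * ‖v‖^2 * ((s x₀)⁻¹)^4 := by push_cast; ring
    rw [e2] at hh3
    linarith
  obtain ⟨R, hR⟩ := psd_sq (ha x₀ hx0)
  have haR : ∀ i j, a i j x₀ = ∑ l, R l i * R l j := by
    intro i j
    have := congrFun (congrFun hR i) j
    simpa [Matrix.mul_apply] using this
  set v : Fin n → Euc n := fun l => WithLp.toLp 2 (R l) with hv
  have hLF : Lop a F x₀ = ∑ l, fderiv ℝ (fderiv ℝ F) x₀ (v l) (v l) := by
    simp only [fderiv2_eq_sum hF, Lop, haR, Finset.sum_mul]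
    rw [Finset.sum_comm' (s := Finset.univ) (t := fun _ => Finset.univ) (s' := fun _ => Finset.univ)
      (t' := Finset.univ) (by simp)]
    rw [Finset.sum_comm]
    conv_rhs => rw [Finset.sum_comm]
    refine Finset.sum_congr rfl fun i _ => ?_
    rw [Finset.sum_comm]
  have hvT : ∑ l, ‖v l‖^2 ≤ T := by
    refine le_trans (le_of_eq ?_) (hTr x₀ hx0)
    simp only [EuclideanSpace.norm_sq_eq, haR, hv]
    rw [Finset.sum_comm]
    simp [sq]
  have h1 : Lop a F x₀ ≤ 28 * Q * ρ^2 * T * ((s x₀)⁻¹)^4 := by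
    rw [hLF]
    calc _ ≤ ∑ l, 28 * Q * ρ^2 * ‖v l‖^2 * ((s x₀)⁻¹)^4 := Finset.sum_le_sum fun l _ => hdir _
      _ = 28 * Q * ρ^2 * (∑ l, ‖v l‖^2) * ((s x₀)⁻¹)^4 := by
        rw [Finset.mul_sum, Finset.sum_mul]
      _ ≤ _ := by gcongr
  have h2 := hL x₀ hx0 hF0.le
  have hsi : 1 ≤ (s x₀)⁻¹ := by
    rw [one_le_inv₀ hs0]
    simp only [hs]
    have := sq_nonneg ‖x₀ - c‖
    nlinarith
  have h3 : Q^2 * ((s x₀)⁻¹)^4 < F x₀ ^ 2 := by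
    have : (Q * ((s x₀)⁻¹)^2)^2 < F x₀ ^ 2 := by gcongr
    calc _ = (Q * ((s x₀)⁻¹)^2)^2 := by ring
      _ < _ := this
  have h4 : 1 ≤ ((s x₀)⁻¹)^4 := one_le_pow₀ hsi
  set z := ((s x₀)⁻¹)^4 with hz
  have hρ2 : ρ^2 ≤ 1 := pow_le_one₀ hρ.le hρ1
  have h5 : 28 * Q * ρ^2 * T * z ≤ 28 * Q * 1 * T * z := by gcongr
  have h6 : κ * (Q^2 * z) < κ * F x₀ ^2 := by gcongr
  have h7 : κ * (Q^2 * z) = (28 * T + B + 1) * (Q * z) := by rw [← hκQ]; ring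
  have h8 : 1 ≤ Q * z := one_le_mul_of_one_le_of_one_le hQ1 h4
  nlinarith

def Gam {n : ℕ} (a : Fin n → Fin n → Euc n → ℝ) (f g : Euc n → ℝ) (x : Euc n) : ℝ :=
  ∑ i, ∑ j, a i j x * (pd i f x * pd j g x)

lemma Lop_mul {n : ℕ} (a : Fin n → Fin n → Euc n → ℝ) {f g : Euc n → ℝ} (hf : Sm f) (hg : Sm g)
    (x : Euc n) (hs : ∀ i j, a i j x = a j i x) :
    Lop a (fun x => f x * g x) x = f x * Lop a g x + g x * Lop a f x + 2 * Gam a f g x := by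
  have h1 : ∀ i j, pd i (pd j fun x => f x * g x) x =
      pd i (pd j f) x * g x + pd j f x * pd i g x + (pd i f x * pd j g x + f x * pd i (pd j g) x) := by
    intro i j
    rw [pd_mul hf hg, pd_add ((hf.pd j).mul hg) (hf.mul (hg.pd j)), pd_mul (hf.pd j) hg,
      pd_mul hf (hg.pd j)]
  have h2 : ∑ i, ∑ j, a i j x * (pd j f x * pd i g x) = Gam a f g x := by
    rw [Finset.sum_comm, Gam]
    refine Finset.sum_congr rfl fun i _ => Finset.sum_congr rfl fun j _ => ?_
    rw [hs j i]
  simp only [Lop, h1]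
  rw [two_mul]
  nth_rewrite 1 [← h2]
  simp only [Gam, Finset.mul_sum, ← Finset.sum_add_distrib]
  refine Finset.sum_congr rfl fun i _ => Finset.sum_congr rfl fun j _ => ?_
  ring

lemma Lop_sum {n : ℕ} (a : Fin n → Fin n → Euc n → ℝ) {ι : Type*} {s : Finset ι}
    {f : ι → Euc n → ℝ} (hf : ∀ i ∈ s, Sm (f i)) (x : Euc n) :
    Lop a (fun x => ∑ i ∈ s, f i x) x = ∑ i ∈ s, Lop a (f i) x := by
  simp only [Lop]
  have : ∀ i j, pd i (pd j fun x => ∑ l ∈ s, f l x) x = ∑ l ∈ s, pd i (pd j (f l)) x := by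
    intro i j
    rw [pd_sum hf, pd_sum (fun l hl => (hf l hl).pd j)]
  simp only [this, Finset.mul_sum]
  conv_rhs => rw [Finset.sum_comm]
  refine Finset.sum_congr rfl fun i _ => ?_
  rw [Finset.sum_comm]

lemma Lop_sumsq {n : ℕ} (a : Fin n → Fin n → Euc n → ℝ) {ι : Type*} [Fintype ι]
    {f : ι → Euc n → ℝ} (hf : ∀ i, Sm (f i)) (x : Euc n) (hs : ∀ i j, a i j x = a j i x) :
    Lop a (fun x => ∑ i, f i x * f i x) x =
      ∑ i, (2 * (f i x * Lop a (f i) x) + 2 * Gam a (f i) (f i) x) := by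
  rw [Lop_sum a (fun i _ => (hf i).mul (hf i))]
  refine Finset.sum_congr rfl fun i _ => ?_
  rw [Lop_mul a (hf i) (hf i) x hs]; ring

lemma pd_sumsq {n : ℕ} {ι : Type*} [Fintype ι]
    {f : ι → Euc n → ℝ} (hf : ∀ i, Sm (f i)) (x : Euc n) (k : Fin n) :
    pd k (fun x => ∑ i, f i x * f i x) x = ∑ i, 2 * (f i x * pd k (f i) x) := by
  rw [pd_sum (fun i _ => (hf i).mul (hf i))]
  refine Finset.sum_congr rfl fun i _ => ?_
  rw [pd_mul (hf i) (hf i)]; ring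

lemma abs_le_sqrt_sumsq {ι : Type*} [Fintype ι] (u : ι → ℝ) (i : ι) :
    |u i| ≤ √(∑ j, u j * u j) := by
  refine Real.abs_le_sqrt ?_
  rw [sq]
  exact Finset.single_le_sum (f := fun j => u j * u j) (fun j _ => mul_self_nonneg _)
    (Finset.mem_univ i)

lemma abs_sum_le_card {ι : Type*} [Fintype ι] (u : ι → ℝ) (C R : ℝ) (hC : 0 ≤ C)
    (hR : (Fintype.card ι : ℝ) ≤ R) (h : ∀ i, |u i| ≤ C) : |∑ i, u i| ≤ R * C := by
  refine (Finset.abs_sum_le_sum_abs _ _).trans ?_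
  refine (Finset.sum_le_card_nsmul _ _ C (fun i _ => h i)).trans ?_
  rw [nsmul_eq_mul]
  exact mul_le_mul_of_nonneg_right (by simpa using hR) hC

/-- scalar inequality for the Bernstein argument -/
lemma bern_arith (R γ θ P A LP LG cr : ℝ) (hR : 2 ≤ R) (hγ : 0 ≤ γ) (hθ : 0 ≤ θ)
    (hP : 0 ≤ P) (hP2 : P ≤ R^3) (hA : A = 32 * R^16)
    (hLP : 2 / R * γ^2 - 2 * R^3 * (1 + γ) ≤ LP)
    (hLG : 2 / R * θ^2 - 2 * R^3 * γ * (1 + γ^2 + θ) ≤ LG)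
    (hcr : -(8 * R^7 * (γ^2 * θ)) ≤ cr) :
    (R^45)⁻¹ * ((A + P) * γ^2)^2 - R^135 ≤ (A + P) * LG + γ^2 * LP + cr := by
  have hR0 : 0 < R := by linarith
  have hA0 : 0 < A := by rw [hA]; positivity
  set K := A + P with hK
  have hKA : A ≤ K := by linarith
  have hK0 : 0 < K := by linarith
  have h2 : ∀ k : ℕ, (2:ℝ)^k ≤ R^k := fun k => by gcongr
  have hKR : K ≤ R^22 := by
    have h1 : R^3 ≤ R^16 := pow_le_pow_right₀ (by linarith) (by norm_num)
    have h3 : (64:ℝ) ≤ R^6 := by have := h2 6; norm_num at this; exact this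
    have h4 : R^22 = R^6 * R^16 := by ring
    have : 0 < R^16 := by positivity
    nlinarith
  have hK1 : 1 ≤ K := by
    have : 1 ≤ R^16 := one_le_pow₀ (by linarith)
    nlinarith
  -- LG bound
  have b1 : 1 / R * θ^2 - R^7 * γ^2 - 2 * R^3 * (γ + γ^3) ≤ LG := by
    have : 2 * R^3 * γ * θ ≤ 1 / R * θ^2 + R^7 * γ^2 := by
      have h := sq_nonneg (θ - R^4 * γ)
      have e : 1 / R * θ^2 + R^7 * γ^2 - 2 * R^3 * γ * θ = 1 / R * (θ - R^4 * γ)^2 := by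
        field_simp
        ring
      have : 0 ≤ 1 / R * (θ - R^4 * γ)^2 := by positivity
      linarith
    have e2 : 2 * R^3 * γ * (1 + γ^2 + θ) = 2 * R^3 * γ * θ + 2 * R^3 * (γ + γ^3) := by ring
    have e3 : 2 / R * θ^2 = 1 / R * θ^2 + 1 / R * θ^2 := by ring
    linarith
  have b2 : K * (1 / R * θ^2) - R^22 * (R^7 * γ^2 + 2 * R^3 * (γ + γ^3)) ≤ K * LG := by
    have h1 := mul_le_mul_of_nonneg_left b1 hK0.le
    have h3 : K * (R^7 * γ^2 + 2 * R^3 * (γ + γ^3)) ≤ R^22 * (R^7 * γ^2 + 2 * R^3 * (γ + γ^3)) := by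
      gcongr
    linarith
  have b3 : 32 * R^15 * θ^2 ≤ K * (1 / R * θ^2) := by
    have : 32 * R^15 * θ^2 = A * (1 / R * θ^2) := by rw [hA]; field_simp
    rw [this]; gcongr
  have b4 : 8 * R^7 * (γ^2 * θ) ≤ 1 / (2 * R) * γ^4 + 32 * R^15 * θ^2 := by
    have e : 1 / (2 * R) * γ^4 + 32 * R^15 * θ^2 - 8 * R^7 * (γ^2 * θ)
      = 1 / (2 * R) * (γ^2 - 8 * R^8 * θ)^2 := by field_simp; ring
    have : 0 ≤ 1 / (2 * R) * (γ^2 - 8 * R^8 * θ)^2 := by positivity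
    linarith
  have b5 : 2 / R * γ^4 - 2 * R^3 * (γ^2 + γ^3) ≤ γ^2 * LP := by
    have h1 := mul_le_mul_of_nonneg_left hLP (sq_nonneg γ)
    have e : γ^2 * (2 / R * γ^2 - 2 * R^3 * (1 + γ)) = 2 / R * γ^4 - 2 * R^3 * (γ^2 + γ^3) := by ring
    linarith
  have g1 : γ ≤ 1 + γ^3 := by
    rcases le_total γ 1 with h | h
    · have : 0 ≤ γ^3 := by positivity
      linarith
    · have : γ^1 ≤ γ^3 := pow_le_pow_right₀ h (by norm_num)
      linarith
  have g2 : γ^2 ≤ 1 + γ^3 := by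
    rcases le_total γ 1 with h | h
    · have : 0 ≤ γ^3 := by positivity
      have : γ^2 ≤ 1 := pow_le_one₀ hγ h
      linarith
    · have : γ^2 ≤ γ^3 := pow_le_pow_right₀ h (by norm_num)
      linarith
  have b6 : R^22 * (R^7 * γ^2 + 2 * R^3 * (γ + γ^3)) + 2 * R^3 * (γ^2 + γ^3) ≤ R^31 * (1 + γ^3) := by
    have h3 : 0 ≤ γ^3 := by positivity
    have c1 : R^22 * (R^7 * γ^2) ≤ R^29 * (1 + γ^3) := by
      have : R^22 * (R^7 * γ^2) = R^29 * γ^2 := by ring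
      rw [this]; gcongr
    have c2 : R^22 * (2 * R^3 * (γ + γ^3)) ≤ 4 * R^25 * (1 + γ^3) := by
      have : R^22 * (2 * R^3 * (γ + γ^3)) = 2 * R^25 * (γ + γ^3) := by ring
      rw [this]
      have : γ + γ^3 ≤ 2 * (1 + γ^3) := by linarith
      calc 2 * R^25 * (γ + γ^3) ≤ 2 * R^25 * (2 * (1 + γ^3)) := by gcongr
        _ = _ := by ring
    have c3 : 2 * R^3 * (γ^2 + γ^3) ≤ 4 * R^3 * (1 + γ^3) := by
      have : γ^2 + γ^3 ≤ 2 * (1 + γ^3) := by linarith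
      calc 2 * R^3 * (γ^2 + γ^3) ≤ 2 * R^3 * (2 * (1 + γ^3)) := by gcongr
        _ = _ := by ring
    have c4 : R^29 + 4 * R^25 + 4 * R^3 ≤ R^31 := by
      have d1 : R^3 ≤ R^25 := pow_le_pow_right₀ (by linarith) (by norm_num)
      have d2 : 16 ≤ R^4 := by have := h2 4; norm_num at this; exact this
      have d3 : R^29 = R^4 * R^25 := by ring
      have d4 : R^31 = R^2 * R^29 := by ring
      have d5 : 4 ≤ R^2 := by have := h2 2; norm_num at this; exact this
      have : 0 < R^25 := by positivity
      have : 0 < R^29 := by positivity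
      nlinarith
    have := mul_le_mul_of_nonneg_right c4 (by linarith : 0 ≤ 1 + γ^3)
    nlinarith
  have b7 : R^31 * (1 + γ^3) ≤ 1 / (2 * R) * γ^4 + R^135 := by
    have d31 : R^31 ≤ R^134 := pow_le_pow_right₀ (by linarith) (by norm_num)
    have dd : 2 * R^134 ≤ R^135 := by
      have : R^135 = R * R^134 := by ring
      rw [this]; gcongr
    rcases le_total γ (2 * R^32) with h | h
    · have : R^31 * γ^3 ≤ R^134 := by
        calc R^31 * γ^3 ≤ R^31 * (2 * R^32)^3 := by gcongr
          _ = 2^3 * R^127 := by ring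
          _ ≤ R^3 * R^127 := by gcongr
          _ = R^130 := by ring
          _ ≤ R^134 := pow_le_pow_right₀ (by linarith) (by norm_num)
      have : 0 ≤ 1 / (2 * R) * γ^4 := by positivity
      linarith
    · have : R^31 * γ^3 ≤ 1 / (2 * R) * γ^4 := by
        have e : R^31 * γ^3 = 1 / (2 * R) * (γ^3 * (2 * R^32)) := by field_simp
        have e' : γ^4 = γ^3 * γ := by ring
        rw [e, e']; gcongr
      have : 0 < R^134 := by positivity
      linarith
  have b8 : (R^45)⁻¹ * (K * γ^2)^2 ≤ 1 / R * γ^4 := by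
    calc (R^45)⁻¹ * (K * γ^2)^2 = (R^45)⁻¹ * (K^2 * γ^4) := by ring
      _ ≤ (R^45)⁻¹ * ((R^22)^2 * γ^4) := by gcongr
      _ = 1 / R * γ^4 := by field_simp
  have e1 : 2 / R * γ^4 = 1 / R * γ^4 + 1 / (2 * R) * γ^4 + 1 / (2 * R) * γ^4 := by ring
  linarith

/-- ellipticity and bounds of the coefficients on a set -/
structure Ell {n : ℕ} (a : Fin n → Fin n → Euc n → ℝ) (S : Set (Euc n)) (M : ℝ) : Prop where
  symm : ∀ x ∈ S, ∀ i j, a i j x = a j i x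
  ell : ∀ x ∈ S, ∀ ξ : Fin n → ℝ, M⁻¹ * ∑ i, ξ i * ξ i ≤ ∑ i, ∑ j, a i j x * (ξ i * ξ j)
  bdd : ∀ x ∈ S, ∀ i j, |a i j x| ≤ M

lemma Ell.mono {n : ℕ} {a : Fin n → Fin n → Euc n → ℝ} {S S' : Set (Euc n)} {M M' : ℝ}
    (h : Ell a S M) (hS : S' ⊆ S) (hM0 : 0 < M) (hM : M ≤ M') : Ell a S' M' where
  symm x hx := h.symm x (hS hx)
  ell x hx ξ := by
    refine le_trans ?_ (h.ell x (hS hx) ξ)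
    have : 0 ≤ ∑ i, ξ i * ξ i := Finset.sum_nonneg fun i _ => mul_self_nonneg _
    gcongr
  bdd x hx i j := (h.bdd x (hS hx) i j).trans hM

lemma Ell.psd {n : ℕ} {a : Fin n → Fin n → Euc n → ℝ} {S : Set (Euc n)} {M : ℝ}
    (h : Ell a S M) (hM : 0 < M) (x : Euc n) (hx : x ∈ S) :
    (Matrix.of fun i j => a i j x).PosSemidef := by
  refine Matrix.PosSemidef.of_dotProduct_mulVec_nonneg ?_ ?_
  · ext i j
    simp [h.symm x hx i j]
  · intro ξ
    have h1 := h.ell x hx ξ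
    have : 0 ≤ ∑ i, ξ i * ξ i := Finset.sum_nonneg fun i _ => mul_self_nonneg _
    have h2 : 0 ≤ M⁻¹ * ∑ i, ξ i * ξ i := by positivity
    refine (h2.trans h1).trans (le_of_eq ?_)
    simp only [dotProduct, Matrix.mulVec, Finset.mul_sum, Matrix.of_apply]
    refine Finset.sum_congr rfl fun i _ => Finset.sum_congr rfl fun j _ => ?_
    simp; ring

lemma Ell.gam {n : ℕ} {a : Fin n → Fin n → Euc n → ℝ} {S : Set (Euc n)} {M : ℝ}
    (h : Ell a S M) (x : Euc n) (hx : x ∈ S) (f : Euc n → ℝ) :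
    M⁻¹ * ∑ i, pd i f x * pd i f x ≤ Gam a f f x := h.ell x hx _

def sqG {n : ℕ} {ι : Type*} [Fintype ι] (U : ι → Euc n → ℝ) (x : Euc n) : ℝ :=
  ∑ p : ι × Fin n, pd p.2 (U p.1) x * pd p.2 (U p.1) x

def sqH {n : ℕ} {ι : Type*} [Fintype ι] (U : ι → Euc n → ℝ) (x : Euc n) : ℝ :=
  ∑ q : (ι × Fin n) × Fin n, pd q.2 (pd q.1.2 (U q.1.1)) x * pd q.2 (pd q.1.2 (U q.1.1)) x

lemma bern_core {n : ℕ} {ι : Type*} [Fintype ι] (R : ℝ) (hR : 2 ≤ R)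
    (hι : (Fintype.card ι : ℝ) ≤ R) (hn : (n : ℝ) ≤ R) (c : Euc n) (ρ : ℝ) (hρ : 0 < ρ)
    (hρ1 : ρ ≤ 1) (hρR : ρ⁻¹ ≤ R) (a : Fin n → Fin n → Euc n → ℝ)
    (hE : Ell a (Metric.ball c ρ) R) (U : ι → Euc n → ℝ) (hU : ∀ s, Sm (U s))
    (hb : ∀ x ∈ Metric.ball c ρ, ∀ s, |U s x| ≤ R)
    (h1 : ∀ x ∈ Metric.ball c ρ, ∀ s, |Lop a (U s) x| ≤ R * (1 + √(sqG U x)))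
    (h2 : ∀ x ∈ Metric.ball c ρ, ∀ s k, |Lop a (pd k (U s)) x| ≤
      R * (1 + sqG U x + √(sqH U x))) :
    sqG U c ≤ R^200 := by
  have hR0 : 0 < R := by linarith
  set P : Euc n → ℝ := fun x => ∑ s, U s x * U s x with hP
  set A : ℝ := 32 * R^16 with hA
  have hPs : Sm P := Sm.sum fun s _ => (hU s).mul (hU s)
  have hAP : Sm (fun x => A + P x) := contDiff_const.add hPs
  have hGs : Sm (sqG U) := Sm.sum fun p _ => ((hU p.1).pd p.2).mul ((hU p.1).pd p.2)
  set F : Euc n → ℝ := fun x => (A + P x) * sqG U x with hF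
  have hFs : Sm F := hAP.mul hGs
  have hP0 : ∀ x, 0 ≤ P x := fun x => Finset.sum_nonneg fun i _ => mul_self_nonneg _
  have hG0 : ∀ x, 0 ≤ sqG U x := fun x => Finset.sum_nonneg fun i _ => mul_self_nonneg _
  have hH0 : ∀ x, 0 ≤ sqH U x := fun x => Finset.sum_nonneg fun i _ => mul_self_nonneg _
  have hcard : (Fintype.card (ι × Fin n) : ℝ) ≤ R^2 := by
    rw [Fintype.card_prod, Fintype.card_fin, sq]; push_cast; gcongr
  have key : ∀ x ∈ Metric.ball c ρ, 0 ≤ F x → (R^45)⁻¹ * F x ^ 2 - R^135 ≤ Lop a F x := by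
    intro x hx _
    set γ := √(sqG U x) with hγ
    set θ := √(sqH U x) with hθ
    have hγ2 : γ^2 = sqG U x := Real.sq_sqrt (hG0 x)
    have hθ2 : θ^2 = sqH U x := Real.sq_sqrt (hH0 x)
    have hγ0 : 0 ≤ γ := Real.sqrt_nonneg _
    have hθ0 : 0 ≤ θ := Real.sqrt_nonneg _
    have hγb : ∀ s k, |pd k (U s) x| ≤ γ := fun s k =>
      abs_le_sqrt_sumsq (fun p : ι × Fin n => pd p.2 (U p.1) x) (s, k)
    have hθb : ∀ s k l, |pd l (pd k (U s)) x| ≤ θ := fun s k l =>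
      abs_le_sqrt_sumsq (fun q : (ι × Fin n) × Fin n => pd q.2 (pd q.1.2 (U q.1.1)) x) ((s, k), l)
    have hsy := hE.symm x hx
    have hPb : P x ≤ R^3 := by
      refine (le_abs_self _).trans ((abs_sum_le_card _ (R^2) R (by positivity) hι ?_).trans
        (le_of_eq (by ring)))
      intro s
      rw [abs_mul, sq]
      have := hb x hx s
      gcongr
    have hLP : 2 / R * γ^2 - 2 * R^3 * (1 + γ) ≤ Lop a P x := by
      rw [hP, Lop_sumsq a hU x hsy, Finset.sum_add_distrib]
      have c1 : |∑ s, 2 * (U s x * Lop a (U s) x)| ≤ R * (2 * (R * (R * (1 + γ)))) := by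
        refine abs_sum_le_card _ _ R (by positivity) hι ?_
        intro s
        rw [abs_mul, abs_mul, abs_two]
        have d1 := hb x hx s
        have d2 := h1 x hx s
        gcongr
      have c2 : 2 / R * γ^2 ≤ ∑ s, 2 * Gam a (U s) (U s) x := by
        rw [hγ2, sqG, Fintype.sum_prod_type, Finset.mul_sum]
        refine Finset.sum_le_sum fun s _ => ?_
        have := hE.gam x hx (U s)
        calc _ = 2 * (R⁻¹ * ∑ i, pd i (U s) x * pd i (U s) x) := by ring
          _ ≤ _ := by gcongr
      have := (abs_le.mp c1).1
      nlinarith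
    have hLG : 2 / R * θ^2 - 2 * R^3 * γ * (1 + γ^2 + θ) ≤ Lop a (sqG U) x := by
      have e : sqG U = fun x => ∑ p : ι × Fin n, pd p.2 (U p.1) x * pd p.2 (U p.1) x := rfl
      rw [e, Lop_sumsq a (f := fun p : ι × Fin n => pd p.2 (U p.1)) (fun p => (hU p.1).pd p.2) x hsy,
        Finset.sum_add_distrib]
      have c1 : |∑ p : ι × Fin n, 2 * (pd p.2 (U p.1) x * Lop a (pd p.2 (U p.1)) x)|
          ≤ R^2 * (2 * (γ * (R * (1 + γ^2 + θ)))) := by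
        refine abs_sum_le_card _ _ _ (by positivity) hcard ?_
        intro p
        rw [abs_mul, abs_mul, abs_two]
        have d1 := hγb p.1 p.2
        have d2 := h2 x hx p.1 p.2
        rw [← hγ2] at d2
        gcongr
      have c2 : 2 / R * θ^2 ≤ ∑ p : ι × Fin n, 2 * Gam a (pd p.2 (U p.1)) (pd p.2 (U p.1)) x := by
        rw [hθ2, sqH, Fintype.sum_prod_type, Finset.mul_sum]
        refine Finset.sum_le_sum fun p _ => ?_
        have := hE.gam x hx (pd p.2 (U p.1))
        calc _ = 2 * (R⁻¹ * ∑ i, pd i (pd p.2 (U p.1)) x * pd i (pd p.2 (U p.1)) x) := by ring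
          _ ≤ _ := by gcongr
      have := (abs_le.mp c1).1
      nlinarith
    have hpP : ∀ i, pd i (fun x => A + P x) x = pd i P x := by
      intro i
      rw [pd_add contDiff_const hPs, pd_const]; simp
    have hcr : -(8 * R^7 * (γ^2 * θ)) ≤ 2 * Gam a (fun x => A + P x) (sqG U) x := by
      have c1 : ∀ i, |pd i (fun x => A + P x) x| ≤ R * (2 * (R * γ)) := by
        intro i
        rw [hpP i, hP, pd_sumsq hU]
        refine abs_sum_le_card _ _ R (by positivity) hι ?_
        intro s
        rw [abs_mul, abs_mul, abs_two]
        have d1 := hb x hx s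
        have d2 := hγb s i
        gcongr
      have c2 : ∀ j, |pd j (sqG U) x| ≤ R^2 * (2 * (γ * θ)) := by
        intro j
        have e : sqG U = fun x => ∑ p : ι × Fin n, pd p.2 (U p.1) x * pd p.2 (U p.1) x := rfl
        rw [e, pd_sumsq (f := fun p : ι × Fin n => pd p.2 (U p.1)) (fun p => (hU p.1).pd p.2) x]
        refine abs_sum_le_card _ _ _ (by positivity) hcard ?_
        intro p
        rw [abs_mul, abs_mul, abs_two]
        have d1 := hγb p.1 p.2
        have d2 := hθb p.1 p.2 j
        gcongr
      have c3 : |Gam a (fun x => A + P x) (sqG U) x| ≤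
          R * (R * (R * ((R * (2 * (R * γ))) * (R^2 * (2 * (γ * θ)))))) := by
        refine abs_sum_le_card _ _ _ (by positivity) (by simpa using hn) fun i => ?_
        refine abs_sum_le_card _ _ _ (by positivity) (by simpa using hn) fun j => ?_
        rw [abs_mul, abs_mul]
        have d1 := hE.bdd x hx i j
        have d2 := c1 i
        have d3 := c2 j
        gcongr
      have := (abs_le.mp c3).1
      nlinarith
    have hL : Lop a F x = (A + P x) * Lop a (sqG U) x + γ^2 * Lop a P x +
        2 * Gam a (fun x => A + P x) (sqG U) x := by
      rw [hF, Lop_mul a hAP hGs x hsy, hγ2]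
      congr 3
      simp only [Lop]
      refine Finset.sum_congr rfl fun i _ => Finset.sum_congr rfl fun j _ => ?_
      rw [pd_add contDiff_const hPs, pd_const]; simp
    rw [hL]
    have := bern_arith R γ θ (P x) A _ _ _ hR hγ0 hθ0 (hP0 x) hPb hA hLP hLG hcr
    rw [hγ2] at this ⊢
    exact this
  have hmp := max_principle a c ρ (R^2) ((R^45)⁻¹) (R^135) hρ hρ1 (by positivity)
    (inv_le_one_of_one_le₀ (one_le_pow₀ (by linarith))) (by positivity) (by positivity)
    (fun x hx => hE.psd hR0 x hx) (fun x hx => by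
      refine (le_abs_self _).trans ((abs_sum_le_card _ R R hR0.le (by simpa using hn)
        (fun i => hE.bdd x hx i i)).trans (le_of_eq (by ring)))) F hFs key
  have hAP1 : 1 ≤ A + P c := by
    have : 1 ≤ R^16 := one_le_pow₀ (by linarith)
    have := hP0 c
    rw [hA]; linarith
  calc sqG U c ≤ F c := by
        simp only [hF]
        exact le_mul_of_one_le_left (hG0 c) hAP1
    _ ≤ _ := hmp
    _ = (28 * R^2 + R^135 + 1) * R^45 * (ρ⁻¹)^4 := by field_simp
    _ ≤ (R^135 + R^135 + R^135) * R^45 * R^4 := by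
        have e1 : 28 * R^2 ≤ R^135 := by
          have : (2:ℝ)^5 ≤ R^5 := by gcongr
          calc 28 * R^2 ≤ R^5 * R^2 := by gcongr; linarith
            _ = R^7 := by ring
            _ ≤ R^135 := pow_le_pow_right₀ (by linarith) (by norm_num)
        have e2 : 1 ≤ R^135 := one_le_pow₀ (by linarith)
        gcongr
    _ = 3 * R^184 := by ring
    _ ≤ R^2 * R^184 := by gcongr; nlinarith
    _ = R^186 := by ring
    _ ≤ _ := pow_le_pow_right₀ (by linarith) (by norm_num)

def alp {n : ℕ} (a : Fin n → Fin n → Euc n → ℝ) (s : ℕ) (x : Euc n) : ℝ :=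
  ∑ i, ∑ j, nd s (a i j) x

lemma alp_nonneg {n : ℕ} (a : Fin n → Fin n → Euc n → ℝ) (s : ℕ) (x : Euc n) : 0 ≤ alp a s x :=
  Finset.sum_nonneg fun _ _ => Finset.sum_nonneg fun _ _ => nd_nonneg _ _ _

def Sg {n : ℕ} (a : Fin n → Fin n → Euc n → ℝ) (v : Euc n → ℝ) (p : ℕ) (x : Euc n) : ℝ :=
  ∑ s ∈ Finset.range p, alp a (s+1) x * nd (p + 1 - s) v x

lemma Sg_nonneg {n : ℕ} (a : Fin n → Fin n → Euc n → ℝ) (v : Euc n → ℝ) (p : ℕ) (x : Euc n) :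
    0 ≤ Sg a v p x := Finset.sum_nonneg fun _ _ => mul_nonneg (alp_nonneg _ _ _) (nd_nonneg _ _ _)

lemma Sm.Lop {n : ℕ} {a : Fin n → Fin n → Euc n → ℝ} (ha : ∀ i j, Sm (a i j)) {v : Euc n → ℝ}
    (hv : Sm v) : Sm (Lop a v) :=
  Sm.sum fun i _ => Sm.sum fun j _ => (ha i j).mul ((hv.pd j).pd i)

lemma Lop_pd {n : ℕ} {a : Fin n → Fin n → Euc n → ℝ} (ha : ∀ i j, Sm (a i j)) {v : Euc n → ℝ}
    (hv : Sm v) (k : Fin n) :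
    Lop a (pd k v) = fun x => pd k (Lop a v) x - Lop (fun i j => pd k (a i j)) v x := by
  ext x
  have e : pd k (Lop a v) x = ∑ i, ∑ j, (pd k (a i j) x * pd i (pd j v) x
      + a i j x * pd i (pd j (pd k v)) x) := by
    unfold Lop
    rw [pd_sum fun i _ => Sm.sum fun j _ => (ha i j).mul ((hv.pd j).pd i)]
    refine Finset.sum_congr rfl fun i _ => ?_
    rw [pd_sum fun j _ => (ha i j).mul ((hv.pd j).pd i)]
    refine Finset.sum_congr rfl fun j _ => ?_
    rw [pd_mul (ha i j) ((hv.pd j).pd i), pd_comm (hv.pd j) k i, pd_comm hv k j]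
  rw [e]
  simp only [Lop, ← Finset.sum_sub_distrib]
  refine Finset.sum_congr rfl fun i _ => Finset.sum_congr rfl fun j _ => by ring

lemma nd_Lop_le {n : ℕ} {b : Fin n → Fin n → Euc n → ℝ} (hb : ∀ i j, Sm (b i j)) {v : Euc n → ℝ}
    (hv : Sm v) (p : ℕ) (x : Euc n) :
    nd p (Lop b v) x ≤ 2^p * ∑ t ∈ Finset.range (p+1), alp b t x * nd (p - t + 2) v x := by
  have h1 : nd p (Lop b v) x ≤ ∑ i, ∑ j, ∑ t ∈ Finset.range (p+1),
      (p.choose t : ℝ) * nd t (b i j) x * nd (p - t) (pd i (pd j v)) x := by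
    unfold Lop
    refine (nd_sum_le (fun i _ => Sm.sum fun j _ => (hb i j).mul ((hv.pd j).pd i)) p x).trans ?_
    refine Finset.sum_le_sum fun i _ => ?_
    refine (nd_sum_le (fun j _ => (hb i j).mul ((hv.pd j).pd i)) p x).trans ?_
    refine Finset.sum_le_sum fun j _ => ?_
    exact nd_mul_le (hb i j) ((hv.pd j).pd i) p x
  refine h1.trans ?_
  have h2 : ∀ i j : Fin n, ∑ t ∈ Finset.range (p+1),
      (p.choose t : ℝ) * nd t (b i j) x * nd (p - t) (pd i (pd j v)) x ≤
      ∑ t ∈ Finset.range (p+1), 2^p * (nd t (b i j) x * nd (p - t + 2) v x) := by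
    intro i j
    refine Finset.sum_le_sum fun t _ => ?_
    rw [mul_assoc]
    have c1 : (p.choose t : ℝ) ≤ 2^p := by exact_mod_cast Nat.choose_le_two_pow p t
    have c2 : nd (p - t) (pd i (pd j v)) x ≤ nd (p - t + 2) v x :=
      (nd_pd (hv.pd j) _ _ _).trans (nd_pd hv _ _ _)
    have c3 := nd_nonneg t (b i j) x
    have c4 := nd_nonneg (p-t) (pd i (pd j v)) x
    gcongr
  refine (Finset.sum_le_sum fun i _ => Finset.sum_le_sum fun j _ => h2 i j).trans (le_of_eq ?_)
  simp only [alp, Finset.mul_sum, Finset.sum_mul]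
  conv_rhs => rw [Finset.sum_comm]
  refine Finset.sum_congr rfl fun i _ => ?_
  conv_rhs => rw [Finset.sum_comm]

lemma alp_pd_le {n : ℕ} {a : Fin n → Fin n → Euc n → ℝ} (ha : ∀ i j, Sm (a i j)) (k : Fin n) (t : ℕ)
    (x : Euc n) : alp (fun i j => pd k (a i j)) t x ≤ alp a (t+1) x :=
  Finset.sum_le_sum fun i _ => Finset.sum_le_sum fun j _ => nd_pd (ha i j) _ _ _

lemma comm_le {n : ℕ} {a : Fin n → Fin n → Euc n → ℝ} (ha : ∀ i j, Sm (a i j)) {v : Euc n → ℝ}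
    (hv : Sm v) (j m : ℕ) (I : Fin m → Fin n) (x : Euc n) :
    nd j (Lop a (pdI m I v)) x ≤ nd (j+m) (Lop a v) x + m * 2^(j+m) * Sg a v (j+m) x := by
  induction m generalizing v with
  | zero => simp [pdI]
  | succ m ih =>
    set k := I 0
    have h1 := ih (hv.pd k) (Fin.tail I)
    have h2 : nd (j+m) (Lop a (pd k v)) x ≤ nd (j+m+1) (Lop a v) x +
        2^(j+m) * Sg a v (j+m+1) x := by
      rw [Lop_pd ha hv]
      refine (nd_sub_le ((Sm.Lop ha hv).pd k) (Sm.Lop (fun i j => (ha i j).pd k) hv) _ x).trans ?_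
      refine add_le_add (nd_pd (Sm.Lop ha hv) _ _ _) ?_
      refine (nd_Lop_le (fun i j => (ha i j).pd k) hv _ x).trans ?_
      refine mul_le_mul_of_nonneg_left ?_ (by positivity)
      refine Finset.sum_le_sum fun t ht => ?_
      rw [Finset.mem_range] at ht
      have e : j + m - t + 2 = j + m + 1 + 1 - t := by omega
      rw [e]
      exact mul_le_mul_of_nonneg_right (alp_pd_le ha k t x) (nd_nonneg _ _ _)
    have h3 : Sg a (pd k v) (j+m) x ≤ Sg a v (j+m+1) x := by
      simp only [Sg]
      rw [Finset.sum_range_succ]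
      refine le_add_of_le_of_nonneg ?_ (mul_nonneg (alp_nonneg _ _ _) (nd_nonneg _ _ _))
      refine Finset.sum_le_sum fun s hs => ?_
      rw [Finset.mem_range] at hs
      refine mul_le_mul_of_nonneg_left ?_ (alp_nonneg _ _ _)
      refine (nd_pd hv _ _ _).trans (le_of_eq ?_)
      congr 1; omega
    have h4 := Sg_nonneg a v (j+m+1) x
    calc _ ≤ _ := h1
      _ ≤ (nd (j+m+1) (Lop a v) x + 2^(j+m) * Sg a v (j+m+1) x) +
          m * 2^(j+m) * Sg a v (j+m+1) x := by gcongr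
      _ = nd (j+m+1) (Lop a v) x + (m+1) * 2^(j+m) * Sg a v (j+m+1) x := by ring
      _ ≤ nd (j+m+1) (Lop a v) x + (m+1) * 2^(j+m+1) * Sg a v (j+m+1) x := by
        have : (2:ℝ)^(j+m) ≤ 2^(j+m+1) := pow_le_pow_right₀ (by norm_num) (by omega)
        gcongr
      _ = _ := by push_cast; rfl

/-- absorbing constants -/
lemma absorb {M : ℝ} (hM : 2 ≤ M) (W : ℕ) : (W : ℝ) ≤ M^W := by
  calc (W:ℝ) ≤ (2:ℝ)^W := by exact_mod_cast Nat.lt_two_pow_self.le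
    _ ≤ M^W := by gcongr

lemma nd_succ_le_gam {n : ℕ} {ι : Type*} [Fintype ι] {v : ι → Euc n → ℝ} (hv : ∀ q, Sm (v q))
    (m : ℕ) (q : ι) (x : Euc n) :
    nd (m+1) (v q) x ≤ (n * n^m : ℕ) * √(sqG (fun p : ι × (Fin m → Fin n) => pdI m p.2 (v p.1)) x) := by
  refine (nd_succ_le (hv q) m x).trans ?_
  have : ∀ i, nd m (pd i (v q)) x ≤ (n^m : ℕ) *
      √(sqG (fun p : ι × (Fin m → Fin n) => pdI m p.2 (v p.1)) x) := by
    intro i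
    refine (nd_le_sum_pdI ((hv q).pd i) m x).trans ?_
    refine (Finset.sum_le_card_nsmul _ _
      (√(sqG (fun p : ι × (Fin m → Fin n) => pdI m p.2 (v p.1)) x)) fun I _ => ?_).trans
      (le_of_eq (by simp))
    rw [← pd_pdI (hv q)]
    exact abs_le_sqrt_sumsq (fun p : (ι × (Fin m → Fin n)) × Fin n => pd p.2 (pdI m p.1.2 (v p.1.1)) x)
      ((q, I), i)
  refine (Finset.sum_le_card_nsmul _ _ _ fun i _ => this i).trans (le_of_eq ?_)
  simp; ring

lemma nd_succ2_le_the {n : ℕ} {ι : Type*} [Fintype ι] {v : ι → Euc n → ℝ} (hv : ∀ q, Sm (v q))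
    (m : ℕ) (q : ι) (x : Euc n) :
    nd (m+2) (v q) x ≤ (n * (n * n^m) : ℕ) *
      √(sqH (fun p : ι × (Fin m → Fin n) => pdI m p.2 (v p.1)) x) := by
  refine (nd_succ_le (hv q) (m+1) x).trans ?_
  have : ∀ i, nd (m+1) (pd i (v q)) x ≤ (n * n^m : ℕ) *
      √(sqH (fun p : ι × (Fin m → Fin n) => pdI m p.2 (v p.1)) x) := by
    intro i
    refine (nd_succ_le ((hv q).pd i) m x).trans ?_
    have : ∀ j, nd m (pd j (pd i (v q))) x ≤ (n^m : ℕ) *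
        √(sqH (fun p : ι × (Fin m → Fin n) => pdI m p.2 (v p.1)) x) := by
      intro j
      refine (nd_le_sum_pdI (((hv q).pd i).pd j) m x).trans ?_
      refine (Finset.sum_le_card_nsmul _ _
        (√(sqH (fun p : ι × (Fin m → Fin n) => pdI m p.2 (v p.1)) x)) fun I _ => ?_).trans
        (le_of_eq (by simp))
      rw [← pd_pdI ((hv q).pd i), ← pd_pdI (hv q)]
      exact abs_le_sqrt_sumsq (fun p : ((ι × (Fin m → Fin n)) × Fin n) × Fin n =>
        pd p.2 (pd p.1.2 (pdI m p.1.1.2 (v p.1.1.1))) x) (((q, I), i), j)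
    refine (Finset.sum_le_card_nsmul _ _ _ fun i _ => this i).trans (le_of_eq ?_)
    simp; ring
  refine (Finset.sum_le_card_nsmul _ _ _ fun i _ => this i).trans (le_of_eq ?_)
  simp; ring

lemma level {n : ℕ} (ι : Type*) [Fintype ι] (m : ℕ) :
    ∃ N : ℕ, ∀ M : ℝ, 2 ≤ M → ∀ (c : Euc n) (ρ : ℝ), 0 < ρ → ρ ≤ 1 → ρ⁻¹ ≤ M →
    ∀ a : Fin n → Fin n → Euc n → ℝ, (∀ i j, Sm (a i j)) → Ell a (Metric.ball c ρ) M →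
    ∀ v : ι → Euc n → ℝ, (∀ q, Sm (v q)) →
    (∀ x ∈ Metric.ball c ρ, ∀ q, Lop a (v q) x = 0) →
    (∀ x ∈ Metric.ball c ρ, ∀ q, nd m (v q) x ≤ M) →
    (∀ x ∈ Metric.ball c ρ, ∀ q, Sg a (v q) m x ≤ M * (1 + ∑ q', nd (m+1) (v q') x)) →
    (∀ x ∈ Metric.ball c ρ, ∀ q, Sg a (v q) (m+1) x ≤
      M * (1 + (∑ q', nd (m+1) (v q') x)^2 + ∑ q', nd (m+2) (v q') x)) →
    ∀ q, nd (m+1) (v q) c ≤ M^N := by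
  set S := Fintype.card ι with hS
  set K : ℕ := S * (n * (n * n^m) + n * n^m) + n * n^m + 1 with hK
  set C0 : ℕ := (m+1) * 2^(m+1) with hC0
  set W : ℕ := C0 * (K^2) + S * n^m + n + 1 with hW
  refine ⟨K + (W+1) * 100, ?_⟩
  intro M hM c ρ hρ hρ1 hρM a ha hE v hv hL hm h1 h2 q
  set R : ℝ := W * M with hR
  have hW1 : (1:ℝ) ≤ W := by exact_mod_cast (by omega : 1 ≤ W)
  have hMR : M ≤ R := by rw [hR]; nlinarith
  have hM0 : 0 < M := by linarith
  have hWR : (W:ℝ) ≤ R := by rw [hR]; nlinarith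
  have hK1 : (1:ℝ) ≤ K := by exact_mod_cast (by omega : 1 ≤ K)
  have hCK : (C0:ℝ) * K^2 ≤ W := by
    exact_mod_cast (by omega : C0 * K^2 ≤ W)
  set U : ι × (Fin m → Fin n) → Euc n → ℝ := fun p => pdI m p.2 (v p.1) with hU
  have hUs : ∀ p, Sm (U p) := fun p => (hv p.1).pdI m p.2
  have hG0 : ∀ x, 0 ≤ sqG U x := fun x => Finset.sum_nonneg fun i _ => mul_self_nonneg _
  have sumγ : ∀ x, ∑ q', nd (m+1) (v q') x ≤ K * √(sqG U x) := by
    intro x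
    refine (Finset.sum_le_card_nsmul _ _ _ fun i _ => nd_succ_le_gam hv m i x).trans ?_
    rw [nsmul_eq_mul, ← mul_assoc]
    refine mul_le_mul_of_nonneg_right ?_ (Real.sqrt_nonneg _)
    simp only [Finset.card_univ]
    rw [← hS]
    exact_mod_cast (by rw [hK, mul_add]; omega : S * (n * n^m) ≤ K)
  have sumθ : ∀ x, ∑ q', nd (m+2) (v q') x ≤ K * √(sqH U x) := by
    intro x
    refine (Finset.sum_le_card_nsmul _ _ _ fun i _ => nd_succ2_le_the hv m i x).trans ?_
    rw [nsmul_eq_mul, ← mul_assoc]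
    refine mul_le_mul_of_nonneg_right ?_ (Real.sqrt_nonneg _)
    simp only [Finset.card_univ]
    rw [← hS]
    exact_mod_cast (by rw [hK, mul_add]; omega : S * (n * (n * n^m)) ≤ K)
  have hzero : ∀ k, ∀ x ∈ Metric.ball c ρ, ∀ q, nd k (Lop a (v q)) x = 0 := by
    intro k x hx q
    rw [nd_congr Metric.isOpen_ball (v := fun _ => 0) (fun y hy => hL y hy q) k x hx, nd_zero_fun]
  have hC0m : (m:ℝ) * 2^m ≤ C0 := by
    rw [hC0]; push_cast
    have : (2:ℝ)^m ≤ 2^(m+1) := pow_le_pow_right₀ (by norm_num) (by omega)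
    have : (m:ℝ) ≤ m + 1 := by linarith
    gcongr
  have key := bern_core R (by linarith) (ι := ι × (Fin m → Fin n)) (by
      refine le_trans ?_ hWR
      simp only [Fintype.card_prod, Fintype.card_fun, Fintype.card_fin]
      rw [← hS]
      exact_mod_cast (by omega : S * n^m ≤ W)) (by
      refine le_trans ?_ hWR
      exact_mod_cast (by omega : n ≤ W)) c ρ hρ hρ1 (hρM.trans hMR) a
      (hE.mono subset_rfl hM0 hMR) U hUs
      (fun x hx p => (abs_pdI_le (hv p.1) m p.2 x).trans ((hm x hx p.1).trans hMR))
      (fun x hx p => by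
        have e1 := comm_le ha (hv p.1) 0 m p.2 x
        rw [nd_zero, zero_add, hzero _ x hx, zero_add] at e1
        refine e1.trans ?_
        have e2 := h1 x hx p.1
        have e3 := sumγ x
        have e4 := Sg_nonneg a (v p.1) m x
        have e5 := Real.sqrt_nonneg (sqG U x)
        calc _ ≤ (C0:ℝ) * (M * (1 + K * √(sqG U x))) := by
              gcongr
              refine e2.trans ?_
              gcongr
          _ ≤ (C0:ℝ) * (M * (K^2 * (1 + √(sqG U x)))) := by
              gcongr
              have f1 : (1:ℝ) ≤ (K:ℝ)^2 := one_le_pow₀ hK1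
              have f2 : (K:ℝ) ≤ (K:ℝ)^2 := by nlinarith
              nlinarith
          _ = (C0 * K^2) * M * (1 + √(sqG U x)) := by ring
          _ ≤ R * (1 + √(sqG U x)) := by rw [hR]; gcongr)
      (fun x hx p k => by
        have e0 : pd k (U p) = pdI (m+1) (Fin.cons k p.2) (v p.1) := by
          simp only [hU]; rw [pd_pdI (hv p.1)]; simp [pdI]
        rw [e0]
        have e1 := comm_le ha (hv p.1) 0 (m+1) (Fin.cons k p.2) x
        rw [nd_zero, zero_add, hzero _ x hx, zero_add] at e1
        refine e1.trans ?_
        have e2 := h2 x hx p.1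
        have e3 := sumγ x
        have e3b := sumθ x
        have e4 := Sg_nonneg a (v p.1) (m+1) x
        have e5 := Real.sqrt_nonneg (sqG U x)
        have e6 := Real.sqrt_nonneg (sqH U x)
        have e7 : 0 ≤ ∑ q', nd (m+1) (v q') x := Finset.sum_nonneg fun _ _ => nd_nonneg _ _ _
        have e8 : (√(sqG U x))^2 = sqG U x := Real.sq_sqrt (hG0 x)
        have e9 : (((m+1:ℕ):ℝ)) * 2^(m+1) = C0 := by rw [hC0]; push_cast; ring
        rw [e9]
        calc _ ≤ (C0:ℝ) * (M * (1 + (K * √(sqG U x))^2 + K * √(sqH U x))) := by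
              gcongr
              refine e2.trans ?_
              gcongr
          _ = (C0:ℝ) * (M * (1 + K^2 * sqG U x + K * √(sqH U x))) := by rw [mul_pow, e8]
          _ ≤ (C0:ℝ) * (M * (K^2 * (1 + sqG U x + √(sqH U x)))) := by
              gcongr
              have f1 : (1:ℝ) ≤ (K:ℝ)^2 := one_le_pow₀ hK1
              have f2 : (K:ℝ) ≤ (K:ℝ)^2 := by nlinarith
              nlinarith
          _ = (C0 * K^2) * M * (1 + sqG U x + √(sqH U x)) := by ring
          _ ≤ R * (1 + sqG U x + √(sqH U x)) := by
              have := hG0 x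
              rw [hR]; gcongr)
  have hsq : √(sqG U c) ≤ R^100 := by
    rw [Real.sqrt_le_left (by positivity)]
    exact key.trans (le_of_eq (by ring))
  calc nd (m+1) (v q) c ≤ ∑ q', nd (m+1) (v q') c :=
        Finset.single_le_sum (f := fun q' => nd (m+1) (v q') c) (fun _ _ => nd_nonneg _ _ _)
          (Finset.mem_univ q)
    _ ≤ K * √(sqG U c) := sumγ c
    _ ≤ M^K * R^100 := by
        gcongr
        exact absorb hM K
    _ ≤ M^K * (M^W * M)^100 := by
        rw [hR]
        have := absorb hM W
        gcongr
    _ = M^(K + (W+1)*100) := by rw [← pow_succ, ← pow_mul, ← pow_add]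

lemma half_ball {n : ℕ} {c x : Euc n} {ρ : ℝ} (hx : x ∈ Metric.ball c (ρ/2)) :
    Metric.ball x (ρ/2) ⊆ Metric.ball c ρ := by
  refine Metric.ball_subset_ball' ?_
  rw [Metric.mem_ball] at hx
  linarith

lemma half_ball_sub {n : ℕ} (c : Euc n) {ρ : ℝ} (hρ : 0 < ρ) :
    Metric.ball c (ρ/2) ⊆ Metric.ball c ρ := Metric.ball_subset_ball (by linarith)

lemma half_inv {ρ M : ℝ} (hM : 2 ≤ M) (h : ρ⁻¹ ≤ M) : (ρ/2)⁻¹ ≤ M^2 := by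
  rw [inv_div, div_eq_mul_inv]
  nlinarith

lemma self_le_pow {M : ℝ} (hM : 2 ≤ M) {k : ℕ} (hk : 1 ≤ k) : M ≤ M^k := by
  calc M = M^1 := (pow_one M).symm
    _ ≤ M^k := pow_le_pow_right₀ (by linarith) hk

/-- interior estimates for linear equations -/
lemma Tv {n : ℕ} (m : ℕ) : ∃ N : ℕ, ∀ M : ℝ, 2 ≤ M → ∀ (c : Euc n) (ρ : ℝ), 0 < ρ → ρ ≤ 1 → ρ⁻¹ ≤ M →
    ∀ a : Fin n → Fin n → Euc n → ℝ, (∀ i j, Sm (a i j)) → Ell a (Metric.ball c ρ) M →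
    (∀ x ∈ Metric.ball c ρ, ∀ s, 1 ≤ s → s ≤ m → alp a s x ≤ M) →
    ∀ v : Euc n → ℝ, Sm v → (∀ x ∈ Metric.ball c ρ, Lop a v x = 0) →
    (∀ x ∈ Metric.ball c ρ, |v x| ≤ M) →
    ∀ k ≤ m, nd k v c ≤ M^N := by
  induction m with
  | zero =>
    refine ⟨1, ?_⟩
    intro M hM c ρ hρ hρ1 hρM a ha hE hal v hv hL hb k hk
    obtain rfl : k = 0 := by omega
    rw [nd_zero, pow_one]
    exact hb c (Metric.mem_ball_self hρ)
  | succ m ih =>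
    obtain ⟨N, hN⟩ := ih
    obtain ⟨N', hN'⟩ := level (n := n) Unit m
    set T := 2 * N + m + 4 with hT
    refine ⟨2 * N + T * N', ?_⟩
    intro M hM c ρ hρ hρ1 hρM a ha hE hal v hv hL hb k hk
    have hM0 : 0 < M := by linarith
    have hM1 : 1 ≤ M := by linarith
    have hM2 : M ≤ M^2 := self_le_pow hM (by norm_num)
    have hlow : ∀ x ∈ Metric.ball c (ρ/2), ∀ k ≤ m, nd k v x ≤ M^(2*N) := by
      intro x hx k hk
      have hsub := half_ball hx
      have := hN (M^2) (by linarith) x (ρ/2) (by linarith) (by linarith) (half_inv hM hρM) a ha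
        (hE.mono hsub hM0 hM2) (fun y hy s h1 h2 => (hal y (hsub hy) s h1 (by omega)).trans hM2)
        v hv (fun y hy => hL y (hsub hy)) (fun y hy => (hb y (hsub hy)).trans hM2) k hk
      rwa [← pow_mul] at this
    have hcc : c ∈ Metric.ball c (ρ/2) := Metric.mem_ball_self (by linarith)
    rcases Nat.lt_or_ge k (m+1) with h | h
    · exact (hlow c hcc k (by omega)).trans (pow_le_pow_right₀ hM1 (by omega))
    obtain rfl : k = m + 1 := by omega
    have hsub := half_ball_sub c hρ
    set B := M^(2*N) with hB
    have hB1 : 1 ≤ B := one_le_pow₀ hM1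
    have hMT : M ≤ M^T := self_le_pow hM (by omega)
    have hconst : ((m+1:ℕ):ℝ) * (2 * (M * B)) ≤ M^T := by
      calc ((m+1:ℕ):ℝ) * (2 * (M * B)) ≤ M^(m+1) * (M * (M * B)) := by
            have := absorb hM (m+1)
            gcongr
        _ = M^(2*N+m+3) := by rw [hB]; ring
        _ ≤ M^T := pow_le_pow_right₀ hM1 (by omega)
    have key := hN' (M^T) (hM.trans hMT) c (ρ/2) (by linarith) (by linarith)
      ((half_inv hM hρM).trans (pow_le_pow_right₀ hM1 (by omega))) a ha (hE.mono hsub hM0 hMT)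
      (fun _ => v) (fun _ => hv) (fun x hx _ => hL x (hsub hx))
      (fun x hx _ => (hlow x hx m le_rfl).trans (pow_le_pow_right₀ hM1 (by omega)))
      (fun x hx _ => by
        simp only [Finset.univ_unique, Finset.sum_const, Finset.card_singleton, one_smul]
        have hX := nd_nonneg (m+1) v x
        have : ∀ s ∈ Finset.range m, alp a (s+1) x * nd (m+1-s) v x ≤
            2 * (M * B) * (1 + nd (m+1) v x) := by
          intro s hs
          rw [Finset.mem_range] at hs
          have h1 := hal x (hsub hx) (s+1) (by omega) (by omega)
          have h2 : nd (m+1-s) v x ≤ B * (1 + nd (m+1) v x) := by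
            rcases Nat.eq_zero_or_pos s with rfl | h0
            · simp only [Nat.sub_zero]; nlinarith
            · have := hlow x hx (m+1-s) (by omega)
              nlinarith
          have h3 := alp_nonneg a (s+1) x
          calc _ ≤ M * (B * (1 + nd (m+1) v x)) := by
                have := nd_nonneg (m+1-s) v x
                gcongr
            _ ≤ _ := by nlinarith [mul_nonneg (mul_nonneg hM0.le (by linarith : 0 ≤ B)) (by linarith : 0 ≤ 1 + nd (m+1) v x)]
        refine (Finset.sum_le_card_nsmul _ _ _ this).trans ?_
        rw [nsmul_eq_mul, Finset.card_range, ← mul_assoc]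
        refine mul_le_mul_of_nonneg_right (le_trans ?_ hconst) (by linarith)
        push_cast
        gcongr
        linarith)
      (fun x hx _ => by
        simp only [Finset.univ_unique, Finset.sum_const, Finset.card_singleton, one_smul]
        set X := nd (m+1) v x with hXd
        set Y := nd (m+2) v x with hYd
        have hX : 0 ≤ X := nd_nonneg (m+1) v x
        have hY : 0 ≤ Y := nd_nonneg (m+2) v x
        have : ∀ s ∈ Finset.range (m+1), alp a (s+1) x * nd (m+1+1-s) v x ≤
            2 * (M * B) * (1 + X^2 + Y) := by
          intro s hs
          rw [Finset.mem_range] at hs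
          have h1 := hal x (hsub hx) (s+1) (by omega) (by omega)
          have h2 : nd (m+1+1-s) v x ≤ B * (2 * (1 + X^2 + Y)) := by
            have hS : 1 ≤ 1 + X^2 + Y := by nlinarith
            rcases Nat.eq_zero_or_pos s with rfl | h0
            · have : nd (m+1+1-0) v x = Y := rfl
              rw [this]; nlinarith
            · rcases Nat.lt_or_ge 1 s with h0 | h0
              · have := hlow x hx (m+1+1-s) (by omega)
                nlinarith
              · obtain rfl : s = 1 := by omega
                have : nd (m+1+1-1) v x = X := rfl
                rw [this]
                have : X ≤ 2 * (1 + X^2 + Y) := by nlinarith [sq_nonneg (X - 1)]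
                nlinarith
          have h3 := alp_nonneg a (s+1) x
          calc _ ≤ M * (B * (2 * (1 + X^2 + Y))) := by
                have := nd_nonneg (m+1+1-s) v x
                gcongr
            _ = _ := by ring
        refine (Finset.sum_le_card_nsmul _ _ _ this).trans ?_
        rw [nsmul_eq_mul, Finset.card_range, ← mul_assoc]
        exact mul_le_mul_of_nonneg_right hconst (by positivity))
      ()
    refine key.trans ?_
    rw [← pow_mul]
    exact pow_le_pow_right₀ hM1 (by omega)

lemma root_pow {X : ℝ} (hX : 0 ≤ X) {m : ℕ} (hm : m ≠ 0) : (X ^ ((m:ℝ)⁻¹))^m = X :=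
  Real.rpow_inv_natCast_pow hX hm

/-- Coefficient control: `alp a s` is controlled by derivatives of `w` -/
def CoefCtl {n : ℕ} (Cs : ℕ → ℕ) (a : Fin n → Fin n → Euc n → ℝ) (w : Euc n → ℝ)
    (S : Set (Euc n)) : Prop :=
  ∀ s, 1 ≤ s → ∀ x ∈ S, ∀ D : ℝ, 1 ≤ D → (∀ i, 1 ≤ i → i ≤ s → nd (i+2) w x ≤ D^i) →
    alp a s x ≤ Cs s * D^s

lemma coef_bounds {n : ℕ} {Cs : ℕ → ℕ} {a : Fin n → Fin n → Euc n → ℝ} {w : Euc n → ℝ}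
    {S : Set (Euc n)} (h : CoefCtl Cs a w S) (μ : ℕ) (hμ : 2 ≤ μ) (x : Euc n) (hx : x ∈ S)
    (M X Y B : ℝ) (hM : 1 ≤ M) (hX0 : 0 ≤ X) (hY0 : 0 ≤ Y)
    (hB : ∀ s ≤ μ + 1, (Cs s : ℝ) * (2 * M^(μ+1)) ≤ B)
    (hlow : ∀ k, 3 ≤ k → k ≤ μ+1 → nd k w x ≤ M)
    (hX : nd (μ+2) w x ≤ X) (hY : nd (μ+3) w x ≤ Y) :
    (∀ s, 1 ≤ s → s < μ → alp a s x ≤ B) ∧ alp a μ x ≤ B * (1 + X) ∧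
      alp a (μ+1) x ≤ B * (1 + X^2 + Y) := by
  have hMp : ∀ s ≤ μ+1, M^s ≤ M^(μ+1) := fun s hs => pow_le_pow_right₀ hM hs
  have hM1 : 1 ≤ M^(μ+1) := one_le_pow₀ hM
  have hi : ∀ i, 1 ≤ i → M ≤ M^i := fun i hi => by
    calc M = M^1 := (pow_one M).symm
      _ ≤ M^i := pow_le_pow_right₀ hM hi
  refine ⟨fun s h1 h2 => ?_, ?_, ?_⟩
  · refine (h s h1 x hx M hM fun i i1 i2 => (hlow (i+2) (by omega) (by omega)).trans (hi i i1)).trans ?_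
    refine le_trans ?_ (hB s (by omega))
    have := hMp s (by omega)
    gcongr
    linarith
  · set D := max M (X ^ ((μ:ℝ)⁻¹)) with hD
    have hD1 : M ≤ D := le_max_left _ _
    have hDX : X ≤ D^μ := by
      rw [← root_pow hX0 (by omega : μ ≠ 0)]
      have : X ^ ((μ:ℝ)⁻¹) ≤ D := le_max_right _ _
      have : 0 ≤ X ^ ((μ:ℝ)⁻¹) := Real.rpow_nonneg hX0 _
      gcongr
    have hDp : D^μ ≤ 2 * M^(μ+1) * (1 + X) := by
      rcases max_choice M (X ^ ((μ:ℝ)⁻¹)) with h0 | h0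
      · rw [← hD] at h0
        rw [h0]
        have := hMp μ (by omega)
        nlinarith
      · rw [← hD] at h0
        rw [h0, root_pow hX0 (by omega : μ ≠ 0)]
        nlinarith
    refine (h μ (by omega) x hx D (hM.trans hD1) fun i i1 i2 => ?_).trans ?_
    · rcases Nat.lt_or_ge i μ with h3 | h3
      · exact ((hlow (i+2) (by omega) (by omega)).trans (hi i i1)).trans (by gcongr)
      · obtain rfl : i = μ := by omega
        exact hX.trans hDX
    · calc _ ≤ (Cs μ : ℝ) * (2 * M^(μ+1) * (1 + X)) := by gcongr
        _ = (Cs μ : ℝ) * (2 * M^(μ+1)) * (1 + X) := by ring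
        _ ≤ _ := by gcongr; exact hB μ (by omega)
  · set D := max (max M (X ^ ((μ:ℝ)⁻¹))) (Y ^ (((μ+1:ℕ):ℝ)⁻¹)) with hD
    have hD1 : M ≤ D := (le_max_left _ _).trans (le_max_left _ _)
    have hX1 : 0 ≤ X ^ ((μ:ℝ)⁻¹) := Real.rpow_nonneg hX0 _
    have hY1 : 0 ≤ Y ^ (((μ+1:ℕ):ℝ)⁻¹) := Real.rpow_nonneg hY0 _
    have eX : (X ^ ((μ:ℝ)⁻¹))^μ = X := root_pow hX0 (by omega : μ ≠ 0)
    have eY : (Y ^ (((μ+1:ℕ):ℝ)⁻¹))^(μ+1) = Y := root_pow hY0 (by omega : μ + 1 ≠ 0)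
    have hDX : X ≤ D^μ := by
      have : X ^ ((μ:ℝ)⁻¹) ≤ D := (le_max_right _ _).trans (le_max_left _ _)
      calc X = (X ^ ((μ:ℝ)⁻¹))^μ := eX.symm
        _ ≤ D^μ := by gcongr
    have hDY : Y ≤ D^(μ+1) := by
      have : Y ^ (((μ+1:ℕ):ℝ)⁻¹) ≤ D := le_max_right _ _
      calc Y = (Y ^ (((μ+1:ℕ):ℝ)⁻¹))^(μ+1) := eY.symm
        _ ≤ D^(μ+1) := by gcongr
    have hDp : D^(μ+1) ≤ 2 * M^(μ+1) * (1 + X^2 + Y) := by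
      have hS : 1 ≤ 1 + X^2 + Y := by nlinarith
      rcases max_choice (max M (X ^ ((μ:ℝ)⁻¹))) (Y ^ (((μ+1:ℕ):ℝ)⁻¹)) with h0 | h0
      · rcases max_choice M (X ^ ((μ:ℝ)⁻¹)) with h1 | h1
        · rw [← hD, h1] at h0
          rw [h0]; nlinarith
        · rw [← hD, h1] at h0
          rw [h0]
          have : (X ^ ((μ:ℝ)⁻¹))^(μ+1) ≤ 1 + X^2 := by
            rcases le_total (X ^ ((μ:ℝ)⁻¹)) 1 with h2 | h2
            · have := pow_le_one₀ (n := μ+1) hX1 h2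
              nlinarith
            · calc (X ^ ((μ:ℝ)⁻¹))^(μ+1) ≤ (X ^ ((μ:ℝ)⁻¹))^(μ*2) := pow_le_pow_right₀ h2 (by omega)
                _ = X^2 := by rw [pow_mul, eX]
                _ ≤ _ := by linarith
          nlinarith
      · rw [← hD] at h0
        rw [h0, eY]; nlinarith
    refine (h (μ+1) (by omega) x hx D (hM.trans hD1) fun i i1 i2 => ?_).trans ?_
    · rcases Nat.lt_or_ge i μ with h3 | h3
      · exact ((hlow (i+2) (by omega) (by omega)).trans (hi i i1)).trans (by gcongr)
      · rcases Nat.lt_or_ge i (μ+1) with h4 | h4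
        · obtain rfl : i = μ := by omega
          exact hX.trans hDX
        · obtain rfl : i = μ + 1 := by omega
          exact hY.trans hDY
    · calc _ ≤ (Cs (μ+1) : ℝ) * (2 * M^(μ+1) * (1 + X^2 + Y)) := by gcongr
        _ = (Cs (μ+1) : ℝ) * (2 * M^(μ+1)) * (1 + X^2 + Y) := by ring
        _ ≤ _ := by gcongr; exact hB (μ+1) (by omega)

lemma sg_bd1 {n : ℕ} {a : Fin n → Fin n → Euc n → ℝ} {w : Euc n → ℝ} (hw : Sm w) (m : ℕ)
    (x : Euc n) (q : Fin n) (B X T : ℝ) (hB1 : 1 ≤ B) (hX : 0 ≤ X)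
    (c1 : ∀ s, 1 ≤ s → s < m + 2 → alp a s x ≤ B) (c2 : alp a (m+2) x ≤ B * (1 + X))
    (hlow : ∀ k, 3 ≤ k → k ≤ m + 3 → nd k w x ≤ B) (hXX : nd (m+2+2) w x ≤ X)
    (hconst : ((m+2+1:ℕ):ℝ) * (2 * B^2) ≤ T) :
    Sg a (pd q w) (m+2) x ≤ T * (1 + X) := by
  unfold Sg
  have : ∀ s ∈ Finset.range (m+2), alp a (s+1) x * nd (m+2+1-s) (pd q w) x ≤
      2 * B^2 * (1 + X) := by
    intro s hs
    rw [Finset.mem_range] at hs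
    have d1 : nd (m+2+1-s) (pd q w) x ≤ nd (m+2+1-s+1) w x := nd_pd hw _ _ _
    have d0 := nd_nonneg (m+2+1-s) (pd q w) x
    have d2 := alp_nonneg a (s+1) x
    rcases Nat.eq_zero_or_pos s with rfl | h0
    · have e1 := c1 1 le_rfl (by omega)
      have e2 : nd (m+2+1-0) (pd q w) x ≤ X := d1.trans hXX
      calc _ ≤ B * X := by gcongr
        _ ≤ _ := by nlinarith [mul_nonneg (by linarith : (0:ℝ) ≤ B) hX]
    · have e1 : alp a (s+1) x ≤ B * (1 + X) := by
        rcases Nat.lt_or_ge (s+1) (m+2) with h1 | h1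
        · have := c1 (s+1) (by omega) h1
          nlinarith
        · have : s + 1 = m + 2 := by omega
          rw [this]; exact c2
      have e2 : nd (m+2+1-s) (pd q w) x ≤ B :=
        d1.trans (hlow _ (by omega) (by omega))
      calc _ ≤ B * (1 + X) * B := by gcongr
        _ ≤ _ := by nlinarith [mul_nonneg (sq_nonneg B) (by linarith : (0:ℝ) ≤ 1 + X)]
  refine (Finset.sum_le_card_nsmul _ _ _ this).trans ?_
  rw [nsmul_eq_mul, Finset.card_range, ← mul_assoc]
  refine mul_le_mul_of_nonneg_right (le_trans ?_ hconst) (by linarith)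
  have : ((m+2:ℕ):ℝ) ≤ ((m+2+1:ℕ):ℝ) := by exact_mod_cast Nat.le_succ _
  gcongr

set_option maxHeartbeats 1000000 in
lemma sg_bd2 {n : ℕ} {a : Fin n → Fin n → Euc n → ℝ} {w : Euc n → ℝ} (hw : Sm w) (m : ℕ)
    (x : Euc n) (q : Fin n) (B X Y T : ℝ) (hB1 : 1 ≤ B) (hX : 0 ≤ X) (hY : 0 ≤ Y)
    (c1 : ∀ s, 1 ≤ s → s < m + 2 → alp a s x ≤ B) (c2 : alp a (m+2) x ≤ B * (1 + X))
    (c3 : alp a (m+2+1) x ≤ B * (1 + X^2 + Y))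
    (hlow : ∀ k, 3 ≤ k → k ≤ m + 3 → nd k w x ≤ B) (hXX : nd (m+2+2) w x ≤ X)
    (hYY : nd (m+2+3) w x ≤ Y)
    (hconst : ((m+2+1:ℕ):ℝ) * (2 * B^2) ≤ T) :
    Sg a (pd q w) (m+2+1) x ≤ T * (1 + X^2 + Y) := by
  unfold Sg
  have hS : 1 ≤ 1 + X^2 + Y := by nlinarith
  have hXS : 1 + X ≤ 2 * (1 + X^2 + Y) := by nlinarith [sq_nonneg (X - 1)]
  have : ∀ s ∈ Finset.range (m+2+1), alp a (s+1) x * nd (m+2+1+1-s) (pd q w) x ≤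
      2 * B^2 * (1 + X^2 + Y) := by
    intro s hs
    rw [Finset.mem_range] at hs
    have d1 : nd (m+2+1+1-s) (pd q w) x ≤ nd (m+2+1+1-s+1) w x := nd_pd hw _ _ _
    have d0 := nd_nonneg (m+2+1+1-s) (pd q w) x
    have d2 := alp_nonneg a (s+1) x
    have dB : B ≤ B^2 := by nlinarith
    rcases Nat.eq_zero_or_pos s with rfl | h0
    · have e1 := c1 1 le_rfl (by omega)
      have e0 : m+2+1+1-0 = m+2+2 := rfl
      rw [e0] at d1 d0 ⊢
      have e2 : nd (m+2+2) (pd q w) x ≤ Y := d1.trans hYY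
      have e3 : Y ≤ 2 * (1 + X^2 + Y) := by nlinarith
      calc _ ≤ B * Y := mul_le_mul e1 e2 d0 (by linarith)
        _ ≤ B^2 * (2 * (1 + X^2 + Y)) := mul_le_mul dB e3 hY (by positivity)
        _ = _ := by ring
    rcases Nat.lt_or_ge 1 s with h1 | h1
    · have e1 : alp a (s+1) x ≤ B * (2 * (1 + X^2 + Y)) := by
        rcases Nat.lt_or_ge (s+1) (m+2) with h1 | h1
        · have := c1 (s+1) (by omega) h1
          nlinarith
        · rcases Nat.lt_or_ge (s+1) (m+2+1) with h2 | h2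
          · have e : s + 1 = m + 2 := by omega
            rw [e]; refine c2.trans ?_
            gcongr
          · have e : s + 1 = m + 2 + 1 := by omega
            rw [e]; refine c3.trans ?_
            gcongr
            linarith
      have e2 : nd (m+2+1+1-s) (pd q w) x ≤ B :=
        d1.trans (hlow _ (by omega) (by omega))
      calc _ ≤ B * (2 * (1 + X^2 + Y)) * B := by gcongr
        _ = _ := by ring
    · obtain rfl : s = 1 := by omega
      have e1 : alp a (1+1) x ≤ B * (1 + X) := by
        rcases Nat.lt_or_ge 2 (m+2) with h1 | h1
        · have := c1 2 (by omega) h1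
          nlinarith
        · have : 1 + 1 = m + 2 := by omega
          rw [this]; exact c2
      have e0 : m+2+1+1-1 = m+2+1 := rfl
      rw [e0] at d1 d0 ⊢
      have e2 : nd (m+2+1) (pd q w) x ≤ X := d1.trans hXX
      calc _ ≤ B * (1 + X) * X := by gcongr
        _ = B * (X + X^2) := by ring
        _ ≤ B^2 * (2 * (1 + X^2 + Y)) := by
          have e3 : X + X^2 ≤ 2 * (1 + X^2 + Y) := by nlinarith [sq_nonneg (X - 1)]
          exact mul_le_mul dB e3 (by positivity) (by positivity)
        _ = _ := by ring
  refine (Finset.sum_le_card_nsmul _ _ _ this).trans ?_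
  rw [nsmul_eq_mul, Finset.card_range, ← mul_assoc]
  exact mul_le_mul_of_nonneg_right hconst (by positivity)

set_option maxHeartbeats 1000000 in
lemma Tw {n : ℕ} (Cs : ℕ → ℕ) (m : ℕ) : ∃ N : ℕ, ∀ M : ℝ, 2 ≤ M →
    ∀ (c : Euc n) (ρ : ℝ), 0 < ρ → ρ ≤ 1 → ρ⁻¹ ≤ M →
    ∀ a : Fin n → Fin n → Euc n → ℝ, (∀ i j, Sm (a i j)) → Ell a (Metric.ball c ρ) M →
    ∀ w : Euc n → ℝ, Sm w → CoefCtl Cs a w (Metric.ball c ρ) →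
    (∀ x ∈ Metric.ball c ρ, ∀ p, Lop a (pd p w) x = 0) →
    (∀ x ∈ Metric.ball c ρ, nd 3 w x ≤ M) →
    ∀ k, 3 ≤ k → k ≤ m + 3 → nd k w c ≤ M^N := by
  induction m with
  | zero =>
    refine ⟨1, ?_⟩
    intro M hM c ρ hρ hρ1 hρM a ha hE w hw hC hL hb k hk hk2
    obtain rfl : k = 3 := by omega
    rw [pow_one]
    exact hb c (Metric.mem_ball_self hρ)
  | succ m ih =>
    obtain ⟨N, hN⟩ := ih
    obtain ⟨N', hN'⟩ := level (n := n) (Fin n) (m+2)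
    set Cm : ℕ := ∑ s ∈ Finset.range (m+2+2), Cs s with hCm
    set b : ℕ := Cm + 1 + 2 * N * (m+2+1) + 2 * N with hb
    set T : ℕ := (m+2+1) + 1 + 2 * b + 2 with hT
    refine ⟨2 * N + n + T * N', ?_⟩
    intro M hM c ρ hρ hρ1 hρM a ha hE w hw hC hL h3 k hk hk2
    have hM0 : 0 < M := by linarith
    have hM1 : 1 ≤ M := by linarith
    have hM2 : M ≤ M^2 := self_le_pow hM (by norm_num)
    have hlow : ∀ x ∈ Metric.ball c (ρ/2), ∀ k, 3 ≤ k → k ≤ m + 3 → nd k w x ≤ M^(2*N) := by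
      intro x hx k hk1 hk
      have hsub := half_ball hx
      have := hN (M^2) (by linarith) x (ρ/2) (by linarith) (by linarith) (half_inv hM hρM) a ha
        (hE.mono hsub hM0 hM2) w hw (fun s hs y hy => hC s hs y (hsub hy))
        (fun y hy => hL y (hsub hy)) (fun y hy => (h3 y (hsub hy)).trans hM2) k hk1 hk
      rwa [← pow_mul] at this
    have hcc : c ∈ Metric.ball c (ρ/2) := Metric.mem_ball_self (by linarith)
    rcases Nat.lt_or_ge k (m+1+3) with h | h
    · exact (hlow c hcc k hk (by omega)).trans (pow_le_pow_right₀ hM1 (by omega))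
    obtain rfl : k = m + 1 + 3 := by omega
    have hsub := half_ball_sub c hρ
    set B := M^b with hBd
    have hB1 : 1 ≤ B := one_le_pow₀ hM1
    have hMB : M^(2*N) ≤ B := pow_le_pow_right₀ hM1 (by omega)
    have hMT : M ≤ M^T := self_le_pow hM (by omega)
    have hBC : ∀ s ≤ m + 2 + 1, (Cs s : ℝ) * (2 * (M^(2*N))^(m+2+1)) ≤ B := by
      intro s hs
      have h1 : Cs s ≤ Cm := Finset.single_le_sum (f := Cs) (fun _ _ => Nat.zero_le _)
        (Finset.mem_range.mpr (by omega))
      calc (Cs s : ℝ) * (2 * (M^(2*N))^(m+2+1)) ≤ M^Cm * (M * (M^(2*N))^(m+2+1)) := by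
            have : (Cs s : ℝ) ≤ M^Cm := le_trans (by exact_mod_cast h1) (absorb hM Cm)
            gcongr
        _ = M^(Cm + 1 + 2 * N * (m+2+1)) := by
            rw [← pow_mul, ← pow_succ', ← pow_add]; congr 1; ring
        _ ≤ B := pow_le_pow_right₀ hM1 (by omega)
    have hconst : ((m+2+1:ℕ):ℝ) * (2 * B^2) ≤ M^T := by
      calc ((m+2+1:ℕ):ℝ) * (2 * B^2) ≤ M^(m+2+1) * (M * B^2) := by
            have := absorb hM (m+2+1)
            gcongr
        _ = M^((m+2+1)+1+2*b) := by rw [hBd, ← pow_mul, ← pow_succ', ← pow_add]; congr 1; ring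
        _ ≤ M^T := pow_le_pow_right₀ hM1 (by omega)
    have hcb : ∀ x ∈ Metric.ball c (ρ/2), _ := fun x hx =>
      coef_bounds hC (m+2) (by omega) x (hsub hx) (M^(2*N))
        (∑ q, nd (m+2+1) (pd q w) x) (∑ q, nd (m+2+2) (pd q w) x) B (one_le_pow₀ hM1)
        (Finset.sum_nonneg fun _ _ => nd_nonneg _ _ _) (Finset.sum_nonneg fun _ _ => nd_nonneg _ _ _)
        hBC (fun k k1 k2 => hlow x hx k k1 (by omega)) (nd_succ_le hw (m+2+1) x)
        (nd_succ_le hw (m+2+2) x)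
    have key := hN' (M^T) (hM.trans hMT) c (ρ/2) (by linarith) (by linarith)
      ((half_inv hM hρM).trans (pow_le_pow_right₀ hM1 (by omega))) a ha (hE.mono hsub hM0 hMT)
      (fun q => pd q w) (fun q => hw.pd q) (fun x hx q => hL x (hsub hx) q)
      (fun x hx q => (nd_pd hw _ _ _).trans
        ((hlow x hx (m+2+1) (by omega) le_rfl).trans (pow_le_pow_right₀ hM1 (by omega))))
      (fun x hx q => by
        obtain ⟨c1, c2, c3⟩ := hcb x hx
        refine sg_bd1 hw m x q B _ (M^T) hB1 (Finset.sum_nonneg fun _ _ => nd_nonneg _ _ _) c1 c2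
          (fun k k1 k2 => (hlow x hx k k1 k2).trans hMB) (nd_succ_le hw (m+2+1) x) hconst)
      (fun x hx q => by
        obtain ⟨c1, c2, c3⟩ := hcb x hx
        refine sg_bd2 hw m x q B _ _ (M^T) hB1 (Finset.sum_nonneg fun _ _ => nd_nonneg _ _ _)
          (Finset.sum_nonneg fun _ _ => nd_nonneg _ _ _) c1 c2 c3
          (fun k k1 k2 => (hlow x hx k k1 k2).trans hMB) (nd_succ_le hw (m+2+1) x)
          (nd_succ_le hw (m+2+2) x) hconst)
    refine (nd_succ_le hw (m+2+1) c).trans ?_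
    refine (Finset.sum_le_card_nsmul _ _ _ fun q _ => key q).trans ?_
    rw [nsmul_eq_mul, ← pow_mul]
    simp only [Finset.card_univ, Fintype.card_fin]
    calc (n:ℝ) * M^(T*N') ≤ M^n * M^(T*N') := by
          have := absorb hM n
          gcongr
      _ = M^(n + T * N') := by rw [pow_add]
      _ ≤ _ := pow_le_pow_right₀ hM1 (by omega)

section MatCalc
open scoped Matrix.Norms.Operator

lemma det_diff {n : ℕ} : ContDiff ℝ (⊤ : ℕ∞) (fun A : Matrix (Fin n) (Fin n) ℝ => A.det) := by
  have e : ∀ i j : Fin n, ContDiff ℝ (⊤ : ℕ∞) (fun A : Matrix (Fin n) (Fin n) ℝ => A i j) := by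
    intro i j
    exact (LinearMap.toContinuousLinearMap (Matrix.entryLinearMap ℝ ℝ i j)).contDiff
  simp only [Matrix.det_apply']
  refine ContDiff.sum fun σ _ => contDiff_const.mul ?_
  exact contDiff_prod fun i _ => e _ _

lemma jac {n : ℕ} {g : ℝ → Matrix (Fin n) (Fin n) ℝ} {g' : Matrix (Fin n) (Fin n) ℝ} {t : ℝ}
    (h : HasDerivAt g g' t) (hd : (g t).det ≠ 0) :
    HasDerivAt (fun s => (g s).det) ((g t).det * Matrix.trace ((g t)⁻¹ * g')) t := by
  have h0 : DifferentiableAt ℝ (fun A : Matrix (Fin n) (Fin n) ℝ => A.det) (g t) :=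
    det_diff.differentiable (by simp) _
  have h1 := h0.hasFDerivAt.comp_hasDerivAt t h
  refine h1.congr_deriv (Eq.symm ?_)
  have hl : HasDerivAt (fun s : ℝ => g t + s • g') g' 0 := by
    have := ((hasDerivAt_id (0:ℝ)).smul_const g').const_add (g t)
    exact this.congr_deriv (one_smul ℝ g')
  have h2 : HasDerivAt (fun s : ℝ => (g t + s • g').det)
      (fderiv ℝ (fun A : Matrix (Fin n) (Fin n) ℝ => A.det) (g t) g') 0 := by
    have h3 : HasFDerivAt (fun A : Matrix (Fin n) (Fin n) ℝ => A.det)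
        (fderiv ℝ (fun A : Matrix (Fin n) (Fin n) ℝ => A.det) (g t)) (g t + (0:ℝ) • g') := by
      simpa using h0.hasFDerivAt
    exact h3.comp_hasDerivAt (0:ℝ) hl
  refine HasDerivAt.unique ?_ h2
  have hu : IsUnit (g t).det := isUnit_iff_ne_zero.mpr hd
  set P := ((Matrix.det (1 + (Polynomial.X : Polynomial ℝ) •
    ((g t)⁻¹ * g').map Polynomial.C)).divX.divX) with hP
  have e : (fun s : ℝ => (g t + s • g').det) = fun s => (g t).det *
      (1 + Matrix.trace ((g t)⁻¹ * g') * s + P.eval s * s^2) := by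
    ext s
    rw [← Matrix.det_one_add_smul, ← Matrix.det_mul]
    congr 1
    rw [mul_add, mul_one, mul_smul_comm, ← mul_assoc, Matrix.mul_nonsing_inv _ hu, one_mul]
  rw [e]
  refine HasDerivAt.const_mul _ ?_
  have hh := (((hasDerivAt_id (0:ℝ)).const_mul (Matrix.trace ((g t)⁻¹ * g'))).const_add 1).add
    ((P.hasDerivAt 0).mul (hasDerivAt_pow 2 (0:ℝ)))
  exact hh.congr_deriv (by simp)

lemma inv_deriv {n : ℕ} {g : ℝ → Matrix (Fin n) (Fin n) ℝ} {g' : Matrix (Fin n) (Fin n) ℝ} {t : ℝ}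
    (h : HasDerivAt g g' t) (hd : (g t).det ≠ 0) :
    HasDerivAt (fun s => (g s)⁻¹) (-((g t)⁻¹ * g' * (g t)⁻¹)) t := by
  have hu : IsUnit (g t) := (Matrix.isUnit_iff_isUnit_det _).mpr (isUnit_iff_ne_zero.mpr hd)
  have e : (fun s => (g s)⁻¹) = fun s => Ring.inverse (g s) := by
    ext1 s; exact Matrix.nonsing_inv_eq_ringInverse _
  rw [e]
  obtain ⟨u, hu⟩ := hu
  have h1 := hasFDerivAt_ringInverse (𝕜 := ℝ) u
  rw [hu] at h1
  have h2 := h1.comp_hasDerivAt t h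
  refine h2.congr_deriv ?_
  have : (g t)⁻¹ = ((u⁻¹ : (Matrix (Fin n) (Fin n) ℝ)ˣ) : Matrix (Fin n) (Fin n) ℝ) := by
    rw [← hu, Matrix.coe_units_inv]
  rw [this]
  simp

lemma trace_deriv {n : ℕ} {g : ℝ → Matrix (Fin n) (Fin n) ℝ} {g' : Matrix (Fin n) (Fin n) ℝ} {t : ℝ}
    (h : HasDerivAt g g' t) : HasDerivAt (fun s => (g s).trace) g'.trace t := by
  have := (LinearMap.toContinuousLinearMap (Matrix.traceLinearMap (Fin n) ℝ ℝ)).hasFDerivAt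
    (x := g t) |>.comp_hasDerivAt t h
  exact this

lemma det_const1 {n : ℕ} {g : ℝ → Matrix (Fin n) (Fin n) ℝ} {g' : Matrix (Fin n) (Fin n) ℝ} {t d : ℝ}
    (h : HasDerivAt g g' t) (hd : d ≠ 0) (hc : ∀ᶠ s in nhds t, (g s).det = d) :
    Matrix.trace ((g t)⁻¹ * g') = 0 := by
  have e := hc.self_of_nhds
  have h1 := jac h (by rw [e]; exact hd)
  have h2 : HasDerivAt (fun s => (g s).det) 0 t := (hasDerivAt_const t d).congr_of_eventuallyEq hc
  have := h1.unique h2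
  rw [e] at this
  exact (mul_eq_zero.mp this).resolve_left hd

lemma det_const3 {n : ℕ} {g g1 g2 : ℝ → Matrix (Fin n) (Fin n) ℝ} {g3 : Matrix (Fin n) (Fin n) ℝ}
    {d : ℝ} (h1 : ∀ t, HasDerivAt g (g1 t) t) (h2 : ∀ t, HasDerivAt g1 (g2 t) t)
    (h3 : HasDerivAt g2 g3 0) (hd : d ≠ 0) (hc : ∀ᶠ s in nhds 0, (g s).det = d) (h0 : g 0 = 1) :
    Matrix.trace (g2 0) = Matrix.trace (g1 0 * g1 0) ∧
    Matrix.trace g3 = 3 * Matrix.trace (g1 0 * g2 0) - 2 * Matrix.trace (g1 0 * g1 0 * g1 0) := by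
  have hne : ∀ᶠ s in nhds (0:ℝ), (g s).det ≠ 0 := hc.mono fun s hs => by rw [hs]; exact hd
  have a1 : ∀ᶠ s in nhds (0:ℝ), Matrix.trace ((g s)⁻¹ * g1 s) = 0 :=
    hc.eventually_nhds.mono fun s hs => det_const1 (h1 s) hd hs
  have b1 : ∀ s, (g s).det ≠ 0 → HasDerivAt (fun s => Matrix.trace ((g s)⁻¹ * g1 s))
      (Matrix.trace (-((g s)⁻¹ * g1 s * (g s)⁻¹) * g1 s + (g s)⁻¹ * g2 s)) s := fun s hs =>
    trace_deriv ((inv_deriv (h1 s) hs).mul (h2 s))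
  have a2 : ∀ᶠ s in nhds (0:ℝ),
      Matrix.trace (-((g s)⁻¹ * g1 s * (g s)⁻¹) * g1 s + (g s)⁻¹ * g2 s) = 0 := by
    filter_upwards [a1.eventually_nhds, hne] with s hs hs2
    exact (b1 s hs2).unique ((hasDerivAt_const s (0:ℝ)).congr_of_eventuallyEq hs)
  have i0 : (g 0)⁻¹ = 1 := by rw [h0, inv_one]
  have hG := inv_deriv (h1 0) hne.self_of_nhds
  have b2 := trace_deriv (((((hG.mul (h1 0 |> fun _ => h2 0)).mul hG).neg).mul (h2 0)).add
    (hG.mul h3))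
  have b3 := b2.unique ((hasDerivAt_const (0:ℝ) (0:ℝ)).congr_of_eventuallyEq a2)
  have b4 := a2.self_of_nhds
  simp only [Pi.mul_apply, Pi.neg_apply, i0, one_mul, mul_one] at b3 b4
  constructor
  · rw [Matrix.trace_add, neg_mul, Matrix.trace_neg] at b4
    linarith
  · have c1 : Matrix.trace (g2 0 * g1 0) = Matrix.trace (g1 0 * g2 0) := Matrix.trace_mul_comm _ _
    simp only [add_mul, neg_mul, neg_add, mul_neg, neg_neg, Matrix.trace_add, Matrix.trace_neg] at b3
    rw [mul_assoc] at b3 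
    simp only [mul_assoc] at b3 ⊢
    linarith
end MatCalc

lemma calabi_alg {n : ℕ} (A : Fin n → Fin n → ℝ) (ξ : Fin n → ℝ) (s : ℝ) (hs : ∑ i, ξ i * ξ i = s)
    (hsym : ∀ i j, A i j = A j i) (hA : ∀ i, ∑ j, A i j * ξ j = s * ξ i)
    (hle : ∀ η : Fin n → ℝ, ∑ i, ∑ j, A i j * (η i * η j) ≤
      (∑ i, ξ i * η i)^2 + s / 2 * ∑ i, η i * η i) :
    s^3 ≤ 3 * s * (∑ l, ∑ i, A l i * A l i) - 2 * ∑ l, ∑ i, ∑ j, A i j * (A l i * A l j) := by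
  have hs0 : 0 ≤ s := by rw [← hs]; exact Finset.sum_nonneg fun i _ => mul_self_nonneg _
  have e1 : ∀ l, ∑ i, ξ i * A l i = s * ξ l := fun l => by
    rw [← hA l]; exact Finset.sum_congr rfl fun i _ => mul_comm _ _
  have n1 : ∀ l, ∑ i, (A l i - ξ l * ξ i) * (A l i - ξ l * ξ i) =
      (∑ i, A l i * A l i) - s * (ξ l * ξ l) := fun l => by
    calc _ = (∑ i, A l i * A l i) - 2 * ξ l * (∑ i, ξ i * A l i) + ξ l * ξ l * ∑ i, ξ i * ξ i := by
          rw [Finset.mul_sum, Finset.mul_sum, ← Finset.sum_sub_distrib, ← Finset.sum_add_distrib]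
          exact Finset.sum_congr rfl fun i _ => by ring
      _ = _ := by rw [e1, hs]; ring
  have n0 : ∀ l, ∑ i, ξ i * (A l i - ξ l * ξ i) = 0 := fun l => by
    calc _ = (∑ i, ξ i * A l i) - ξ l * ∑ i, ξ i * ξ i := by
          rw [Finset.mul_sum, ← Finset.sum_sub_distrib]
          exact Finset.sum_congr rfl fun i _ => by ring
      _ = _ := by rw [e1, hs]; ring
  have n2 : ∀ l, ∑ i, ∑ j, A i j * ((A l i - ξ l * ξ i) * (A l j - ξ l * ξ j)) =
      (∑ i, ∑ j, A i j * (A l i * A l j)) - s^2 * (ξ l * ξ l) := fun l => by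
    have m1 : ∑ i, ∑ j, A i j * (A l i * ξ j) = s^2 * ξ l := by
      calc _ = ∑ i, s * (ξ i * A l i) := by
            refine Finset.sum_congr rfl fun i _ => ?_
            calc _ = A l i * ∑ j, A i j * ξ j := by
                  rw [Finset.mul_sum]; exact Finset.sum_congr rfl fun j _ => by ring
              _ = _ := by rw [hA]; ring
        _ = _ := by rw [← Finset.mul_sum, e1]; ring
    have m2 : ∑ i, ∑ j, A i j * (ξ i * A l j) = s^2 * ξ l := by
      rw [← m1, Finset.sum_comm]
      refine Finset.sum_congr rfl fun i _ => Finset.sum_congr rfl fun j _ => ?_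
      rw [hsym j i]; ring
    have m3 : ∑ i, ∑ j, A i j * (ξ i * ξ j) = s^2 := by
      calc _ = ∑ i, s * (ξ i * ξ i) := by
            refine Finset.sum_congr rfl fun i _ => ?_
            calc _ = ξ i * ∑ j, A i j * ξ j := by
                  rw [Finset.mul_sum]; exact Finset.sum_congr rfl fun j _ => by ring
              _ = _ := by rw [hA]; ring
        _ = _ := by rw [← Finset.mul_sum, hs]; ring
    calc _ = (∑ i, ∑ j, A i j * (A l i * A l j)) - ξ l * (∑ i, ∑ j, A i j * (A l i * ξ j))
          - ξ l * (∑ i, ∑ j, A i j * (ξ i * A l j)) + ξ l * ξ l * ∑ i, ∑ j, A i j * (ξ i * ξ j) := by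
          simp only [Finset.mul_sum, ← Finset.sum_sub_distrib, ← Finset.sum_add_distrib]
          exact Finset.sum_congr rfl fun i _ => Finset.sum_congr rfl fun j _ => by ring
      _ = _ := by rw [m1, m2, m3]; ring
  have n3 : ∀ l, (∑ i, ∑ j, A i j * (A l i * A l j)) - s^2 * (ξ l * ξ l) ≤
      s / 2 * ((∑ i, A l i * A l i) - s * (ξ l * ξ l)) := fun l => by
    have := hle fun i => A l i - ξ l * ξ i
    simp only [n0, n1, n2] at this
    linarith
  have n4 : ∀ l, 0 ≤ (∑ i, A l i * A l i) - s * (ξ l * ξ l) := fun l => by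
    rw [← n1]; exact Finset.sum_nonneg fun i _ => mul_self_nonneg _
  have t3 := Finset.sum_le_sum fun l (_ : l ∈ Finset.univ) => n3 l
  have t4 := Finset.sum_nonneg fun l (_ : l ∈ Finset.univ) => n4 l
  simp only [Finset.sum_sub_distrib, ← Finset.mul_sum, hs] at t3 t4
  nlinarith

def dd {n : ℕ} (v : Euc n) (u : Euc n → ℝ) : Euc n → ℝ := fun x => fderiv ℝ u x v

section DD
variable {n : ℕ} {u u' : Euc n → ℝ}

lemma Sm.dd (h : Sm u) (v : Euc n) : Sm (dd v u) := h.fd.clm_apply contDiff_const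

lemma dd_eq (h : Sm u) (a b x : Euc n) : dd a (dd b u) x = fderiv ℝ (fderiv ℝ u) x a b := by
  unfold dd
  rw [fderiv_clm_apply (h.fd.differentiable (by simp) x) (differentiableAt_const b)]; simp

lemma dd_comm (h : Sm u) (a b : Euc n) : dd a (dd b u) = dd b (dd a u) := by
  ext x
  rw [dd_eq h, dd_eq h]
  exact (h.contDiffAt.isSymmSndFDerivAt (by simp; exact WithTop.coe_le_coe.mpr (le_top : (2:ℕ∞) ≤ ⊤))) a b

lemma dd_add_dir (a b : Euc n) (u : Euc n → ℝ) : dd (a + b) u = fun x => dd a u x + dd b u x := by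
  ext x; simp [dd]

lemma dd_smul_dir (c : ℝ) (a : Euc n) (u : Euc n → ℝ) : dd (c • a) u = fun x => c * dd a u x := by
  ext x; simp [dd]

lemma dd_sum_dir {ι : Type*} (s : Finset ι) (c : ι → ℝ) (a : ι → Euc n) (u : Euc n → ℝ) :
    dd (∑ i ∈ s, c i • a i) u = fun x => ∑ i ∈ s, c i * dd (a i) u x := by
  ext x; simp [dd]

lemma dd_add (hu : Sm u) (hv : Sm u') (a : Euc n) :
    dd a (fun x => u x + u' x) = fun x => dd a u x + dd a u' x := by
  ext x; simp only [dd]; rw [fderiv_fun_add (hu.diff x) (hv.diff x)]; rfl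

lemma dd_const_mul (hu : Sm u) (c : ℝ) (a : Euc n) :
    dd a (fun x => c * u x) = fun x => c * dd a u x := by
  ext x; simp only [dd]; rw [fderiv_const_mul (hu.diff x)]; rfl

lemma dd_sum {ι : Type*} {s : Finset ι} {f : ι → Euc n → ℝ} (h : ∀ i ∈ s, Sm (f i))
    (a : Euc n) : dd a (fun x => ∑ j ∈ s, f j x) = fun x => ∑ j ∈ s, dd a (f j) x := by
  ext x; simp only [dd]; rw [fderiv_fun_sum (fun j hj => (h j hj).diff x)]; simp

lemma line (h : Sm u) (x f : Euc n) (t : ℝ) :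
    HasDerivAt (fun t : ℝ => u (x + t • f)) (dd f u (x + t • f)) t := by
  have h1 : HasDerivAt (fun t : ℝ => x + t • f) f t := by
    have := ((hasDerivAt_id t).smul_const f).const_add x
    exact this.congr_deriv (one_smul ℝ f)
  exact (h.diff _).hasFDerivAt.comp_hasDerivAt t h1

/-- quadratic form of the Hessian along a segment of directions -/
lemma q2_expand (h : Sm u) (ξ q : Euc n) (t : ℝ) (x : Euc n) :
    dd (ξ + t • q) (dd (ξ + t • q) u) x =
      dd ξ (dd ξ u) x + 2 * t * dd q (dd ξ u) x + t^2 * dd q (dd q u) x := by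
  have c := dd_comm h q ξ
  rw [dd_add_dir _ _ u, dd_smul_dir, dd_add (h.dd ξ) (contDiff_const.mul (h.dd q)),
    dd_add_dir, dd_smul_dir]
  simp only [dd_const_mul (h.dd q), dd_add_dir, dd_smul_dir, c]
  ring

lemma q3_expand (h : Sm u) (ξ q : Euc n) (t : ℝ) (x : Euc n) :
    dd (ξ + t • q) (dd (ξ + t • q) (dd (ξ + t • q) u)) x =
      dd ξ (dd ξ (dd ξ u)) x + 3 * t * dd q (dd ξ (dd ξ u)) x + 3 * t^2 * dd q (dd q (dd ξ u)) x
        + t^3 * dd q (dd q (dd q u)) x := by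
  have c : dd (ξ + t • q) (dd (ξ + t • q) (dd (ξ + t • q) u)) x =
      dd (ξ + t • q) (dd (ξ + t • q) (dd ξ u)) x
        + t * dd (ξ + t • q) (dd (ξ + t • q) (dd q u)) x := by
    rw [dd_add_dir _ _ u, dd_smul_dir, dd_add (h.dd ξ) (contDiff_const.mul (h.dd q)),
      dd_add ((h.dd ξ).dd _) (Sm.dd (contDiff_const.mul (h.dd q)) _)]
    simp only [dd_const_mul (h.dd q), dd_const_mul ((h.dd q).dd _)]
  rw [c, q2_expand (h.dd ξ), q2_expand (h.dd q)]
  have c1 : dd q (dd ξ (dd q u)) = dd q (dd q (dd ξ u)) := by rw [dd_comm h ξ q]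
  have c2 : dd ξ (dd ξ (dd q u)) = dd q (dd ξ (dd ξ u)) := by
    rw [dd_comm h ξ q, dd_comm (h.dd ξ) ξ q]
  rw [c1, c2]
  ring

/-- derivative of a quartic-in-t combination along a line -/
lemma poly_line {u0 u1 u2 u3 : Euc n → ℝ} (h0 : Sm u0) (h1 : Sm u1) (h2 : Sm u2) (h3 : Sm u3)
    (x f : Euc n) : ∃ p' : ℝ → ℝ,
    (∀ t, HasDerivAt (fun t : ℝ => u0 (x + t • f) + t * u1 (x + t • f) + t^2 * u2 (x + t • f)
      + t^3 * u3 (x + t • f)) (p' t) t) ∧ p' 0 = dd f u0 x + u1 x ∧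
    HasDerivAt p' (dd f (dd f u0) x + 2 * dd f u1 x + 2 * u2 x) 0 := by
  refine ⟨fun t => dd f u0 (x + t • f) + (u1 (x + t • f) + t * dd f u1 (x + t • f))
    + (2 * t * u2 (x + t • f) + t^2 * dd f u2 (x + t • f))
    + (3 * t^2 * u3 (x + t • f) + t^3 * dd f u3 (x + t • f)), fun t => ?_, ?_, ?_⟩
  · have a := (((line h0 x f t).add ((hasDerivAt_id t).mul (line h1 x f t))).add
      ((hasDerivAt_pow 2 t).mul (line h2 x f t))).add ((hasDerivAt_pow 3 t).mul (line h3 x f t))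
    refine a.congr_deriv ?_
    simp
  · simp
  · have a := (((line (h0.dd f) x f 0).add ((line h1 x f 0).add
      ((hasDerivAt_id 0).mul (line (h1.dd f) x f 0)))).add
      ((((hasDerivAt_id 0).const_mul 2).mul (line h2 x f 0)).add
      ((hasDerivAt_pow 2 (0:ℝ)).mul (line (h2.dd f) x f 0)))).add
      ((((hasDerivAt_pow 2 (0:ℝ)).const_mul 3).mul (line h3 x f 0)).add
      ((hasDerivAt_pow 3 (0:ℝ)).mul (line (h3.dd f) x f 0)))
    refine a.congr_deriv ?_
    simp
    ring

lemma D_line (h : Sm u) (x f ξ q : Euc n) : ∃ p' : ℝ → ℝ,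
    (∀ t, HasDerivAt (fun t : ℝ => dd (ξ + t • q) (dd (ξ + t • q) u) (x + t • f)) (p' t) t) ∧
    p' 0 = dd f (dd ξ (dd ξ u)) x + 2 * dd q (dd ξ u) x ∧
    HasDerivAt p' (dd f (dd f (dd ξ (dd ξ u))) x + 4 * dd f (dd q (dd ξ u)) x
      + 2 * dd q (dd q u) x) 0 := by
  have hu1 : Sm (fun x => 2 * dd q (dd ξ u) x) := contDiff_const.mul ((h.dd ξ).dd q)
  obtain ⟨p', a, b, c⟩ := poly_line ((h.dd ξ).dd ξ) hu1 ((h.dd q).dd q)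
    (contDiff_const (c := (0:ℝ))) x f
  refine ⟨p', fun t => (a t).congr_of_eventuallyEq (Filter.Eventually.of_forall fun t => ?_), b, ?_⟩
  · beta_reduce; rw [q2_expand h]; ring
  · refine c.congr_deriv ?_
    rw [dd_const_mul ((h.dd ξ).dd q)]; ring

lemma N_line (h : Sm u) (x f ξ q : Euc n) : ∃ p' : ℝ → ℝ,
    (∀ t, HasDerivAt (fun t : ℝ => dd (ξ + t • q) (dd (ξ + t • q) (dd (ξ + t • q) u)) (x + t • f))
      (p' t) t) ∧
    p' 0 = dd f (dd ξ (dd ξ (dd ξ u))) x + 3 * dd q (dd ξ (dd ξ u)) x ∧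
    HasDerivAt p' (dd f (dd f (dd ξ (dd ξ (dd ξ u)))) x + 6 * dd f (dd q (dd ξ (dd ξ u))) x
      + 6 * dd q (dd q (dd ξ u)) x) 0 := by
  have hu1 : Sm (fun x => 3 * dd q (dd ξ (dd ξ u)) x) :=
    contDiff_const.mul (((h.dd ξ).dd ξ).dd q)
  have hu2 : Sm (fun x => 3 * dd q (dd q (dd ξ u)) x) :=
    contDiff_const.mul (((h.dd ξ).dd q).dd q)
  obtain ⟨p', a, b, c⟩ := poly_line (((h.dd ξ).dd ξ).dd ξ) hu1 hu2 (((h.dd q).dd q).dd q) x f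
  refine ⟨p', fun t => (a t).congr_of_eventuallyEq (Filter.Eventually.of_forall fun t => ?_), b, ?_⟩
  · beta_reduce; rw [q3_expand h]; ring
  · refine c.congr_deriv ?_
    rw [dd_const_mul (((h.dd ξ).dd ξ).dd q)]; ring

/-- the Calabi-type quantity -/
def Psi (u : Euc n → ℝ) (x ξ : Euc n) : ℝ :=
  4 * dd ξ (dd ξ (dd ξ u)) x - 3 * (dd ξ (dd ξ u) x)^2

lemma Psi_line (h : Sm u) (x f ξ q : Euc n) : ∃ p' : ℝ → ℝ,
    (∀ t, HasDerivAt (fun t : ℝ => Psi u (x + t • f) (ξ + t • q)) (p' t) t) ∧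
    p' 0 = 4 * (dd f (dd ξ (dd ξ (dd ξ u))) x + 3 * dd q (dd ξ (dd ξ u)) x)
      - 6 * (dd ξ (dd ξ u) x) * (dd f (dd ξ (dd ξ u)) x + 2 * dd q (dd ξ u) x) ∧
    HasDerivAt p' (4 * (dd f (dd f (dd ξ (dd ξ (dd ξ u)))) x + 6 * dd f (dd q (dd ξ (dd ξ u))) x
      + 6 * dd q (dd q (dd ξ u)) x)
      - 6 * ((dd f (dd ξ (dd ξ u)) x + 2 * dd q (dd ξ u) x)^2 + dd ξ (dd ξ u) x *
        (dd f (dd f (dd ξ (dd ξ u))) x + 4 * dd f (dd q (dd ξ u)) x + 2 * dd q (dd q u) x))) 0 := by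
  obtain ⟨d, d1, d2, d3⟩ := D_line h x f ξ q
  obtain ⟨p, p1, p2, p3⟩ := N_line h x f ξ q
  refine ⟨fun t => 4 * p t - 3 * (2 * (dd (ξ + t • q) (dd (ξ + t • q) u) (x + t • f) * d t)),
    fun t => ?_, ?_, ?_⟩
  · have := ((p1 t).const_mul 4).sub (((d1 t).pow 2).const_mul 3)
    refine this.congr_deriv ?_
    simp; ring
  · simp [p2, d2]; ring
  · have := (p3.const_mul 4).sub ((((d1 0).mul d3).const_mul 2).const_mul 3)
    refine this.congr_deriv ?_
    simp [d2]; ring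
end DD

section MatCalc2
open scoped Matrix.Norms.Operator

lemma mat_deriv {n : ℕ} {g : ℝ → Matrix (Fin n) (Fin n) ℝ} {g' : Matrix (Fin n) (Fin n) ℝ} {t : ℝ}
    (h : ∀ i j, HasDerivAt (fun s => g s i j) (g' i j) t) : HasDerivAt g g' t := by
  exact hasDerivAt_pi.2 fun i => hasDerivAt_pi.2 fun j => h i j

def Hs {n : ℕ} (w : Euc n → ℝ) (x : Euc n) : Matrix (Fin n) (Fin n) ℝ :=
  Matrix.of fun i j => pd i (pd j w) x

lemma gram_det {n : ℕ} {w : Euc n → ℝ} (h : Sm w) (f : Fin n → Euc n) :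
    ∃ c : ℝ, ∀ x, (Matrix.of fun i j => dd (f i) (dd (f j) w) x : Matrix (Fin n) (Fin n) ℝ).det
      = c * (Hs w x).det := by
  set F : Matrix (Fin n) (Fin n) ℝ := Matrix.of fun i k => (f i) k with hF
  refine ⟨F.det * F.transpose.det, fun x => ?_⟩
  have : (Matrix.of fun i j => dd (f i) (dd (f j) w) x : Matrix (Fin n) (Fin n) ℝ) =
      F * Hs w x * F.transpose := by
    ext i j
    simp only [Matrix.of_apply, Matrix.mul_apply, Matrix.transpose_apply, hF, Hs]
    rw [dd_eq h, fderiv2_eq_sum h]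
    rw [Finset.sum_comm]
    refine Finset.sum_congr rfl fun k _ => ?_
    rw [Finset.sum_mul]
    exact Finset.sum_congr rfl fun l _ => by ring
  rw [this, Matrix.det_mul, Matrix.det_mul]; ring

lemma frame {n : ℕ} {w : Euc n → ℝ} (h : Sm w) (x : Euc n) (κ : ℝ) (hκ : 0 < κ)
    (hp : ∀ v, κ * ‖v‖^2 ≤ dd v (dd v w) x) :
    ∃ f : Module.Basis (Fin n) ℝ (Euc n), ∀ i j, dd (f i) (dd (f j) w) x = if i = j then 1 else 0 := by
  set B : LinearMap.BilinForm ℝ (Euc n) :=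
    LinearMap.mk₂ ℝ (fun a b => dd a (dd b w) x)
      (fun a b c => by simp only [dd_eq h]; simp) (fun c a b => by simp only [dd_eq h]; simp)
      (fun a b c => by simp only [dd_eq h]; simp) (fun c a b => by simp only [dd_eq h]; simp) with hB
  have hBa : ∀ a b, B a b = dd a (dd b w) x := fun a b => rfl
  have hsym : LinearMap.IsSymm (M := Euc n) B := ⟨fun a b => by
    simp only [RingHom.id_apply, hBa]; rw [dd_comm h]⟩
  have : Invertible (2:ℝ) := invertibleOfNonzero two_ne_zero
  obtain ⟨v, hv⟩ := LinearMap.BilinForm.exists_orthogonal_basis hsym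
  have hn : Module.finrank ℝ (Euc n) = n := by simp
  set v' := v.reindex (finCongr hn) with hv'
  have ho : ∀ i j, i ≠ j → dd (v' i) (dd (v' j) w) x = 0 := by
    intro i j hij
    have := hv (i := (finCongr hn).symm i) (j := (finCongr hn).symm j)
      (fun e => hij ((finCongr hn).symm.injective e))
    simpa [hv', Function.onFun, hBa] using! this
  have hpos : ∀ i, 0 < dd (v' i) (dd (v' i) w) x := fun i => by
    refine lt_of_lt_of_le ?_ (hp (v' i))
    have : 0 < ‖v' i‖ := norm_pos_iff.mpr (v'.ne_zero i)
    positivity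
  set c : Fin n → ℝ := fun i => (Real.sqrt (dd (v' i) (dd (v' i) w) x))⁻¹ with hc
  have hc0 : ∀ i, c i ≠ 0 := fun i => inv_ne_zero (Real.sqrt_pos.mpr (hpos i)).ne'
  refine ⟨v'.isUnitSMul (fun i => (hc0 i).isUnit), fun i j => ?_⟩
  simp only [Module.Basis.isUnitSMul_apply]
  have e : dd (c i • v' i) (dd (c j • v' j) w) x = c i * (c j * dd (v' i) (dd (v' j) w) x) := by
    simp only [dd_eq h]; simp; ring
  rw [e]
  split_ifs with hij
  · subst hij
    have := Real.mul_self_sqrt (hpos i).le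
    simp only [hc]
    have h3 := (Real.sqrt_pos.mpr (hpos i)).ne'
    field_simp
    nlinarith
  · rw [ho i j hij]; ring

lemma ma_ident {n : ℕ} {w : Euc n → ℝ} (h : Sm w) (x ξ : Euc n) (f : Fin n → Euc n) (d : ℝ)
    (hc : ∀ᶠ y in nhds x, (Hs w y).det = d)
    (hf : ∀ i j, dd (f i) (dd (f j) w) x = if i = j then 1 else 0) :
    (∑ l, dd ξ (dd ξ (dd (f l) (dd (f l) w))) x =
      ∑ l, ∑ i, dd ξ (dd (f l) (dd (f i) w)) x * dd ξ (dd (f i) (dd (f l) w)) x) ∧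
    ∑ l, dd ξ (dd ξ (dd ξ (dd (f l) (dd (f l) w)))) x =
      3 * (∑ l, ∑ i, dd ξ (dd (f l) (dd (f i) w)) x * dd ξ (dd ξ (dd (f i) (dd (f l) w))) x)
      - 2 * ∑ l, ∑ i, (∑ j, dd ξ (dd (f l) (dd (f j) w)) x * dd ξ (dd (f j) (dd (f i) w)) x)
        * dd ξ (dd (f i) (dd (f l) w)) x := by
  obtain ⟨c, hcc⟩ := gram_det h f
  set g : ℝ → Matrix (Fin n) (Fin n) ℝ := fun t => Matrix.of fun i j =>
    dd (f i) (dd (f j) w) (x + t • ξ)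
  set g1 : ℝ → Matrix (Fin n) (Fin n) ℝ := fun t => Matrix.of fun i j =>
    dd ξ (dd (f i) (dd (f j) w)) (x + t • ξ)
  set g2 : ℝ → Matrix (Fin n) (Fin n) ℝ := fun t => Matrix.of fun i j =>
    dd ξ (dd ξ (dd (f i) (dd (f j) w))) (x + t • ξ)
  have hg0 : g 0 = 1 := by
    ext i j; simp [g, hf, Matrix.one_apply]
  have hcd : c * d = 1 := by
    have := hcc x
    rw [hc.self_of_nhds] at this
    rw [← this]
    have e : (Matrix.of fun i j => dd (f i) (dd (f j) w) x) = g 0 := by simp [g]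
    rw [e, hg0, Matrix.det_one]
  have hdet : ∀ᶠ s in nhds (0:ℝ), (g s).det = 1 := by
    have ct : Filter.Tendsto (fun s : ℝ => x + s • ξ) (nhds 0) (nhds x) := by
      have : Continuous fun s : ℝ => x + s • ξ := by fun_prop
      simpa using this.tendsto 0
    filter_upwards [ct.eventually hc] with s hs
    rw [hcc, hs, hcd]
  have key := det_const3 (g := g) (g1 := g1) (g2 := g2)
    (g3 := Matrix.of fun i j => dd ξ (dd ξ (dd ξ (dd (f i) (dd (f j) w)))) (x + (0:ℝ) • ξ))
    (fun t => mat_deriv fun i j => line ((h.dd _).dd _) x ξ t)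
    (fun t => mat_deriv fun i j => line (((h.dd _).dd _).dd _) x ξ t)
    (mat_deriv fun i j => line ((((h.dd _).dd _).dd _).dd _) x ξ 0) one_ne_zero hdet hg0
  simpa [g, g1, g2, Matrix.trace, Matrix.mul_apply] using key
end MatCalc2

lemma dd2_sum {n : ℕ} {u : Euc n → ℝ} (h : Sm u) (c d : Fin n → ℝ) (f : Fin n → Euc n)
    (x : Euc n) : dd (∑ i, c i • f i) (dd (∑ j, d j • f j) u) x =
      ∑ i, ∑ j, c i * d j * dd (f i) (dd (f j) u) x := by
  simp only [dd_eq h, map_sum, map_smul, sum_apply, smul_apply, smul_eq_mul, Finset.mul_sum]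
  rw [Finset.sum_comm]
  exact Finset.sum_congr rfl fun i _ => Finset.sum_congr rfl fun j _ => by ring

lemma dd1_sum {n : ℕ} {u : Euc n → ℝ} (h : Sm u) (a : Euc n) (d : Fin n → ℝ) (f : Fin n → Euc n)
    (x : Euc n) : dd a (dd (∑ j, d j • f j) u) x =
      ∑ j, d j * dd a (dd (f j) u) x := by
  simp [dd_eq h]

/-- second derivative of Psi along (f, q) -/
def Psi2 {n : ℕ} (u : Euc n → ℝ) (x f ξ q : Euc n) : ℝ :=
  4 * (dd f (dd f (dd ξ (dd ξ (dd ξ u)))) x + 6 * dd f (dd q (dd ξ (dd ξ u))) x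
      + 6 * dd q (dd q (dd ξ u)) x)
      - 6 * ((dd f (dd ξ (dd ξ u)) x + 2 * dd q (dd ξ u) x)^2 + dd ξ (dd ξ u) x *
        (dd f (dd f (dd ξ (dd ξ u))) x + 4 * dd f (dd q (dd ξ u)) x + 2 * dd q (dd q u) x))

lemma calabi_second {n : ℕ} {w : Euc n → ℝ} (h : Sm w) (x ξ : Euc n)
    (f : Module.Basis (Fin n) ℝ (Euc n)) (d s : ℝ)
    (hc : ∀ᶠ y in nhds x, (Hs w y).det = d)
    (hf : ∀ i j, dd (f i) (dd (f j) w) x = if i = j then 1 else 0)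
    (hs : dd ξ (dd ξ w) x = s)
    (h1 : ∀ η, dd η (dd ξ (dd ξ w)) x = s * dd η (dd ξ w) x)
    (h2 : ∀ η, dd η (dd η (dd ξ w)) x ≤ (dd η (dd ξ w) x)^2 + s / 2 * dd η (dd η w) x) :
    s^3 ≤ ∑ l, Psi2 w x (f l) ξ (∑ j, (-(1/2) * dd (f l) (dd (f j) (dd ξ w)) x) • f j) := by
  set A : Fin n → Fin n → ℝ := fun i j => dd (f i) (dd (f j) (dd ξ w)) x with hA
  set B : Fin n → Fin n → ℝ := fun i j => dd (f i) (dd (f j) (dd ξ (dd ξ w))) x with hB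
  have hAs : ∀ i j, A i j = A j i := fun i j => by simp only [hA]; rw [dd_comm (h.dd ξ)]
  have hBs : ∀ i j, B i j = B j i := fun i j => by simp only [hB]; rw [dd_comm ((h.dd ξ).dd ξ)]
  set c : Fin n → ℝ := fun i => f.repr ξ i with hcd
  have hξ : ξ = ∑ i, c i • f i := (f.sum_repr ξ).symm
  have hcf : ∀ i, dd (f i) (dd ξ w) x = c i := fun i => by
    conv_lhs => rw [hξ]
    rw [dd1_sum h]; simp [hf]
  have hcη : ∀ η : Fin n → ℝ, dd (∑ i, η i • f i) (dd ξ w) x = ∑ i, c i * η i := fun η => by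
    conv_lhs => rw [hξ]
    rw [dd2_sum h]; simp [hf, mul_comm]
  have hηη : ∀ η : Fin n → ℝ, dd (∑ i, η i • f i) (dd (∑ i, η i • f i) w) x = ∑ i, η i * η i :=
    fun η => by rw [dd2_sum h]; simp [hf]
  have hηA : ∀ η : Fin n → ℝ, dd (∑ i, η i • f i) (dd (∑ i, η i • f i) (dd ξ w)) x =
      ∑ i, ∑ j, A i j * (η i * η j) := fun η => by
    rw [dd2_sum (h.dd ξ)]
    exact Finset.sum_congr rfl fun i _ => Finset.sum_congr rfl fun j _ => by simp only [hA]; ring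
  have hcs : ∑ i, c i * c i = s := by rw [← hηη, ← hξ, hs]
  have hAc : ∀ i, ∑ j, A i j * c j = s * c i := fun i => by
    rw [← hcf i, ← h1]
    conv_rhs => arg 2; arg 1; rw [hξ]
    rw [dd1_sum (h.dd ξ)]
    exact Finset.sum_congr rfl fun j _ => mul_comm _ _
  have alg := calabi_alg A c s hcs hAs hAc (fun η => by
    rw [← hηA, ← hcη, ← hηη]; exact h2 _)
  refine alg.trans (le_of_eq ?_)
  have m1 : ∀ i j, dd ξ (dd (f i) (dd (f j) w)) = dd (f i) (dd (f j) (dd ξ w)) := fun i j => by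
    rw [dd_comm (h.dd _), dd_comm h]
  have m2 : ∀ i j, dd ξ (dd ξ (dd (f i) (dd (f j) w))) = dd (f i) (dd (f j) (dd ξ (dd ξ w))) :=
    fun i j => by rw [m1, dd_comm ((h.dd _).dd _), dd_comm (h.dd _) ξ (f j)]
  have m3 : ∀ i j, dd ξ (dd ξ (dd ξ (dd (f i) (dd (f j) w)))) =
      dd (f i) (dd (f j) (dd ξ (dd ξ (dd ξ w)))) :=
    fun i j => by rw [m2, dd_comm (((h.dd _).dd _).dd _), dd_comm ((h.dd _).dd _) ξ (f j)]
  obtain ⟨id1, id2⟩ := ma_ident h x ξ f d hc hf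
  have hm1 : ∀ i j, dd ξ (dd (f i) (dd (f j) w)) x = A i j := fun i j => by rw [m1]
  have hm2 : ∀ i j, dd ξ (dd ξ (dd (f i) (dd (f j) w))) x = B i j := fun i j => by rw [m2]
  have hm3 : ∀ l, dd ξ (dd ξ (dd ξ (dd (f l) (dd (f l) w)))) x =
    dd (f l) (dd (f l) (dd ξ (dd ξ (dd ξ w)))) x := fun l => by rw [m3]
  simp only [hm1, hm2, hm3] at id1 id2
  have t5 : ∑ l, B l l = ∑ l, ∑ i, A l i * A l i := by
    rw [id1]
    exact Finset.sum_congr rfl fun l _ => Finset.sum_congr rfl fun i _ => by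
      rw [hAs i l]
  have tr3 : ∑ l, ∑ i, (∑ j, A l j * A j i) * A i l = ∑ l, ∑ i, ∑ j, A i j * (A l i * A l j) := by
    refine Finset.sum_congr rfl fun l _ => Finset.sum_congr rfl fun i _ => ?_
    rw [Finset.sum_mul]
    exact Finset.sum_congr rfl fun j _ => by rw [hAs j i, hAs i l]; ring
  have t1 : ∑ l, dd (f l) (dd (f l) (dd ξ (dd ξ (dd ξ w)))) x =
      3 * (∑ l, ∑ i, A l i * B l i) - 2 * ∑ l, ∑ i, ∑ j, A i j * (A l i * A l j) := by
    rw [id2, ← tr3]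
    congr 2
    exact Finset.sum_congr rfl fun l _ => Finset.sum_congr rfl fun i _ => by
      rw [hBs i l]
  have p : ∀ l, Psi2 w x (f l) ξ (∑ j, (-(1/2) * A l j) • f j) =
      4 * dd (f l) (dd (f l) (dd ξ (dd ξ (dd ξ w)))) x - 12 * (∑ i, A l i * B l i)
       + 6 * (∑ i, ∑ j, A i j * (A l i * A l j)) - 6 * s * B l l + 9 * s * ∑ i, A l i * A l i := by
    intro l
    have q1 : dd (f l) (dd (∑ j, (-(1/2) * A l j) • f j) (dd ξ (dd ξ w))) x =
        -(1/2) * ∑ i, A l i * B l i := by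
      rw [dd1_sum ((h.dd ξ).dd ξ), Finset.mul_sum]
      exact Finset.sum_congr rfl fun j _ => by simp only [hB]; ring
    have q2 : dd (∑ j, (-(1/2) * A l j) • f j) (dd (∑ j, (-(1/2) * A l j) • f j) (dd ξ w)) x =
        1/4 * ∑ i, ∑ j, A i j * (A l i * A l j) := by
      rw [hηA]; simp only [Finset.mul_sum]
      exact Finset.sum_congr rfl fun i _ => Finset.sum_congr rfl fun j _ => by ring
    have q3 : dd (f l) (dd ξ (dd ξ w)) x + 2 * dd (∑ j, (-(1/2) * A l j) • f j) (dd ξ w) x = 0 := by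
      rw [hcη, h1, hcf, ← hAc, Finset.mul_sum, ← Finset.sum_add_distrib]
      exact Finset.sum_eq_zero fun i _ => by ring
    have q4 : dd (f l) (dd (∑ j, (-(1/2) * A l j) • f j) (dd ξ w)) x =
        -(1/2) * ∑ i, A l i * A l i := by
      rw [dd1_sum (h.dd ξ), Finset.mul_sum]
      exact Finset.sum_congr rfl fun j _ => by simp only [hA]; ring
    have q5 : dd (∑ j, (-(1/2) * A l j) • f j) (dd (∑ j, (-(1/2) * A l j) • f j) w) x =
        1/4 * ∑ i, A l i * A l i := by
      rw [hηη, Finset.mul_sum]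
      exact Finset.sum_congr rfl fun i _ => by ring
    unfold Psi2
    rw [q1, q2, q3, q4, q5, hs, show dd (f l) (dd (f l) (dd ξ (dd ξ w))) x = B l l from rfl]
    ring
  rw [show (∑ l, Psi2 w x (f l) ξ (∑ j, (-(1/2) * dd (f l) (dd (f j) (dd ξ w)) x) • f j)) =
    ∑ l, Psi2 w x (f l) ξ (∑ j, (-(1/2) * A l j) • f j) from rfl]
  simp only [p, Finset.sum_add_distrib, Finset.sum_sub_distrib, ← Finset.mul_sum, t1, t5]
  ring

/-- criticality in the direction variable -/
lemma crit {n : ℕ} {w : Euc n → ℝ} (h : Sm w) (x ξ : Euc n) 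
    (hm : ∀ ζ, Psi w x ζ ≤ Psi w x ξ) (η : Euc n) :
    dd η (dd ξ (dd ξ w)) x = dd ξ (dd ξ w) x * dd η (dd ξ w) x ∧
    dd η (dd η (dd ξ w)) x ≤ (dd η (dd ξ w) x)^2 + dd ξ (dd ξ w) x / 2 * dd η (dd η w) x := by
  obtain ⟨p, p1, p2, p3⟩ := Psi_line h x 0 ξ η
  have hmax : IsLocalMax (fun t : ℝ => Psi w (x + t • (0 : Euc n)) (ξ + t • η)) 0 := by
    refine Filter.Eventually.of_forall fun t => ?_
    simpa using hm (ξ + t • η)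
  have a := hmax.hasDerivAt_eq_zero (p1 0)
  have b := sdt (Filter.Eventually.of_forall p1) p3 hmax
  have z : ∀ v : Euc n → ℝ, dd 0 v x = 0 := fun v => by simp [dd]
  rw [p2] at a
  simp only [z] at a b
  constructor
  · linarith
  · nlinarith

lemma nd_dd {n : ℕ} {u : Euc n → ℝ} (h : Sm u) (v : Euc n) (k : ℕ) (x : Euc n) :
    nd k (dd v u) x ≤ ‖v‖ * nd (k+1) u x := by
  have e : dd v u = (fun L : Euc n →L[ℝ] ℝ => (ContinuousLinearMap.apply ℝ ℝ v) L) ∘ fderiv ℝ u := by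
    ext y; simp [dd]
  have h1 : iteratedFDeriv ℝ k (dd v u) x = (ContinuousLinearMap.apply ℝ ℝ v).compContinuousMultilinearMap
      (iteratedFDeriv ℝ k (fderiv ℝ u) x) := by
    rw [e]
    exact (ContinuousLinearMap.apply ℝ ℝ v).iteratedFDeriv_comp_left (h.fd.contDiffAt)
      (by exact_mod_cast le_top)
  unfold nd
  rw [h1, ← norm_iteratedFDeriv_fderiv]
  refine (ContinuousLinearMap.norm_compContinuousMultilinearMap_le _ _).trans ?_
  gcongr
  refine ContinuousLinearMap.opNorm_le_bound _ (norm_nonneg _) fun L => ?_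
  rw [ContinuousLinearMap.apply_apply, mul_comm]
  exact L.le_opNorm v

lemma dd3_le {n : ℕ} {u : Euc n → ℝ} (h : Sm u) (a b c x : Euc n) :
    |dd a (dd b (dd c u)) x| ≤ ‖a‖ * (‖b‖ * (‖c‖ * nd 3 u x)) := by
  have h0 : |dd a (dd b (dd c u)) x| = nd 0 (dd a (dd b (dd c u))) x := by
    simp [nd]
  rw [h0]
  refine (nd_dd ((h.dd c).dd b) a 0 x).trans ?_
  gcongr
  refine (nd_dd (h.dd c) b 1 x).trans ?_
  gcongr
  exact nd_dd h c 2 x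

lemma nd_cont {n : ℕ} {u : Euc n → ℝ} (h : Sm u) (k : ℕ) : Continuous (nd k u) := by
  unfold nd
  exact (h.continuous_iteratedFDeriv (m := k) (by exact_mod_cast le_top)).norm

lemma Psi_cont {n : ℕ} {w : Euc n → ℝ} (h : Sm w) :
    Continuous fun p : Euc n × Euc n => Psi w p.1 p.2 := by
  have c2 : ∀ u : Euc n → ℝ, Sm u → Continuous fun p : Euc n × Euc n => dd p.2 (dd p.2 u) p.1 := by
    intro u hu
    simp only [dd_eq hu]
    have : Continuous (fderiv ℝ (fderiv ℝ u)) := (hu.fd.fderiv_right (m := 0) (by simp)).continuous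
    exact ((this.comp continuous_fst).clm_apply continuous_snd).clm_apply continuous_snd
  have e3 : ∀ p : Euc n × Euc n, dd p.2 (dd p.2 (dd p.2 w)) p.1 =
      ∑ i, p.2 i * dd p.2 (dd p.2 (pd i w)) p.1 := by
    rintro ⟨x, ξ⟩
    dsimp only
    have e : dd ξ w = fun x => ∑ i, ξ i * pd i w x := by
      ext x; exact fderiv_eq_sum w x ξ
    rw [e, dd_sum (fun i _ => contDiff_const.mul (h.pd i))]
    simp only [dd_const_mul (h.pd _)]
    rw [dd_sum (fun i _ => contDiff_const.mul ((h.pd i).dd _))]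
    simp only [dd_const_mul ((h.pd _).dd _)]
  unfold Psi
  simp only [e3]
  refine (continuous_const.mul (continuous_finsetSum _ fun i _ => ?_)).sub
    (continuous_const.mul ((c2 w h).pow 2))
  refine Continuous.mul ?_ (c2 _ (h.pd i))
  exact (EuclideanSpace.proj (𝕜 := ℝ) i).continuous.comp continuous_snd

lemma calabi_compact {n : ℕ} {w : Euc n → ℝ} (h : Sm w) (c : Euc n) (ρ κ Q : ℝ)
    (hκ : 0 < κ) (hQ : 0 < Q)
    (hell : ∀ x ∈ Metric.ball c ρ, ∀ v, κ * ‖v‖^2 ≤ dd v (dd v w) x) (m : ℝ) (hm : 0 < m) :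
    IsCompact {p : Euc n × Euc n | p ∈ {p : Euc n × Euc n | p.1 ∈ Metric.closedBall c ρ} ∧
      Q ≤ (Psi w p.1 p.2 - m) * (ρ^2 - ‖p.1 - c‖^2)^4} := by
  obtain ⟨T, hT⟩ := (isCompact_closedBall c ρ).exists_bound_of_continuousOn (nd_cont h 3).continuousOn
  set R := 4 * |T| / (3 * κ^2) with hR
  refine ((isCompact_closedBall c ρ).prod (isCompact_closedBall (0 : Euc n) R)).of_isClosed_subset
    ?_ ?_
  · refine IsClosed.inter ?_ ?_
    · exact Metric.isClosed_closedBall.preimage continuous_fst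
    · refine isClosed_le continuous_const (((Psi_cont h).sub continuous_const).mul ?_)
      fun_prop
  · rintro ⟨x, ξ⟩ ⟨hx, hx2⟩
    simp only [Set.mem_setOf_eq] at hx hx2
    refine ⟨hx, ?_⟩
    rw [mem_closedBall_zero_iff]
    dsimp only
    have hnx : ‖x - c‖ ≤ ρ := by simpa [dist_eq_norm] using hx
    have hxb : x ∈ Metric.ball c ρ := by
      rw [Metric.mem_ball, dist_eq_norm]
      refine lt_of_le_of_ne hnx fun e => ?_
      rw [e] at hx2; simp at hx2; linarith
    have hpos : 0 < Psi w x ξ - m := by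
      by_contra hc
      push Not at hc
      have : 0 ≤ (ρ^2 - ‖x - c‖^2)^4 := by positivity
      nlinarith
    have h1 := hell x hxb ξ
    have h2 := dd3_le h ξ ξ ξ x
    have h3 := hT x hx
    rw [Real.norm_of_nonneg (nd_nonneg _ _ _)] at h3
    have h4 : nd 3 w x ≤ |T| := h3.trans (le_abs_self T)
    have h5 : dd ξ (dd ξ (dd ξ w)) x ≤ ‖ξ‖^3 * |T| := by
      refine (le_abs_self _).trans (h2.trans ?_)
      calc _ = ‖ξ‖^3 * nd 3 w x := by ring
        _ ≤ _ := by gcongr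
    have h6 : (κ * ‖ξ‖^2)^2 ≤ (dd ξ (dd ξ w) x)^2 := by
      have : 0 ≤ κ * ‖ξ‖^2 := by positivity
      gcongr
    unfold Psi at hpos
    have h7 : ‖ξ‖^3 * (3 * κ^2 * ‖ξ‖) ≤ ‖ξ‖^3 * (4 * |T|) := by nlinarith
    rcases (norm_nonneg ξ).eq_or_lt with h0 | h0
    · rw [← h0]; positivity
    · have h8 := le_of_mul_le_mul_left h7 (by positivity)
      rw [hR, le_div_iff₀ (by positivity)]
      linarith

lemma calabi {n : ℕ} (hn : 0 < n) {w : Euc n → ℝ} (h : Sm w) (c : Euc n) (ρ κ d : ℝ) (hρ : 0 < ρ)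
    (hκ : 0 < κ) (hell : ∀ x ∈ Metric.ball c ρ, ∀ v, κ * ‖v‖^2 ≤ dd v (dd v w) x)
    (hd : ∀ x ∈ Metric.ball c ρ, (Hs w x).det = d) (ξ : Euc n) :
    Psi w c ξ ≤ (88 * n * ρ^2 * κ⁻¹)^2 * ((ρ^2)⁻¹)^4 := by
  set q : ℝ := 88 * n * ρ^2 * κ⁻¹ with hq
  have hn' : (0:ℝ) < n := by exact_mod_cast hn
  have hq0 : 0 < q := by positivity
  have hQ0 : 0 < q^2 := by positivity
  by_contra hcon
  push Not at hcon
  obtain ⟨⟨x, ζ⟩, hxD, hs0, hF, hmax⟩ := exists_max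
    {p : Euc n × Euc n | p.1 ∈ Metric.closedBall c ρ} (fun p => Psi w p.1 p.2)
    (fun p => ρ^2 - ‖p.1 - c‖^2) (Psi_cont h) (by fun_prop) (q^2) hQ0 4 (by norm_num)
    (fun p hp => by
      have : ‖p.1 - c‖ ≤ ρ := by simpa [dist_eq_norm] using hp
      have := norm_nonneg (p.1 - c)
      nlinarith)
    (fun m hm => calabi_compact h c ρ κ (q^2) hκ hQ0 hell m hm) (c, ξ)
    (by simpa using hρ.le) (by simpa using by positivity) (by simpa using hcon)
  dsimp only at hs0 hF
  have hb : ∀ y : Euc n, 0 < ρ^2 - ‖y - c‖^2 → y ∈ Metric.ball c ρ := by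
    intro y hy
    rw [Metric.mem_ball, dist_eq_norm]
    exact lt_of_pow_lt_pow_left₀ 2 hρ.le (by linarith)
  have hmax2 : ∀ y η, 0 < ρ^2 - ‖y - c‖^2 →
      Psi w y η - q^2 * ((ρ^2 - ‖y - c‖^2)⁻¹)^4 ≤ Psi w x ζ - q^2 * ((ρ^2 - ‖x - c‖^2)⁻¹)^4 := by
    intro y η hy
    exact hmax (y, η) (Metric.ball_subset_closedBall (hb y hy)) hy
  have hxb := hb x hs0
  have hcr := crit h x ζ (fun η => by have := hmax2 x η hs0; linarith)
  set s := dd ζ (dd ζ w) x with hs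
  set σ := (ρ^2 - ‖x - c‖^2)⁻¹ with hσ
  have hσ0 : 0 < σ := inv_pos.mpr hs0
  have hPs : Psi w x ζ = s^2 := by
    unfold Psi; rw [(hcr ζ).1, ← hs]; ring
  have hs00 : 0 ≤ s := le_trans (by positivity) (hell x hxb ζ)
  obtain ⟨f, hf⟩ := frame h x κ hκ (hell x hxb)
  have hfn : ∀ l, ‖f l‖^2 ≤ κ⁻¹ := fun l => by
    have := hell x hxb (f l)
    rw [hf l l, if_pos rfl] at this
    rw [← one_div, le_div_iff₀ hκ]; linarith
  have hsec := calabi_second h x ζ f d s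
    (Filter.eventually_of_mem (Metric.isOpen_ball.mem_nhds hxb) hd) hf rfl
    (fun η => (hcr η).1) (fun η => (hcr η).2)
  have hl : ∀ l, ∀ e : Euc n, Psi2 w x (f l) ζ e ≤ q^2 * 88 * ρ^2 * κ⁻¹ * σ^6 := by
    intro l e
    obtain ⟨p, p1, -, p3⟩ := Psi_line h x (f l) ζ e
    obtain ⟨b, b2, b1, b3, b4⟩ := barrier (q^2) ρ hQ0.le 4 (x - c) (f l)
      (by simpa [dist_eq_norm] using hxb)
    have hloc : IsLocalMax (fun t : ℝ => Psi w (x + t • f l) (ζ + t • e) -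
        q^2 * ((ρ^2 - ‖x - c + t • f l‖^2)⁻¹)^4) 0 := by
      have ct : ∀ᶠ t in nhds (0:ℝ), 0 < ρ^2 - ‖x - c + t • f l‖^2 := by
        have : Continuous fun t : ℝ => ρ^2 - ‖x - c + t • f l‖^2 := by fun_prop
        refine (this.tendsto 0).eventually (lt_mem_nhds ?_)
        simpa using hs0
      filter_upwards [ct] with t ht
      have e1 : x - c + t • f l = x + t • f l - c := by abel
      rw [e1] at ht ⊢
      have := hmax2 _ (ζ + t • e) ht
      simpa [hσ] using this
    have hh := sdt (f' := fun t => p t - b t) (f2 := Psi2 w x (f l) ζ e - b2)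
      (b1.mono fun t ht => (p1 t).sub ht) (p3.sub b3) hloc
    have h4 : b2 ≤ q^2 * 88 * ρ^2 * κ⁻¹ * σ^6 := by
      refine b4.trans ?_
      have : q^2 * (4 * (4:ℕ) * ((4:ℕ)+1) + 2 * (4:ℕ)) * ρ^2 * ‖f l‖^2 * σ^(4+2)
        = q^2 * 88 * ρ^2 * ‖f l‖^2 * σ^6 := by push_cast; ring
      rw [this]
      have := hfn l
      gcongr
    linarith
  have hsum : s^3 ≤ q^3 * σ^6 := by
    refine hsec.trans ((Finset.sum_le_card_nsmul _ _ _ fun l _ => hl l _).trans (le_of_eq ?_))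
    rw [nsmul_eq_mul, Finset.card_univ, Fintype.card_fin, hq]
    ring
  have hlt : q * σ^2 < s := by
    refine lt_of_pow_lt_pow_left₀ 2 hs00 ?_
    rw [← hPs]
    calc (q * σ^2)^2 = q^2 * σ^4 := by ring
      _ < _ := hF
  have : (q * σ^2)^3 < s^3 := pow_lt_pow_left₀ hlt (by positivity) (by norm_num)
  nlinarith

lemma N_neg {n : ℕ} (w : Euc n → ℝ) (x η : Euc n) :
    dd (-η) (dd (-η) (dd (-η) w)) x = - dd η (dd η (dd η w)) x := by
  have e : ∀ u : Euc n → ℝ, dd (-η) u = -(dd η u) := by intro u; ext y; simp [dd]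
  have e2 : ∀ u : Euc n → ℝ, dd η (-u) = -(dd η u) := by
    intro u; ext y; simp [dd, fderiv_neg]
  rw [e, e, e, e2, e2, e2]; simp

lemma trilin_bd {n : ℕ} {w : Euc n → ℝ} (h : Sm w) (c : Euc n) (B : ℝ)
    (hB : ∀ η : Euc n, ‖η‖ ≤ 3 → dd η (dd η (dd η w)) c ≤ B) (x y z : Euc n)
    (hx : ‖x‖ ≤ 1) (hy : ‖y‖ ≤ 1) (hz : ‖z‖ ≤ 1) : |dd x (dd y (dd z w)) c| ≤ 2 * B := by
  have hB2 : ∀ η : Euc n, ‖η‖ ≤ 3 → |dd η (dd η (dd η w)) c| ≤ B := by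
    intro η hη
    rw [abs_le]
    refine ⟨?_, hB η hη⟩
    have := hB (-η) (by simpa using hη)
    rw [N_neg] at this; linarith
  have h1 : ∀ ξ : Euc n, ‖ξ‖ ≤ 2 → |dd z (dd ξ (dd ξ w)) c| ≤ B := by
    intro ξ hξ
    have q1 := q3_expand h ξ z 1 c
    have q2 := q3_expand h ξ z (-1) c
    have b1 := hB2 (ξ + (1:ℝ) • z) (by
      refine (norm_add_le _ _).trans ?_; simp; linarith)
    have b2 := hB2 (ξ + (-1:ℝ) • z) (by
      refine (norm_add_le _ _).trans ?_; simp; linarith)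
    have b3 := hB2 z (by linarith)
    rw [q1] at b1; rw [q2] at b2
    rw [abs_le] at *
    constructor <;> linarith [b1.1, b1.2, b2.1, b2.2, b3.1, b3.2]
  have hc : ∀ ξ : Euc n, dd z (dd ξ (dd ξ w)) = dd ξ (dd ξ (dd z w)) := by
    intro ξ
    rw [dd_comm (h.dd ξ) z ξ, dd_comm h z ξ]
  have q := q2_expand (h.dd z) y x 1 c
  have b1 := h1 (y + (1:ℝ) • x) (by refine (norm_add_le _ _).trans ?_; simp; linarith)
  have b2 := h1 y (by linarith)
  have b3 := h1 x (by linarith)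
  rw [hc] at b1 b2 b3
  rw [q] at b1
  rw [abs_le] at *
  constructor <;> linarith [b1.1, b1.2, b2.1, b2.2, b3.1, b3.2]

lemma pd_eq_dd {n : ℕ} (i : Fin n) (u : Euc n → ℝ) : pd i u = dd (ee i) u := rfl

lemma nd3_le {n : ℕ} {w : Euc n → ℝ} (h : Sm w) (c : Euc n) (B : ℝ)
    (hB : ∀ η : Euc n, ‖η‖ ≤ 3 → dd η (dd η (dd η w)) c ≤ B) :
    nd 3 w c ≤ (n:ℝ)^3 * (2 * B) := by
  refine (nd_le_sum_pdI h 3 c).trans ?_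
  refine (Finset.sum_le_card_nsmul _ _ (2*B) fun I _ => ?_).trans (le_of_eq ?_)
  · simp only [pdI, pd_eq_dd]
    exact trilin_bd h c B hB _ _ _ (norm_ee _).le (norm_ee _).le (norm_ee _).le
  · simp

/-- interior third derivative bound -/
lemma calabi_nd3 (n : ℕ) (hn : 0 < n) : ∃ N : ℕ, ∀ M : ℝ, 2 ≤ M → ∀ (c : Euc n) (ρ : ℝ), 0 < ρ →
    ρ ≤ 1 → ρ⁻¹ ≤ M → ∀ κ d : ℝ, 0 < κ → κ⁻¹ ≤ M → ∀ w : Euc n → ℝ, Sm w →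
    (∀ x ∈ Metric.ball c ρ, ∀ v, κ * ‖v‖^2 ≤ dd v (dd v w) x) →
    (∀ x ∈ Metric.ball c ρ, ∀ v, dd v (dd v w) x ≤ ‖v‖^2) →
    (∀ x ∈ Metric.ball c ρ, (Hs w x).det = d) → nd 3 w c ≤ M^N := by
  refine ⟨n^3 * 2 * (243 + (88*n)^2) + 10, ?_⟩
  intro M hM c ρ hρ hρ1 hρM κ d hκ hκM w h hl hu hd
  have hM0 : 0 < M := by linarith
  have hcb : c ∈ Metric.ball c ρ := Metric.mem_ball_self hρ
  have hB : ∀ η : Euc n, ‖η‖ ≤ 3 → dd η (dd η (dd η w)) c ≤ (243 + (88*n)^2) * M^10 := by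
    intro η hη
    have h1 := calabi hn h c ρ κ d hρ hκ hl hd η
    unfold Psi at h1
    have h2 := hu c hcb η
    have h3 : 0 ≤ dd η (dd η w) c := le_trans (by positivity) (hl c hcb η)
    have h4 : dd η (dd η w) c ≤ 9 := h2.trans (by nlinarith [norm_nonneg η])
    have h5 : (dd η (dd η w) c)^2 ≤ 81 := by nlinarith
    have h6 : (88 * n * ρ^2 * κ⁻¹)^2 * ((ρ^2)⁻¹)^4 ≤ (88*n)^2 * M^10 := by
      have e1 : (ρ^2)⁻¹ ≤ M^2 := by
        rw [← inv_pow]; exact pow_le_pow_left₀ (by positivity) hρM 2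
      have e2 : ρ^2 ≤ 1 := pow_le_one₀ hρ.le hρ1
      calc (88 * n * ρ^2 * κ⁻¹)^2 * ((ρ^2)⁻¹)^4 ≤ (88 * n * 1 * M)^2 * (M^2)^4 := by gcongr
        _ = _ := by ring
    have h7 : 1 ≤ M^10 := one_le_pow₀ (by linarith)
    have h8 : 0 ≤ (88*(n:ℝ))^2 * M^10 := by positivity
    nlinarith
  refine (nd3_le h c _ hB).trans ?_
  have := absorb hM (n^3 * 2 * (243 + (88*n)^2))
  rw [pow_add]
  calc (n:ℝ)^3 * (2 * ((243 + (88*n)^2) * M^10))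
      = ((n^3 * 2 * (243 + (88*n)^2) : ℕ) : ℝ) * M^10 := by push_cast; ring
    _ ≤ _ := by gcongr

open Matrix in
lemma adj_poly {n : ℕ} (B H : Matrix (Fin n) (Fin n) ℝ) (i j : Fin n) :
    ∃ p : Polynomial ℝ, p.natDegree ≤ n ∧ ∀ t : ℝ, p.eval t = (B + t • H).adjugate i j := by
  refine ⟨det ((Polynomial.X : Polynomial ℝ) • (H.updateRow j 0).map Polynomial.C +
    (B.updateRow j (Pi.single i 1)).map Polynomial.C), ?_, fun t => ?_⟩
  · simpa using Polynomial.natDegree_det_X_add_C_le (H.updateRow j 0) (B.updateRow j (Pi.single i 1))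
  · rw [adjugate_apply, ← Polynomial.coe_evalRingHom, RingHom.map_det]
    congr 1
    ext k l
    by_cases hk : k = j
    · subst hk; simp
    · simp [hk]; ring

lemma quad_rule (n : ℕ) : ∃ ω : Fin (n+1) → ℝ, ∀ p : Polynomial ℝ, p.natDegree ≤ n →
    ∑ k, ω k * p.eval ((k:ℕ):ℝ) = ∫ t in (0:ℝ)..1, p.eval t := by
  set v : Fin (n+1) → ℝ := fun k => ((k:ℕ):ℝ) with hv
  have hinj : Set.InjOn v (Finset.univ : Finset (Fin (n+1))) := by
    intro a _ b _ h
    simp only [hv] at h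
    exact Fin.ext (by exact_mod_cast h)
  refine ⟨fun k => ∫ t in (0:ℝ)..1, (Lagrange.basis Finset.univ v k).eval t, fun p hp => ?_⟩
  have h1 := Lagrange.eq_interpolate (f := p) hinj (by
    refine lt_of_le_of_lt Polynomial.degree_le_natDegree ?_
    simp only [Finset.card_univ, Fintype.card_fin]
    exact_mod_cast Nat.lt_succ_of_le hp)
  have h2 : ∀ t, p.eval t = ∑ k, (Lagrange.basis Finset.univ v k).eval t * p.eval (v k) := by
    intro t
    conv_lhs => rw [h1]
    rw [Lagrange.interpolate_apply, Polynomial.eval_finsetSum]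
    refine Finset.sum_congr rfl fun k _ => ?_
    simp [mul_comm]
  have h3 : (∫ t in (0:ℝ)..1, p.eval t) = ∫ t in (0:ℝ)..1,
      ∑ k, (Lagrange.basis Finset.univ v k).eval t * p.eval (v k) := by
    congr 1; ext t; exact h2 t
  rw [h3, intervalIntegral.integral_finsetSum]
  · refine Finset.sum_congr rfl fun k _ => ?_
    rw [intervalIntegral.integral_mul_const]
  · intro k _
    exact ((Polynomial.continuous _).mul continuous_const).intervalIntegrable _ _

open Matrix in
/-- symmetric with quadratic form between `κ` and `1` -/
structure Pinch {n : ℕ} (κ : ℝ) (A : Matrix (Fin n) (Fin n) ℝ) : Prop where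
  symm : Aᵀ = A
  lo : ∀ ξ : Fin n → ℝ, κ * (ξ ⬝ᵥ ξ) ≤ ξ ⬝ᵥ (A *ᵥ ξ)
  hi : ∀ ξ : Fin n → ℝ, ξ ⬝ᵥ (A *ᵥ ξ) ≤ ξ ⬝ᵥ ξ

namespace Pinch
open Matrix
variable {n : ℕ} {κ : ℝ} {A B : Matrix (Fin n) (Fin n) ℝ}

lemma seg (hA : Pinch κ A) (hB : Pinch κ B) {t : ℝ} (h0 : 0 ≤ t) (h1 : t ≤ 1) :
    Pinch κ (B + t • (A - B)) := by
  have e : ∀ ξ : Fin n → ℝ, ξ ⬝ᵥ ((B + t • (A - B)) *ᵥ ξ) =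
      (1 - t) * (ξ ⬝ᵥ (B *ᵥ ξ)) + t * (ξ ⬝ᵥ (A *ᵥ ξ)) := by
    intro ξ
    rw [add_mulVec, smul_mulVec, sub_mulVec, dotProduct_add, dotProduct_smul, dotProduct_sub]
    simp only [smul_eq_mul]; ring
  refine ⟨?_, fun ξ => ?_, fun ξ => ?_⟩
  · rw [transpose_add, transpose_smul, transpose_sub, hA.symm, hB.symm]
  · rw [e]
    nlinarith [mul_le_mul_of_nonneg_left (hA.lo ξ) h0, mul_le_mul_of_nonneg_left (hB.lo ξ) (sub_nonneg.mpr h1)]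
  · rw [e]
    nlinarith [mul_le_mul_of_nonneg_left (hA.hi ξ) h0, mul_le_mul_of_nonneg_left (hB.hi ξ) (sub_nonneg.mpr h1)]

lemma det_ge (hκ : 0 < κ) (hA : Pinch κ A) : κ^n ≤ A.det := by
  have hH : A.IsHermitian := by
    rw [Matrix.IsHermitian, conjTranspose_eq_transpose_of_trivial]; exact hA.symm
  rw [hH.det_eq_prod_eigenvalues]
  have : ∀ i, κ ≤ hH.eigenvalues i := by
    intro i
    set ξ : Fin n → ℝ := (hH.eigenvectorBasis i).ofLp with hξ
    have h1 := hH.mulVec_eigenvectorBasis i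
    have h2 := hA.lo ξ
    have h3 : ξ ⬝ᵥ ξ = 1 := by
      have := hH.eigenvectorBasis.orthonormal.1 i
      rw [EuclideanSpace.norm_eq, Real.sqrt_eq_one] at this
      rw [dotProduct, ← this]
      refine Finset.sum_congr rfl fun k _ => ?_
      simp [hξ, sq]
    rw [hξ] at h2 h3
    rw [h1, dotProduct_smul, h3] at h2
    simpa using h2
  calc κ^n = ∏ _i : Fin n, κ := by simp
    _ ≤ _ := Finset.prod_le_prod (fun _ _ => hκ.le) fun i _ => by simpa using this i

lemma adj_ge (hκ : 0 < κ) (hA : Pinch κ A) (ξ : Fin n → ℝ) :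
    κ^n * (ξ ⬝ᵥ ξ) ≤ ξ ⬝ᵥ (A.adjugate *ᵥ ξ) := by
  have hd := hA.det_ge hκ
  have hd0 : 0 < A.det := lt_of_lt_of_le (by positivity) hd
  have hu : IsUnit A.det := isUnit_iff_ne_zero.mpr hd0.ne'
  set η := A⁻¹ *ᵥ ξ with hη
  have e1 : A *ᵥ η = ξ := by rw [hη, mulVec_mulVec, mul_nonsing_inv _ hu, one_mulVec]
  have e2 : A.adjugate *ᵥ ξ = A.det • η := by
    rw [hη, ← smul_mulVec]
    congr 1
    rw [inv_def, smul_smul, Ring.inverse_eq_inv', mul_inv_cancel₀ hd0.ne', one_smul]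
  have e3 : ξ ⬝ᵥ ξ ≤ ξ ⬝ᵥ η := by
    have h1 := hA.lo (η - ξ)
    have h2 := hA.hi ξ
    have h0 : 0 ≤ (η - ξ) ⬝ᵥ (η - ξ) := Finset.sum_nonneg fun i _ => mul_self_nonneg _
    have h3 : (η - ξ) ⬝ᵥ (A *ᵥ (η - ξ)) = ξ ⬝ᵥ η - 2 * (ξ ⬝ᵥ ξ) + ξ ⬝ᵥ (A *ᵥ ξ) := by
      rw [mulVec_sub, e1, dotProduct_sub, sub_dotProduct, sub_dotProduct]
      have : η ⬝ᵥ (A *ᵥ ξ) = ξ ⬝ᵥ ξ := by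
        rw [dotProduct_mulVec, ← mulVec_transpose, hA.symm, e1]
      rw [this, dotProduct_comm η ξ]; ring
    rw [h3] at h1
    nlinarith [mul_nonneg hκ.le h0]
  rw [e2, dotProduct_smul, smul_eq_mul]
  have h0 : 0 ≤ ξ ⬝ᵥ ξ := Finset.sum_nonneg fun i _ => mul_self_nonneg _
  calc κ^n * (ξ ⬝ᵥ ξ) ≤ A.det * (ξ ⬝ᵥ ξ) := by gcongr
    _ ≤ _ := by gcongr

end Pinch

abbrev YI (n : ℕ) := Bool × Fin n × Fin n

def matT {n : ℕ} (b : Bool) (y : YI n → ℝ) : Matrix (Fin n) (Fin n) ℝ := Matrix.of fun p q => y (b, p, q)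

def quadW (n : ℕ) : Fin (n+1) → ℝ := (quad_rule n).choose

/-- averaged cofactor matrix -/
def AA {n : ℕ} (i j : Fin n) (y : YI n → ℝ) : ℝ :=
  ∑ k : Fin (n+1), quadW n k *
    (matT false y + ((k:ℕ):ℝ) • (matT true y - matT false y)).adjugate i j

lemma AA_diff {n : ℕ} (i j : Fin n) : ContDiff ℝ (⊤ : ℕ∞) (AA i j : (YI n → ℝ) → ℝ) := by
  unfold AA
  refine ContDiff.sum fun k _ => contDiff_const.mul ?_
  simp only [Matrix.adjugate_apply, Matrix.det_apply']
  refine ContDiff.sum fun σ _ => contDiff_const.mul ?_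
  refine contDiff_prod fun l _ => ?_
  by_cases h : σ l = j
  · simp only [h, Matrix.updateRow_self]; exact contDiff_const
  · simp only [Matrix.updateRow_ne h, matT, Matrix.add_apply, Matrix.smul_apply, Matrix.sub_apply,
      Matrix.of_apply, smul_eq_mul]
    fun_prop

lemma AA_int {n : ℕ} (i j : Fin n) (y : YI n → ℝ) :
    AA i j y = ∫ t in (0:ℝ)..1, (matT false y + t • (matT true y - matT false y)).adjugate i j := by
  obtain ⟨p, hp, he⟩ := adj_poly (matT false y) (matT true y - matT false y) i j
  simp_rw [← he]
  rw [← (quad_rule n).choose_spec p hp]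
  unfold AA quadW
  refine Finset.sum_congr rfl fun k _ => ?_
  rw [he]

lemma adj_cont {n : ℕ} (B H : Matrix (Fin n) (Fin n) ℝ) (i j : Fin n) :
    Continuous fun t : ℝ => (B + t • H).adjugate i j := by
  obtain ⟨p, -, he⟩ := adj_poly B H i j
  simp_rw [← he]
  exact p.continuous

lemma AA_symm {n : ℕ} {κ : ℝ} (y : YI n → ℝ) (hA : Pinch κ (matT true y)) (hB : Pinch κ (matT false y))
    (i j : Fin n) : AA i j y = AA j i y := by
  unfold AA
  refine Finset.sum_congr rfl fun k _ => ?_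
  congr 1
  rw [← Matrix.transpose_apply (Matrix.adjugate _), Matrix.adjugate_transpose]
  rw [Matrix.transpose_add, Matrix.transpose_smul, Matrix.transpose_sub, hA.symm, hB.symm]

lemma AA_sum {n : ℕ} (y : YI n → ℝ) (c : Fin n → Fin n → ℝ) :
    ∑ i, ∑ j, AA i j y * c i j = ∫ t in (0:ℝ)..1, ∑ i, ∑ j,
      (matT false y + t • (matT true y - matT false y)).adjugate i j * c i j := by
  have hc := fun i j => (adj_cont (matT false y) (matT true y - matT false y) i j).mul
    (continuous_const (y := c i j))
  rw [intervalIntegral.integral_finsetSum]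
  · refine Finset.sum_congr rfl fun i _ => ?_
    rw [intervalIntegral.integral_finsetSum]
    · refine Finset.sum_congr rfl fun j _ => ?_
      rw [intervalIntegral.integral_mul_const, AA_int]
    · exact fun j _ => (hc i j).intervalIntegrable _ _
  · exact fun i _ => (continuous_finsetSum _ fun j _ => hc i j).intervalIntegrable _ _

lemma AA_ell {n : ℕ} {κ : ℝ} (hκ : 0 < κ) (y : YI n → ℝ) (hA : Pinch κ (matT true y))
    (hB : Pinch κ (matT false y)) (ξ : Fin n → ℝ) :
    κ^n * ∑ i, ξ i * ξ i ≤ ∑ i, ∑ j, AA i j y * (ξ i * ξ j) := by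
  rw [AA_sum y fun i j => ξ i * ξ j]
  have h1 : κ^n * ∑ i, ξ i * ξ i = ∫ _t in (0:ℝ)..1, κ^n * ∑ i, ξ i * ξ i := by simp
  rw [h1]
  refine intervalIntegral.integral_mono_on zero_le_one intervalIntegrable_const ?_ ?_
  · refine Continuous.intervalIntegrable ?_ _ _
    refine continuous_finsetSum _ fun i _ => continuous_finsetSum _ fun j _ => ?_
    exact (adj_cont _ _ i j).mul continuous_const
  · intro t ht
    have := (hA.seg hB ht.1 ht.2).adj_ge hκ ξ
    refine this.trans (le_of_eq ?_)
    simp only [dotProduct, Matrix.mulVec, Finset.mul_sum]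
    refine Finset.sum_congr rfl fun i _ => Finset.sum_congr rfl fun j _ => by ring

lemma AA_self {n : ℕ} (y : YI n → ℝ) (h : matT true y = matT false y) (i j : Fin n) :
    AA i j y = (matT true y).adjugate i j := by
  rw [AA_int]; simp [h]

section MatCalc3
open scoped Matrix.Norms.Operator
lemma AA_diffdet {n : ℕ} {κ : ℝ} (hκ : 0 < κ) (y : YI n → ℝ) (hA : Pinch κ (matT true y))
    (hB : Pinch κ (matT false y)) :
    ∑ i, ∑ j, AA i j y * (y (true, i, j) - y (false, i, j)) = (matT true y).det - (matT false y).det := by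
  rw [AA_sum y fun i j => y (true, i, j) - y (false, i, j)]
  set H := matT true y - matT false y with hH
  have hs : H.transpose = H := by rw [hH, Matrix.transpose_sub, hA.symm, hB.symm]
  have hder : ∀ t ∈ Set.uIcc (0:ℝ) 1, HasDerivAt (fun t : ℝ => (matT false y + t • H).det)
      (∑ i, ∑ j, (matT false y + t • H).adjugate i j * (y (true, i, j) - y (false, i, j))) t := by
    intro t ht
    rw [Set.uIcc_of_le zero_le_one] at ht
    have hd : 0 < (matT false y + t • H).det :=
      lt_of_lt_of_le (by positivity) ((hA.seg hB ht.1 ht.2).det_ge hκ)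
    have hg : HasDerivAt (fun t : ℝ => matT false y + t • H) H t := by
      have := ((hasDerivAt_id t).smul_const H).const_add (matT false y)
      exact this.congr_deriv (one_smul ℝ H)
    refine (jac hg hd.ne').congr_deriv ?_
    have e : (matT false y + t • H).det • (matT false y + t • H)⁻¹ = (matT false y + t • H).adjugate := by
      rw [Matrix.inv_def, smul_smul, Ring.inverse_eq_inv', mul_inv_cancel₀ hd.ne', one_smul]
    rw [← smul_eq_mul, ← Matrix.trace_smul, ← Matrix.smul_mul, e]
    simp only [Matrix.trace, Matrix.diag, Matrix.mul_apply]
    refine Finset.sum_congr rfl fun i _ => Finset.sum_congr rfl fun j _ => ?_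
    congr 1
    conv_lhs => rw [← hs]
    simp [hH, matT]
  rw [intervalIntegral.integral_eq_sub_of_hasDerivAt hder]
  · simp [hH]
  · refine Continuous.intervalIntegrable ?_ _ _
    refine continuous_finsetSum _ fun i _ => continuous_finsetSum _ fun j _ => ?_
    exact (adj_cont _ _ i j).mul continuous_const
end MatCalc3

lemma pi_norm_iter {n : ℕ} {ι : Type*} [Fintype ι] {f : ι → Euc n → ℝ} (hf : ∀ i, Sm (f i))
    (k : ℕ) (x : Euc n) (B : ℝ) (hB : 0 ≤ B) (h : ∀ i, nd k (f i) x ≤ B) :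
    ‖iteratedFDeriv ℝ k (fun y => fun i => f i y) x‖ ≤ B := by
  have hF : ContDiff ℝ (⊤ : ℕ∞) (fun y => fun i => f i y) := contDiff_pi.2 hf
  refine ContinuousMultilinearMap.opNorm_le_bound hB fun m => ?_
  refine (pi_norm_le_iff_of_nonneg (by positivity)).2 fun i => ?_
  have h1 := (ContinuousLinearMap.proj (R := ℝ) (φ := fun _ : ι => ℝ) i).iteratedFDeriv_comp_left
    (hF.contDiffAt (x := x)) (i := k) (by exact_mod_cast le_top)
  have h2 : iteratedFDeriv ℝ k (f i) x m = (iteratedFDeriv ℝ k (fun y => fun i => f i y) x m) i := by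
    have h3 : (f i) = (ContinuousLinearMap.proj (R := ℝ) (φ := fun _ : ι => ℝ) i) ∘
      (fun y => fun i => f i y) := rfl
    conv_lhs => rw [h3, h1]
    rfl
  rw [← h2]
  refine (ContinuousMultilinearMap.le_opNorm _ _).trans ?_
  have := h i
  unfold nd at this
  gcongr

lemma comp_bound {n : ℕ} {ι : Type*} [Fintype ι] {g : (ι → ℝ) → ℝ} (hg : ContDiff ℝ (⊤ : ℕ∞) g) :
    ∃ Cs : ℕ → ℕ, ∀ f : ι → Euc n → ℝ, (∀ i, Sm (f i)) → ∀ x, (∀ i, |f i x| ≤ 1) → ∀ (s : ℕ) (D : ℝ),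
      0 ≤ D → (∀ k, 1 ≤ k → k ≤ s → ∀ i, nd k (f i) x ≤ D^k) →
      nd s (fun y => g fun i => f i y) x ≤ Cs s * D^s := by
  have h1 : ∀ k : ℕ, ∃ C : ℕ, ∀ y ∈ Metric.closedBall (0 : ι → ℝ) 1, ‖iteratedFDeriv ℝ k g y‖ ≤ C := by
    intro k
    obtain ⟨C, hC⟩ := (isCompact_closedBall (0 : ι → ℝ) 1).exists_bound_of_continuousOn
      (hg.continuous_iteratedFDeriv (m := k) (by exact_mod_cast le_top)).continuousOn
    obtain ⟨C', hC'⟩ := exists_nat_ge C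
    exact ⟨C', fun y hy => (hC y hy).trans hC'⟩
  choose C hC using h1
  refine ⟨fun s => s.factorial * ∑ k ∈ Finset.range (s+1), C k, ?_⟩
  intro f hf x hx s D hD hk
  have hF : ContDiff ℝ (⊤ : ℕ∞) (fun y => fun i => f i y) := contDiff_pi.2 hf
  have := norm_iteratedFDeriv_comp_le (g := g) (f := fun y => fun i => f i y) (n := s) hg hF
    (by exact_mod_cast le_top) x (C := ((∑ k ∈ Finset.range (s+1), C k : ℕ) : ℝ)) (D := D)
    (fun k hks => by
      refine (hC k _ ?_).trans ?_
      · rw [mem_closedBall_zero_iff]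
        exact (pi_norm_le_iff_of_nonneg zero_le_one).2 fun i => hx i
      · exact_mod_cast Finset.single_le_sum (f := C) (fun _ _ => Nat.zero_le _)
          (Finset.mem_range.2 (Nat.lt_succ_of_le hks)))
    (fun k k1 k2 => pi_norm_iter hf k x _ (by positivity) (hk k k1 k2))
  refine this.trans (le_of_eq ?_)
  push_cast; ring

structure Good {n : ℕ} (κ d : ℝ) (w : Euc n → ℝ) (S : Set (Euc n)) : Prop where
  sm : Sm w
  lo : ∀ x ∈ S, ∀ v, κ * ‖v‖^2 ≤ dd v (dd v w) x
  hi : ∀ x ∈ S, ∀ v, dd v (dd v w) x ≤ ‖v‖^2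
  det : ∀ x ∈ S, (Hs w x).det = d

namespace Good
open Matrix
variable {n : ℕ} {κ d : ℝ} {w w' : Euc n → ℝ} {S : Set (Euc n)}

lemma mono (h : Good κ d w S) {S' : Set (Euc n)} (hS : S' ⊆ S) : Good κ d w S' :=
  ⟨h.sm, fun x hx => h.lo x (hS hx), fun x hx => h.hi x (hS hx), fun x hx => h.det x (hS hx)⟩

lemma pinch (h : Good κ d w S) {x : Euc n} (hx : x ∈ S) : Pinch κ (Hs w x) := by
  have e : ∀ ξ : Fin n → ℝ, dd (WithLp.toLp 2 ξ) (dd (WithLp.toLp 2 ξ) w) x = ξ ⬝ᵥ (Hs w x *ᵥ ξ) := by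
    intro ξ
    rw [dd_eq h.sm, fderiv2_eq_sum h.sm]
    simp only [dotProduct, Matrix.mulVec, Finset.mul_sum, Hs, Matrix.of_apply]
    exact Finset.sum_congr rfl fun i _ => Finset.sum_congr rfl fun j _ => by ring
  have e2 : ∀ ξ : Fin n → ℝ, ‖(WithLp.toLp 2 ξ : Euc n)‖^2 = ξ ⬝ᵥ ξ := by
    intro ξ
    rw [EuclideanSpace.norm_sq_eq, dotProduct]
    exact Finset.sum_congr rfl fun i _ => by simp [sq]
  refine ⟨?_, fun ξ => ?_, fun ξ => ?_⟩
  · ext i j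
    simp only [Hs, Matrix.transpose_apply, Matrix.of_apply]
    rw [pd_comm h.sm]
  · rw [← e, ← e2]; exact h.lo x hx _
  · rw [← e, ← e2]; exact h.hi x hx _

lemma entry (hκ : 0 < κ) (h : Good κ d w S) {x : Euc n} (hx : x ∈ S) (i j : Fin n) :
    |pd i (pd j w) x| ≤ 1 := by
  have q1 := q2_expand h.sm (ee j) (ee i) 1 x
  have q2 := q2_expand h.sm (ee j) (ee i) (-1) x
  have b1 := h.hi x hx (ee j + (1:ℝ) • ee i)
  have b2 := h.hi x hx (ee j + (-1:ℝ) • ee i)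
  have a1 := (by positivity : 0 ≤ κ * ‖ee j + (1:ℝ) • ee i‖^2).trans (h.lo x hx _)
  have a2 := (by positivity : 0 ≤ κ * ‖ee j + (-1:ℝ) • ee i‖^2).trans (h.lo x hx _)
  have n1 : ‖ee j + (1:ℝ) • ee i‖^2 ≤ 4 := by
    have : ‖ee j + (1:ℝ) • ee i‖ ≤ 2 := by
      refine (norm_add_le _ _).trans ?_
      rw [norm_smul, norm_ee, norm_ee]; norm_num
    nlinarith [norm_nonneg (ee j + (1:ℝ) • ee i)]
  have n2 : ‖ee j + (-1:ℝ) • ee i‖^2 ≤ 4 := by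
    have : ‖ee j + (-1:ℝ) • ee i‖ ≤ 2 := by
      refine (norm_add_le _ _).trans ?_
      rw [norm_smul, norm_ee, norm_ee]; norm_num
    nlinarith [norm_nonneg (ee j + (-1:ℝ) • ee i)]
  simp only [pd_eq_dd]
  rw [abs_le]
  constructor <;> nlinarith

end Good

def yv {n : ℕ} (w w' : Euc n → ℝ) (x : Euc n) : YI n → ℝ :=
  fun p => pd p.2.1 (pd p.2.2 (if p.1 then w else w')) x

def aw {n : ℕ} (w w' : Euc n → ℝ) (i j : Fin n) : Euc n → ℝ := fun x => AA i j (yv w w' x)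

lemma matT_t {n : ℕ} (w w' : Euc n → ℝ) (x : Euc n) : matT true (yv w w' x) = Hs w x := by
  ext i j; simp [matT, yv, Hs]
lemma matT_f {n : ℕ} (w w' : Euc n → ℝ) (x : Euc n) : matT false (yv w w' x) = Hs w' x := by
  ext i j; simp [matT, yv, Hs]

lemma aw_sm {n : ℕ} {w w' : Euc n → ℝ} (h : Sm w) (h' : Sm w') (i j : Fin n) : Sm (aw w w' i j) := by
  refine (AA_diff i j).comp (contDiff_pi.2 fun p => ?_)
  rcases p with ⟨b, p, q⟩
  cases b
  · exact (h'.pd q).pd p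
  · exact (h.pd q).pd p

/-- bounds of coefficient derivatives -/
lemma aw_bound (n : ℕ) : ∃ Cs : ℕ → ℕ, ∀ (w w' : Euc n → ℝ) (κ d : ℝ) (S : Set (Euc n)), 0 < κ →
    Good κ d w S → Good κ d w' S → ∀ x ∈ S, ∀ (s : ℕ) (D : ℝ), 0 ≤ D →
    (∀ i, 1 ≤ i → i ≤ s → nd (i+2) w x ≤ D^i ∧ nd (i+2) w' x ≤ D^i) →
    alp (aw w w') s x ≤ Cs s * D^s := by
  have := fun i j : Fin n => comp_bound (n := n) (AA_diff i j)
  choose C hC using this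
  refine ⟨fun s => ∑ i, ∑ j, C i j s, ?_⟩
  intro w w' κ d S hκ h h' x hx s D hD hk
  unfold alp
  push_cast
  rw [Finset.sum_mul]
  refine Finset.sum_le_sum fun i _ => ?_
  rw [Finset.sum_mul]
  refine Finset.sum_le_sum fun j _ => ?_
  refine hC i j (fun p x => yv w w' x p) ?_ x ?_ s D hD ?_
  · rintro ⟨b, p, q⟩
    cases b
    · exact (h'.sm.pd q).pd p
    · exact (h.sm.pd q).pd p
  · rintro ⟨b, p, q⟩
    cases b
    · exact h'.entry hκ hx p q
    · exact h.entry hκ hx p q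
  · rintro k k1 k2 ⟨b, p, q⟩
    cases b
    · exact ((nd_pd (h'.sm.pd q) k p x).trans (nd_pd h'.sm (k+1) q x)).trans (hk k k1 k2).2
    · exact ((nd_pd (h.sm.pd q) k p x).trans (nd_pd h.sm (k+1) q x)).trans (hk k k1 k2).1

lemma abs_le_alp {n : ℕ} (a : Fin n → Fin n → Euc n → ℝ) (i j : Fin n) (x : Euc n) :
    |a i j x| ≤ alp a 0 x := by
  have e : |a i j x| = nd 0 (a i j) x := by rw [nd_zero]
  rw [e]
  unfold alp
  refine le_trans ?_ (Finset.single_le_sum (f := fun i => ∑ j, nd 0 (a i j) x)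
    (fun _ _ => Finset.sum_nonneg fun _ _ => nd_nonneg _ _ _) (Finset.mem_univ i))
  exact Finset.single_le_sum (f := fun j => nd 0 (a i j) x) (fun _ _ => nd_nonneg _ _ _) (Finset.mem_univ j)

lemma aw_ell (n : ℕ) : ∃ N : ℕ, ∀ M : ℝ, 2 ≤ M → ∀ (w w' : Euc n → ℝ) (κ d : ℝ) (S : Set (Euc n)), 0 < κ →
    κ⁻¹ ≤ M → Good κ d w S → Good κ d w' S → Ell (aw w w') S (M^N) := by
  obtain ⟨Cs, hCs⟩ := aw_bound n
  refine ⟨n + Cs 0, fun M hM w w' κ d S hκ hκM h h' => ?_⟩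
  have hM1 : 1 ≤ M := by linarith
  refine ⟨fun x hx i j => ?_, fun x hx ξ => ?_, fun x hx i j => ?_⟩
  · exact AA_symm _ (by rw [matT_t]; exact h.pinch hx) (by rw [matT_f]; exact h'.pinch hx) i j
  · refine le_trans ?_ (AA_ell hκ (yv w w' x) (by rw [matT_t]; exact h.pinch hx)
      (by rw [matT_f]; exact h'.pinch hx) ξ)
    refine mul_le_mul_of_nonneg_right ?_ (Finset.sum_nonneg fun i _ => mul_self_nonneg _)
    have : (κ^n)⁻¹ ≤ M^(n + Cs 0) := by
      rw [← inv_pow]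
      exact (pow_le_pow_left₀ (by positivity) hκM n).trans (pow_le_pow_right₀ hM1 (by omega))
    exact inv_le_of_inv_le₀ (by positivity) this
  · refine (abs_le_alp _ i j x).trans ?_
    have := hCs w w' κ d S hκ h h' x hx 0 1 zero_le_one (fun i h1 h2 => by omega)
    refine this.trans ?_
    rw [one_pow, mul_one]
    exact (absorb hM _).trans (pow_le_pow_right₀ hM1 (by omega))

lemma aw_diff_eq {n : ℕ} {w w' : Euc n → ℝ} {κ d : ℝ} {S : Set (Euc n)} (hκ : 0 < κ)
    (h : Good κ d w S) (h' : Good κ d w' S) {x : Euc n} (hx : x ∈ S) :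
    Lop (aw w w') (fun y => w y - w' y) x = 0 := by
  have := AA_diffdet hκ (yv w w' x) (by rw [matT_t]; exact h.pinch hx)
      (by rw [matT_f]; exact h'.pinch hx)
  rw [matT_t, matT_f, h.det x hx, h'.det x hx, sub_self] at this
  rw [← this]
  unfold Lop aw
  refine Finset.sum_congr rfl fun i _ => Finset.sum_congr rfl fun j _ => ?_
  congr 1
  rw [pd_sub h.sm h'.sm, pd_sub (h.sm.pd j) (h'.sm.pd j)]
  simp [yv]

section MatCalc4
open scoped Matrix.Norms.Operator
lemma aw_pd_eq {n : ℕ} {w : Euc n → ℝ} {κ d : ℝ} {S : Set (Euc n)} (hS : IsOpen S) (hκ : 0 < κ)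
    (h : Good κ d w S) (p : Fin n) {x : Euc n} (hx : x ∈ S) :
    Lop (aw w w) (pd p w) x = 0 := by
  have hd0 : 0 < d := by
    rw [← h.det x hx]; exact lt_of_lt_of_le (by positivity) ((h.pinch hx).det_ge hκ)
  have hg : HasDerivAt (fun t : ℝ => Hs w (x + t • ee p)) (Matrix.of fun i j => pd p (pd i (pd j w)) x) 0 := by
    refine mat_deriv fun i j => ?_
    have := line ((h.sm.pd j).pd i) x (ee p) 0
    simpa [Hs, pd_eq_dd] using this
  have hev : ∀ᶠ s in nhds (0:ℝ), (Hs w (x + s • ee p)).det = d := by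
    have hc : Continuous fun s : ℝ => x + s • ee p := by fun_prop
    have := hc.tendsto 0 |>.eventually (hS.mem_nhds (by simpa using hx))
    exact this.mono fun s hs => h.det _ hs
  have := det_const1 hg hd0.ne' hev
  have e0 : Hs w (x + (0:ℝ) • ee p) = Hs w x := by simp
  rw [e0] at this
  have e : Lop (aw w w) (pd p w) x = d * ((Hs w x)⁻¹ * Matrix.of fun i j => pd p (pd i (pd j w)) x).trace := by
    have e1 : d • (Hs w x)⁻¹ = (Hs w x).adjugate := by
      rw [Matrix.inv_def, h.det x hx, smul_smul, Ring.inverse_eq_inv', mul_inv_cancel₀ hd0.ne', one_smul]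
    rw [← smul_eq_mul, ← Matrix.trace_smul, ← Matrix.smul_mul, e1]
    simp only [Matrix.trace, Matrix.diag, Matrix.mul_apply, Lop, aw, Matrix.of_apply]
    refine Finset.sum_congr rfl fun i _ => Finset.sum_congr rfl fun j _ => ?_
    rw [AA_self _ (by rw [matT_t, matT_f]), matT_t]
    congr 1
    rw [pd_comm h.sm j p, pd_comm (h.sm.pd j) i p, pd_comm h.sm i j]
  rw [e, this, mul_zero]
end MatCalc4

lemma two_le_pow {M : ℝ} (hM : 2 ≤ M) {k : ℕ} (hk : 1 ≤ k) : 2 ≤ M^k := hM.trans (self_le_pow hM hk)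

lemma w_bounds (n : ℕ) (hn : 0 < n) (m : ℕ) : ∃ N : ℕ, ∀ M : ℝ, 2 ≤ M → ∀ (c : Euc n) (ρ : ℝ), 0 < ρ →
    ρ ≤ 1 → ρ⁻¹ ≤ M → ∀ κ d : ℝ, 0 < κ → κ⁻¹ ≤ M → ∀ w : Euc n → ℝ,
    Good κ d w (Metric.ball c ρ) → ∀ k, 3 ≤ k → k ≤ m + 3 → nd k w c ≤ M^N := by
  obtain ⟨N3, h3⟩ := calabi_nd3 n hn
  obtain ⟨NE, hE⟩ := aw_ell n
  obtain ⟨Cs, hCs⟩ := aw_bound n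
  obtain ⟨NT, hT⟩ := Tw (n := n) Cs m
  refine ⟨(2 * N3 + NE + 2) * NT, ?_⟩
  intro M hM c ρ hρ hρ1 hρM κ d hκ hκM w hw k hk1 hk2
  have hM1 : 1 ≤ M := by linarith
  have hsub := half_ball_sub c hρ
  rw [pow_mul]
  refine hT (M^(2 * N3 + NE + 2)) (two_le_pow hM (by omega)) c (ρ/2) (by positivity) (by linarith)
    ((half_inv hM hρM).trans (pow_le_pow_right₀ hM1 (by omega))) (aw w w)
    (fun i j => aw_sm hw.sm hw.sm i j) ?_ w hw.sm ?_ ?_ ?_ k hk1 hk2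
  · exact (hE M hM w w κ d _ hκ hκM hw hw).mono hsub (by positivity) (pow_le_pow_right₀ hM1 (by omega))
  · intro s hs x hx D hD hi
    exact hCs w w κ d _ hκ hw hw x (hsub hx) s D (by linarith) fun i h1 h2 => ⟨hi i h1 h2, hi i h1 h2⟩
  · intro x hx p
    exact aw_pd_eq Metric.isOpen_ball hκ hw p (hsub hx)
  · intro x hx
    have hw2 := hw.mono (half_ball hx)
    have := h3 (M^2) (two_le_pow hM (by omega)) x (ρ/2) (by positivity) (by linarith)
      (half_inv hM hρM) κ d hκ (hκM.trans (self_le_pow hM (by omega))) w hw.sm hw2.lo hw2.hi hw2.det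
    refine this.trans ?_
    rw [← pow_mul]
    exact pow_le_pow_right₀ hM1 (by omega)

lemma core (n : ℕ) (hn : 0 < n) (m : ℕ) : ∃ N : ℕ, ∀ M : ℝ, 2 ≤ M → ∀ (c : Euc n) (ρ : ℝ), 0 < ρ →
    ρ ≤ 1 → ρ⁻¹ ≤ M → ∀ κ d : ℝ, 0 < κ → κ⁻¹ ≤ M → ∀ w w' : Euc n → ℝ,
    Good κ d w (Metric.ball c ρ) → Good κ d w' (Metric.ball c ρ) → ∀ v : Euc n → ℝ, Sm v →
    (∀ x ∈ Metric.ball c ρ, Lop (aw w w') v x = 0) → (∀ x ∈ Metric.ball c ρ, |v x| ≤ M) →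
    ∀ k ≤ m, nd k v c ≤ M^N := by
  obtain ⟨NE, hE⟩ := aw_ell n
  obtain ⟨Cs, hCs⟩ := aw_bound n
  obtain ⟨NW, hW⟩ := w_bounds n hn m
  obtain ⟨NT, hT⟩ := Tv (n := n) m
  set W := ∑ s ∈ Finset.range (m+1), Cs s with hWdef
  refine ⟨(W + 2 * NW * m + NE + 2) * NT, ?_⟩
  intro M hM c ρ hρ hρ1 hρM κ d hκ hκM w w' hw hw' v hv hL hb k hk
  have hM1 : 1 ≤ M := by linarith
  have hsub := half_ball_sub c hρ
  rw [pow_mul]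
  refine hT (M^(W + 2 * NW * m + NE + 2)) (two_le_pow hM (by omega)) c (ρ/2) (by positivity) (by linarith)
    ((half_inv hM hρM).trans (pow_le_pow_right₀ hM1 (by omega))) (aw w w')
    (fun i j => aw_sm hw.sm hw'.sm i j) ?_ ?_ v hv (fun x hx => hL x (hsub hx)) ?_ k hk
  · exact (hE M hM w w' κ d _ hκ hκM hw hw').mono hsub (by positivity) (pow_le_pow_right₀ hM1 (by omega))
  · intro x hx s hs1 hs2
    have b : ∀ u : Euc n → ℝ, Good κ d u (Metric.ball c ρ) → ∀ i, 1 ≤ i → i ≤ s →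
        nd (i+2) u x ≤ (M^(2*NW))^i := by
      intro u hu i h1 h2
      have := hW (M^2) (two_le_pow hM (by omega)) x (ρ/2) (by positivity) (by linarith)
        (half_inv hM hρM) κ d hκ (hκM.trans (self_le_pow hM (by omega))) u (hu.mono (half_ball hx))
        (i+2) (by omega) (by omega)
      refine this.trans ?_
      rw [← pow_mul]
      exact le_self_pow₀ (one_le_pow₀ hM1) (by omega)
    have := hCs w w' κ d _ hκ hw hw' x (hsub hx) s (M^(2*NW)) (by positivity)
      fun i h1 h2 => ⟨b w hw i h1 h2, b w' hw' i h1 h2⟩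
    refine this.trans ?_
    have c1 : (Cs s : ℝ) ≤ M^W := by
      refine le_trans ?_ (absorb hM W)
      exact_mod_cast Finset.single_le_sum (f := Cs) (fun _ _ => Nat.zero_le _)
          (Finset.mem_range.2 (Nat.lt_succ_of_le hs2))
    have c2 : (M^(2*NW))^s ≤ M^(2*NW*m) := by
      rw [← pow_mul]
      exact pow_le_pow_right₀ hM1 (Nat.mul_le_mul_left _ hs2)
    calc (Cs s : ℝ) * (M^(2*NW))^s ≤ M^W * M^(2*NW*m) := by gcongr
      _ = M^(W + 2*NW*m) := (pow_add _ _ _).symm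
      _ ≤ _ := pow_le_pow_right₀ hM1 (by omega)
  · intro x hx
    exact (hb x (hsub hx)).trans (self_le_pow hM (by omega))

lemma nd_const_mul {n : ℕ} {u : Euc n → ℝ} (h : Sm u) (c : ℝ) (k : ℕ) (x : Euc n) :
    nd k (fun y => c * u y) x = |c| * nd k u x := by
  unfold nd
  have := iteratedFDeriv_const_smul_apply' (𝕜 := ℝ) (a := c) (i := k)
    ((h.of_le (by exact_mod_cast le_top)).contDiffAt (x := x) (f := u))
  simp only [smul_eq_mul] at this
  rw [this, norm_smul, Real.norm_eq_abs]

lemma aff_sm {n : ℕ} (p : ℝ) (l : Euc n →L[ℝ] ℝ) : Sm (fun y => p + l y) :=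
  contDiff_const.add l.contDiff

lemma nd_aff {n : ℕ} (p : ℝ) (l : Euc n →L[ℝ] ℝ) (k : ℕ) (hk : 2 ≤ k) (x : Euc n) :
    nd k (fun y => p + l y) x = 0 := by
  obtain ⟨m, rfl⟩ : ∃ m, k = m + 2 := ⟨k - 2, by omega⟩
  unfold nd
  rw [← norm_iteratedFDeriv_fderiv]
  have : fderiv ℝ (fun y => p + l y) = fun _ => l := by
    ext1 y; rw [fderiv_const_add]; exact l.fderiv
  rw [this, iteratedFDeriv_succ_const]; simp

lemma pd_aff {n : ℕ} (p : ℝ) (l : Euc n →L[ℝ] ℝ) (i : Fin n) :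
    pd i (fun y => p + l y) = fun _ => l (ee i) := by
  ext y; simp only [pd]; rw [fderiv_const_add, l.fderiv]

lemma taylor_unit {n : ℕ} {W : Euc n → ℝ} (h : Sm W)
    (hlo : ∀ x ∈ Metric.ball (0 : Euc n) 1, ∀ v, 0 ≤ dd v (dd v W) x)
    (hhi : ∀ x ∈ Metric.ball (0 : Euc n) 1, ∀ v, dd v (dd v W) x ≤ ‖v‖^2) (y : Euc n)
    (hy : y ∈ Metric.ball (0 : Euc n) 1) : |W y - W 0 - fderiv ℝ W 0 y| ≤ 1 := by
  have hy1 : ‖y‖ < 1 := by simpa using hy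
  obtain ⟨ξ, hξ, e1⟩ := exists_hasDerivAt_eq_slope (fun t : ℝ => W (0 + t • y))
    (fun t => dd y W (0 + t • y)) zero_lt_one
    (fun t _ => (line h 0 y t).continuousAt.continuousWithinAt) (fun t _ => line h 0 y t)
  obtain ⟨η, hη, e2⟩ := exists_hasDerivAt_eq_slope (fun t : ℝ => dd y W (0 + t • y))
    (fun t => dd y (dd y W) (0 + t • y)) hξ.1
    (fun t _ => (line (h.dd y) 0 y t).continuousAt.continuousWithinAt) (fun t _ => line (h.dd y) 0 y t)
  have hb : (0:Euc n) + η • y ∈ Metric.ball (0 : Euc n) 1 := by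
    have h1 : η < 1 := hη.2.trans hξ.2
    have h0 : 0 < η := hη.1
    simp only [zero_add, mem_ball_zero_iff, norm_smul, Real.norm_eq_abs, abs_of_pos h0]
    nlinarith [norm_nonneg y]
  have a1 := hlo _ hb y
  have a2 := hhi _ hb y
  simp only [zero_smul, add_zero, one_smul, zero_add, sub_zero, div_one] at e1 e2 a1 a2
  have e3 : dd y W (ξ • y) - dd y W 0 = dd y (dd y W) (η • y) * ξ := by
    rw [e2, div_mul_cancel₀ _ hξ.1.ne']
  have e4 : fderiv ℝ W 0 y = dd y W 0 := rfl
  have e5 : W y - W 0 - fderiv ℝ W 0 y = dd y (dd y W) (η • y) * ξ := by rw [e4, ← e3, e1]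
  rw [e5, abs_le]
  have : ‖y‖^2 ≤ 1 := by nlinarith [norm_nonneg y]
  have h1 := hξ.1; have h2 := hξ.2
  constructor <;> nlinarith [mul_nonneg a1 h1.le]

lemma unit_est (n : ℕ) (hn : 0 < n) : ∃ N : ℕ, ∀ M : ℝ, 2 ≤ M → ∀ κ d : ℝ, 0 < κ → κ⁻¹ ≤ M →
    ∀ W W' : Euc n → ℝ, Good κ d W (Metric.ball 0 1) → Good κ d W' (Metric.ball 0 1) →
    ∀ b b' δ : ℝ, 0 < b' → b' ≤ b → 0 < δ →
    (∀ x ∈ Metric.ball (0 : Euc n) 1, |b * W x - b' * W' x| ≤ δ) →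
    ∀ k, 2 ≤ k → k ≤ 4 → nd k (fun y => W y - W' y) 0 ≤ M^N * ((δ + (b - b')) / b) := by
  obtain ⟨N, hN⟩ := core n hn 4
  refine ⟨N, ?_⟩
  intro M hM κ d hκ hκM W W' h h' b b' δ hb' hbb hδ hbd k hk1 hk2
  have hb : 0 < b := lt_of_lt_of_le hb' hbb
  set E : ℝ := (δ + (b - b')) / b with hE
  have hE0 : 0 < E := div_pos (by linarith) hb
  obtain ⟨p, l, hpl⟩ : ∃ (p : ℝ) (l : Euc n →L[ℝ] ℝ), ∀ y, p + l y = (1 - b'/b) * (W' 0 + fderiv ℝ W' 0 y) :=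
    ⟨(1 - b'/b) * W' 0, (1 - b'/b) • fderiv ℝ W' 0, fun y => by simp; ring⟩
  have hu : Sm (fun y => W y - W' y) := h.sm.sub h'.sm
  have hs : Sm (fun y => (W y - W' y) + (p + l y)) := hu.add (aff_sm p l)
  have hV : Sm (fun y => E⁻¹ * ((W y - W' y) + (p + l y))) := contDiff_const.mul hs
  have key := hN M hM 0 1 one_pos le_rfl (by simp; linarith) κ d hκ hκM W W' h h' _ hV ?_ ?_ k hk2
  · have e : (fun y => W y - W' y) = fun y => (fun y => E * (E⁻¹ * ((W y - W' y) + (p + l y)))) y - (p + l y) := by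
      ext y
      have : E * (E⁻¹ * ((W y - W' y) + (p + l y))) = (W y - W' y) + (p + l y) := by
        rw [← mul_assoc, mul_inv_cancel₀ hE0.ne', one_mul]
      simp only [this]; ring
    rw [e]
    refine (nd_sub_le (contDiff_const.mul hV) (aff_sm p l) k 0).trans ?_
    rw [nd_aff p l k hk1, add_zero, nd_const_mul hV, abs_of_pos hE0, mul_comm]
    gcongr
  · intro x hx
    have h0 := aw_diff_eq hκ h h' hx
    have : Lop (aw W W') (fun y => E⁻¹ * ((W y - W' y) + (p + l y))) x =
        E⁻¹ * Lop (aw W W') (fun y => W y - W' y) x := by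
      unfold Lop
      rw [Finset.mul_sum]
      refine Finset.sum_congr rfl fun i _ => ?_
      rw [Finset.mul_sum]
      refine Finset.sum_congr rfl fun j _ => ?_
      have e1 : pd j (fun y => E⁻¹ * ((W y - W' y) + (p + l y))) =
          fun y => E⁻¹ * (pd j (fun y => W y - W' y) y + l (ee j)) := by
        rw [pd_eq_dd, dd_const_mul hs, ← pd_eq_dd, pd_add hu (aff_sm p l), pd_aff]
      have hc : Sm (fun y => pd j (fun y => W y - W' y) y + l (ee j)) := (hu.pd j).add contDiff_const
      rw [e1, pd_eq_dd, dd_const_mul hc, ← pd_eq_dd, pd_add (hu.pd j) contDiff_const, pd_const]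
      ring
    rw [this, h0, mul_zero]
  · intro x hx
    refine le_trans ?_ (show (1:ℝ) ≤ M by linarith)
    rw [abs_mul, abs_of_pos (inv_pos.mpr hE0), inv_mul_le_iff₀ hE0, mul_one, hE, le_div_iff₀ hb]
    have t := taylor_unit h'.sm (fun x hx v => le_trans (by positivity) (h'.lo x hx v)) h'.hi x hx
    have e : (W x - W' x + (p + l x)) * b = (b * W x - b' * W' x) -
        (b - b') * (W' x - W' 0 - fderiv ℝ W' 0 x) := by
      rw [hpl]; field_simp; ring
    have hb2 : |W x - W' x + (p + l x)| * b = |(W x - W' x + (p + l x)) * b| := by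
      rw [abs_mul, abs_of_pos hb]
    rw [hb2, e]
    refine (abs_sub _ _).trans ?_
    rw [abs_mul, abs_of_nonneg (sub_nonneg.mpr hbb)]
    have h1 := hbd x hx
    nlinarith [mul_le_mul_of_nonneg_left t (sub_nonneg.mpr hbb)]

lemma dd_scale {n : ℕ} {u : Euc n → ℝ} (h : Sm u) (s r : ℝ) (x0 v : Euc n) :
    dd v (fun y => s * u (x0 + r • y)) = fun y => (s * r) * dd v u (x0 + r • y) := by
  ext y
  have h1 : HasFDerivAt (fun y : Euc n => x0 + r • y) (r • ContinuousLinearMap.id ℝ (Euc n)) y :=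
    ((hasFDerivAt_id y).const_smul r).const_add x0
  have h2 := ((h.diff (x0 + r • y)).hasFDerivAt.comp y h1).const_mul s
  unfold dd
  rw [HasFDerivAt.fderiv (f := fun y => s * u (x0 + r • y)) h2]
  simp; ring

lemma scale_sm {n : ℕ} {u : Euc n → ℝ} (h : Sm u) (s r : ℝ) (x0 : Euc n) :
    Sm (fun y => s * u (x0 + r • y)) :=
  contDiff_const.mul (h.comp (contDiff_const.add (contDiff_id.const_smul r)))

lemma nd_scale {n : ℕ} {u : Euc n → ℝ} (h : Sm u) (s r : ℝ) (hr : 0 < r) (x0 : Euc n) (k : ℕ) :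
    nd k (fun y => s * u (x0 + r • y)) 0 = |s| * (r^k * nd k u x0) := by
  have h1 : Sm (fun z => u (x0 + z)) := h.comp (contDiff_const.add contDiff_id)
  have h2 : Sm (fun y => u (x0 + r • y)) := h.comp (contDiff_const.add (contDiff_id.const_smul r))
  rw [nd_const_mul h2]
  congr 1
  unfold nd
  have := iteratedFDeriv_comp_const_smul (𝕜 := ℝ) (i := k) r (h1.of_le (by exact_mod_cast le_top))
  rw [this]
  simp only [smul_zero]
  rw [iteratedFDeriv_comp_add_left, norm_smul, add_zero, Real.norm_of_nonneg (by positivity)]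

lemma good_scale {n : ℕ} {w : Euc n → ℝ} (h : Sm w) (x0 : Euc n) (r lam Lam : ℝ) (hr : 0 < r)
    (hL : 0 < Lam)
    (hlo : ∀ x ∈ Metric.ball x0 r, ∀ v, lam * ‖v‖^2 ≤ dd v (dd v w) x)
    (hhi : ∀ x ∈ Metric.ball x0 r, ∀ v, dd v (dd v w) x ≤ Lam * ‖v‖^2)
    (hd : ∀ x ∈ Metric.ball x0 r, (Hs w x).det = 1) :
    Good (lam / Lam) ((Lam⁻¹)^n) (fun y => (Lam * r^2)⁻¹ * w (x0 + r • y)) (Metric.ball 0 1) := by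
  have hb : ∀ y ∈ Metric.ball (0 : Euc n) 1, x0 + r • y ∈ Metric.ball x0 r := by
    intro y hy
    have : ‖y‖ < 1 := by simpa using hy
    simp only [Metric.mem_ball, dist_eq_norm, add_sub_cancel_left, norm_smul, Real.norm_eq_abs, abs_of_pos hr]
    nlinarith
  have e : ∀ a c y, dd a (dd c (fun y => (Lam * r^2)⁻¹ * w (x0 + r • y))) y =
      Lam⁻¹ * dd a (dd c w) (x0 + r • y) := by
    intro a c y
    rw [dd_scale h, dd_scale (h.dd c)]
    simp only
    field_simp
  refine ⟨scale_sm h _ _ _, fun y hy v => ?_, fun y hy v => ?_, fun y hy => ?_⟩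
  · rw [e]
    calc lam / Lam * ‖v‖^2 = Lam⁻¹ * (lam * ‖v‖^2) := by ring
      _ ≤ _ := by gcongr; exact hlo _ (hb y hy) v
  · rw [e]
    calc _ ≤ Lam⁻¹ * (Lam * ‖v‖^2) := by gcongr; exact hhi _ (hb y hy) v
      _ = _ := by field_simp
  · have : Hs (fun y => (Lam * r^2)⁻¹ * w (x0 + r • y)) y = Lam⁻¹ • Hs w (x0 + r • y) := by
      ext i j
      simp only [Hs, Matrix.of_apply, Matrix.smul_apply, pd_eq_dd, e, smul_eq_mul]
    rw [this, Matrix.det_smul, hd _ (hb y hy)]; simp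

lemma ball_est (n : ℕ) (hn : 0 < n) : ∃ N : ℕ, ∀ M : ℝ, 2 ≤ M → ∀ (x0 : Euc n) (r lam Lam : ℝ), 0 < r →
    0 < lam → 0 < Lam → Lam / lam ≤ M → ∀ w w' : Euc n → ℝ, Sm w → Sm w' →
    (∀ x ∈ Metric.ball x0 r, ∀ v, lam * ‖v‖^2 ≤ dd v (dd v w) x) →
    (∀ x ∈ Metric.ball x0 r, ∀ v, dd v (dd v w) x ≤ Lam * ‖v‖^2) →
    (∀ x ∈ Metric.ball x0 r, (Hs w x).det = 1) →
    (∀ x ∈ Metric.ball x0 r, ∀ v, lam * ‖v‖^2 ≤ dd v (dd v w') x) →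
    (∀ x ∈ Metric.ball x0 r, ∀ v, dd v (dd v w') x ≤ Lam * ‖v‖^2) →
    (∀ x ∈ Metric.ball x0 r, (Hs w' x).det = 1) →
    ∀ b b' δ : ℝ, 0 < b' → b' ≤ b → 0 < δ → (∀ x ∈ Metric.ball x0 r, |b * w x - b' * w' x| ≤ δ) →
    ∀ k, 2 ≤ k → k ≤ 4 →
      r^k * nd k (fun y => w y - w' y) x0 ≤ M^N * ((δ + Lam * r^2 * (b - b')) / b) := by
  obtain ⟨N, hN⟩ := unit_est n hn
  refine ⟨N, ?_⟩
  intro M hM x0 r lam Lam hr hl hL hq w w' h h' h1 h2 h3 h1' h2' h3' b b' δ hb' hbb hδ hbd k hk1 hk2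
  have hb : 0 < b := lt_of_lt_of_le hb' hbb
  set s := (Lam * r^2)⁻¹ with hs
  have hs0 : 0 < s := by positivity
  have key := hN M hM (lam/Lam) ((Lam⁻¹)^n) (by positivity) (by rw [inv_div]; exact hq) _ _
    (good_scale h x0 r lam Lam hr hL h1 h2 h3) (good_scale h' x0 r lam Lam hr hL h1' h2' h3')
    b b' (s * δ) hb' hbb (by positivity) ?_ k hk1 hk2
  · have e : (fun y => (Lam * r^2)⁻¹ * w (x0 + r • y) - (Lam * r^2)⁻¹ * w' (x0 + r • y)) =
        fun y => s * (fun z => w z - w' z) (x0 + r • y) := by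
      ext y; simp only [hs]; ring
    rw [e, nd_scale (h.sub h') s r hr, abs_of_pos hs0] at key
    have e2 : M^N * ((s * δ + (b - b'))/b) = s * (M^N * ((δ + Lam * r^2 * (b - b'))/b)) := by
      rw [hs]; field_simp
    rw [e2] at key
    exact le_of_mul_le_mul_left key hs0
  · intro y hy
    have hy2 : x0 + r • y ∈ Metric.ball x0 r := by
      have : ‖y‖ < 1 := by simpa using hy
      simp only [Metric.mem_ball, dist_eq_norm, add_sub_cancel_left, norm_smul, Real.norm_eq_abs, abs_of_pos hr]
      nlinarith
    have := hbd _ hy2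
    have e : b * ((Lam * r^2)⁻¹ * w (x0 + r • y)) - b' * ((Lam * r^2)⁻¹ * w' (x0 + r • y)) =
        s * (b * w (x0 + r • y) - b' * w' (x0 + r • y)) := by simp only [hs]; ring
    rw [e, abs_mul, abs_of_pos hs0]
    gcongr

lemma localize {n : ℕ} {w : Euc n → ℝ} {r r0 : ℝ} (h0 : 0 < r0)
    (hw : ContDiffOn ℝ (⊤ : ℕ∞) w (Metric.ball 0 r)) {x0 : Euc n}
    (hx : x0 ∈ Metric.ball (0 : Euc n) (r - r0)) :
    ∃ v : Euc n → ℝ, Sm v ∧ ∀ x ∈ Metric.ball x0 (r0/2), v x = w x := by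
  let f : ContDiffBump x0 := ⟨r0/2, 3*r0/4, by linarith, by linarith⟩
  refine ⟨fun x => f x * w x, ?_, fun x hx => ?_⟩
  · rw [Sm, contDiff_iff_contDiffAt]
    intro x
    by_cases hxr : x ∈ Metric.ball (0 : Euc n) r
    · exact f.contDiffAt.mul (hw.contDiffAt (Metric.isOpen_ball.mem_nhds hxr))
    · have hns : x ∉ tsupport f := by
        rw [f.tsupport_eq]
        intro hc
        apply hxr
        have h1 : dist x x0 ≤ 3*r0/4 := hc
        have h2 : dist x0 0 < r - r0 := hx
        have := dist_triangle x x0 0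
        simp only [Metric.mem_ball]
        linarith
      have he : (fun x => f x * w x) =ᶠ[nhds x] fun _ => 0 := by
        filter_upwards [notMem_tsupport_iff_eventuallyEq.mp hns] with y hy
        simp [hy]
      exact contDiffAt_const.congr_of_eventuallyEq he
  · have : f x = 1 := f.one_of_mem_closedBall (Metric.ball_subset_closedBall hx)
    simp [this]

lemma hess_eq {n : ℕ} {w v : Euc n → ℝ} (hv : Sm v) {U : Set (Euc n)} (hU : IsOpen U)
    (h : ∀ x ∈ U, v x = w x) : ∀ x ∈ U, hessianMatrix w x = Hs v x := by
  intro x hx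
  have e : v =ᶠ[nhds x] w := Filter.eventuallyEq_of_mem (hU.mem_nhds hx) h
  ext i j
  simp only [hessianMatrix, Hs, Matrix.of_apply]
  rw [← (e.iteratedFDeriv ℝ 2).eq_of_nhds, iteratedFDeriv_two_apply, pd_pd_eq hv]
  rfl

open Matrix in
lemma quad_form {n : ℕ} {v : Euc n → ℝ} (hv : Sm v) (x ξ : Euc n) :
    dd ξ (dd ξ v) x = ξ.ofLp ⬝ᵥ (Hs v x *ᵥ ξ.ofLp) := by
  rw [dd_eq hv, fderiv2_eq_sum hv]
  simp only [dotProduct, Matrix.mulVec, Finset.mul_sum, Hs, Matrix.of_apply]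
  exact Finset.sum_congr rfl fun i _ => Finset.sum_congr rfl fun j _ => by ring

open Matrix in
lemma normsq_dot {n : ℕ} (ξ : Euc n) : ‖ξ‖^2 = ξ.ofLp ⬝ᵥ ξ.ofLp := by
  rw [EuclideanSpace.norm_sq_eq, dotProduct]
  exact Finset.sum_congr rfl fun i _ => by simp [sq]

open Matrix in
lemma psd_lo {n : ℕ} {v : Euc n → ℝ} (hv : Sm v) (x : Euc n) (lam : ℝ)
    (h : Matrix.PosSemidef (Hs v x - lam • (1 : Matrix (Fin n) (Fin n) ℝ))) (ξ : Euc n) :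
    lam * ‖ξ‖^2 ≤ dd ξ (dd ξ v) x := by
  have := h.dotProduct_mulVec_nonneg ξ.ofLp
  rw [quad_form hv, normsq_dot]
  rw [star_trivial, sub_mulVec, dotProduct_sub, smul_mulVec, one_mulVec, dotProduct_smul, smul_eq_mul] at this
  linarith

open Matrix in
lemma psd_hi {n : ℕ} {v : Euc n → ℝ} (hv : Sm v) (x : Euc n) (lam : ℝ)
    (h : Matrix.PosSemidef (lam • (1 : Matrix (Fin n) (Fin n) ℝ) - Hs v x)) (ξ : Euc n) :
    dd ξ (dd ξ v) x ≤ lam * ‖ξ‖^2 := by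
  have := h.dotProduct_mulVec_nonneg ξ.ofLp
  rw [quad_form hv, normsq_dot]
  rw [star_trivial, sub_mulVec, dotProduct_sub, smul_mulVec, one_mulVec, dotProduct_smul, smul_eq_mul] at this
  linarith

lemma lam_le {n : ℕ} (hn : 0 < n) {w : Euc n → ℝ} (h : Sm w) (x0 : Euc n) (r lam Lam : ℝ) (hr : 0 < r)
    (hl : 0 < lam) (hL : 0 < Lam)
    (hlo : ∀ x ∈ Metric.ball x0 r, ∀ v, lam * ‖v‖^2 ≤ dd v (dd v w) x)
    (hhi : ∀ x ∈ Metric.ball x0 r, ∀ v, dd v (dd v w) x ≤ Lam * ‖v‖^2)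
    (hd : ∀ x ∈ Metric.ball x0 r, (Hs w x).det = 1) : lam ≤ 1 ∧ lam ≤ Lam := by
  have g := good_scale h x0 r lam Lam hr hL hlo hhi hd
  have hm : (0 : Euc n) ∈ Metric.ball (0 : Euc n) 1 := by simp
  have p := (g.pinch hm).det_ge (by positivity)
  rw [g.det 0 hm] at p
  constructor
  · have := le_of_pow_le_pow_left₀ hn.ne' (by positivity) p
    rw [div_eq_mul_inv] at this
    have h2 : lam * Lam⁻¹ ≤ 1 * Lam⁻¹ := by linarith
    exact le_of_mul_le_mul_right h2 (by positivity)
  · have hx : x0 ∈ Metric.ball x0 r := by simpa using hr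
    have a := hlo x0 hx (ee ⟨0, hn⟩)
    have b := hhi x0 hx (ee ⟨0, hn⟩)
    rw [norm_ee] at a b
    linarith

lemma pt_est (n : ℕ) (hn : 0 < n) : ∃ N : ℕ, ∀ r b b' δ lam Lam : ℝ,
    0 < b → 0 < b' → 0 < δ → 0 < lam → 0 < Lam →
    ∀ w w' : Euc n → ℝ,
      ContDiffOn ℝ (⊤ : ℕ∞) w (Metric.ball 0 r) → ContDiffOn ℝ (⊤ : ℕ∞) w' (Metric.ball 0 r) →
      (∀ x ∈ Metric.ball (0 : Euc n) r, |b * w x - b' * w' x| ≤ δ) →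
      (∀ x ∈ Metric.ball (0 : Euc n) r, hessDet w x = 1 ∧ hessDet w' x = 1) →
      (∀ x ∈ Metric.ball (0 : Euc n) r,
        Matrix.PosSemidef (hessianMatrix w x - lam • (1 : Matrix (Fin n) (Fin n) ℝ)) ∧
        Matrix.PosSemidef (Lam • (1 : Matrix (Fin n) (Fin n) ℝ) - hessianMatrix w x) ∧
        Matrix.PosSemidef (hessianMatrix w' x - lam • (1 : Matrix (Fin n) (Fin n) ℝ)) ∧
        Matrix.PosSemidef (Lam • (1 : Matrix (Fin n) (Fin n) ℝ) - hessianMatrix w' x)) →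
      ∀ r0 : ℝ, 0 < r0 → r0 < r → ∀ x ∈ Metric.ball (0 : Euc n) (r - r0), ∀ k, 2 ≤ k → k ≤ 4 →
        r0^k * nd k (fun z => w z - w' z) x ≤
          32 * 2^N * (Lam/lam)^(N+1) * ((δ + r^2 * |b - b'|)/(b + b')) := by
  obtain ⟨N, hN⟩ := ball_est n hn
  refine ⟨N, ?_⟩
  intro r b b' δ lam Lam hb hb' hδ hl hL w w' hw hw' hbd hdet hpsd r0 h0 hr x0 hx0 k hk1 hk2
  have hsub : ∀ x ∈ Metric.ball x0 (r0/2), x ∈ Metric.ball (0 : Euc n) r := by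
    intro x hx
    have h1 : dist x x0 < r0/2 := hx
    have h2 : dist x0 0 < r - r0 := hx0
    have := dist_triangle x x0 0
    simp only [Metric.mem_ball]
    linarith
  obtain ⟨v, hv, ev⟩ := localize h0 hw hx0
  obtain ⟨v', hv', ev'⟩ := localize h0 hw' hx0
  have H := hess_eq hv Metric.isOpen_ball ev
  have H' := hess_eq hv' Metric.isOpen_ball ev'
  have lo : ∀ x ∈ Metric.ball x0 (r0/2), ∀ ξ, lam * ‖ξ‖^2 ≤ dd ξ (dd ξ v) x := fun x hx ξ =>
    psd_lo hv x lam (by rw [← H x hx]; exact (hpsd x (hsub x hx)).1) ξ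
  have hi : ∀ x ∈ Metric.ball x0 (r0/2), ∀ ξ, dd ξ (dd ξ v) x ≤ Lam * ‖ξ‖^2 := fun x hx ξ =>
    psd_hi hv x Lam (by rw [← H x hx]; exact (hpsd x (hsub x hx)).2.1) ξ
  have lo' : ∀ x ∈ Metric.ball x0 (r0/2), ∀ ξ, lam * ‖ξ‖^2 ≤ dd ξ (dd ξ v') x := fun x hx ξ =>
    psd_lo hv' x lam (by rw [← H' x hx]; exact (hpsd x (hsub x hx)).2.2.1) ξ
  have hi' : ∀ x ∈ Metric.ball x0 (r0/2), ∀ ξ, dd ξ (dd ξ v') x ≤ Lam * ‖ξ‖^2 := fun x hx ξ =>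
    psd_hi hv' x Lam (by rw [← H' x hx]; exact (hpsd x (hsub x hx)).2.2.2) ξ
  have de : ∀ x ∈ Metric.ball x0 (r0/2), (Hs v x).det = 1 := fun x hx => by
    rw [← H x hx]; exact (hdet x (hsub x hx)).1
  have de' : ∀ x ∈ Metric.ball x0 (r0/2), (Hs v' x).det = 1 := fun x hx => by
    rw [← H' x hx]; exact (hdet x (hsub x hx)).2
  have bd : ∀ x ∈ Metric.ball x0 (r0/2), |b * v x - b' * v' x| ≤ δ := fun x hx => by
    rw [ev x hx, ev' x hx]; exact hbd x (hsub x hx)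
  obtain ⟨hl1, hlL⟩ := lam_le hn hv x0 (r0/2) lam Lam (by linarith) hl hL lo hi de
  have hq1 : 1 ≤ Lam/lam := (one_le_div hl).mpr hlL
  have hq2 : Lam ≤ Lam/lam := by
    rw [le_div_iff₀ hl]; nlinarith
  have hM : (2:ℝ) ≤ 2 * (Lam/lam) := by linarith
  have hMq : Lam/lam ≤ 2 * (Lam/lam) := by linarith
  have hxm : x0 ∈ Metric.ball x0 (r0/2) := by simpa using h0
  have ndeq : nd k (fun z => w z - w' z) x0 = nd k (fun z => v z - v' z) x0 :=
    nd_congr Metric.isOpen_ball (fun x hx => by rw [ev x hx, ev' x hx]) k x0 hxm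
  have ndsw : nd k (fun z => v' z - v z) x0 = nd k (fun z => v z - v' z) x0 := by
    have : (fun z => v' z - v z) = fun z => (-1:ℝ) * (v z - v' z) := by ext z; ring
    rw [this, nd_const_mul (hv.sub hv')]
    simp
  set E := (2 * (Lam/lam))^N with hE
  set D := |b - b'| with hD
  have hD0 : 0 ≤ D := abs_nonneg _
  have main : (r0/2)^k * nd k (fun z => v z - v' z) x0 ≤
      E * (2 * (Lam/lam) * ((δ + r^2 * D)/(b + b'))) := by
    have aux : ∀ m : ℝ, 0 < m → b + b' ≤ 2 * m →
        E * ((δ + Lam * (r0/2)^2 * D)/m) ≤ E * (2 * (Lam/lam) * ((δ + r^2 * D)/(b + b'))) := by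
      intro m hm hmb
      gcongr
      rw [div_le_iff₀ hm]
      have e1 : δ + Lam * (r0/2)^2 * D ≤ (Lam/lam) * (δ + r^2 * D) := by
        have a1 : δ ≤ (Lam/lam) * δ := le_mul_of_one_le_left hδ.le hq1
        have a2 : Lam * (r0/2)^2 * D ≤ (Lam/lam) * r^2 * D := by
          gcongr
          linarith
        linarith
      refine e1.trans ?_
      have hY : 0 ≤ (Lam/lam) * (δ + r^2 * D) := by positivity
      have e2 : 2 * (Lam / lam) * ((δ + r ^ 2 * D) / (b + b')) * m =
          ((Lam/lam) * (δ + r^2 * D)) * (2 * m/(b+b')) := by field_simp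
      rw [e2]
      exact le_mul_of_one_le_right hY ((one_le_div (by positivity)).mpr hmb)
    rcases le_total b' b with hbb | hbb
    · have := hN (2 * (Lam/lam)) hM x0 (r0/2) lam Lam (by linarith) hl hL hMq v v' hv hv' lo hi de lo' hi' de'
        b b' δ hb' hbb hδ bd k hk1 hk2
      have eD : b - b' = D := by rw [hD, abs_of_nonneg]; linarith
      rw [eD] at this
      exact this.trans (aux b hb (by linarith))
    · have := hN (2 * (Lam/lam)) hM x0 (r0/2) lam Lam (by linarith) hl hL hMq v' v hv' hv lo' hi' de' lo hi de
        b' b δ hb hbb hδ (fun x hx => by rw [abs_sub_comm]; exact bd x hx) k hk1 hk2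
      have eD : b' - b = D := by rw [hD, abs_sub_comm, abs_of_nonneg]; linarith
      rw [eD, ndsw] at this
      exact this.trans (aux b' hb' (by linarith))
  rw [ndeq]
  have h2k : (2:ℝ)^k ≤ 16 := by
    calc (2:ℝ)^k ≤ 2^4 := pow_le_pow_right₀ (by norm_num) hk2
      _ = 16 := by norm_num
  have e3 : r0^k = 2^k * (r0/2)^k := by rw [← mul_pow]; congr 1; ring
  have hR : 0 ≤ E * (2 * (Lam/lam) * ((δ + r^2 * D)/(b + b'))) := by positivity
  calc r0^k * nd k (fun z => v z - v' z) x0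
      = 2^k * ((r0/2)^k * nd k (fun z => v z - v' z) x0) := by rw [e3]; ring
    _ ≤ 16 * (E * (2 * (Lam/lam) * ((δ + r^2 * D)/(b + b')))) := by
        refine mul_le_mul h2k main ?_ (by norm_num)
        have := nd_nonneg k (fun z => v z - v' z) x0
        positivity
    _ = _ := by rw [hE, mul_pow]; ring

lemma holder_arith {r0 d α B X : ℝ} (l : ℕ) (h0 : 0 < r0) (hd : 0 < d) (hα : α ∈ Set.Ioo (0:ℝ) 1)
    (hB : 0 ≤ B) (h1 : r0^l * X ≤ 2 * B) (h2 : r0^(l+1) * X ≤ B * d) :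
    r0 ^ ((l:ℝ) + α) * (X / d^α) ≤ 2 * B := by
  have hdα : 0 < d^α := Real.rpow_pos_of_pos hd α
  have hrα : 0 < r0^α := Real.rpow_pos_of_pos h0 α
  rw [Real.rpow_add h0, Real.rpow_natCast, ← mul_div_assoc, div_le_iff₀ hdα]
  rcases le_total r0 d with h | h
  · have : r0^α ≤ d^α := Real.rpow_le_rpow h0.le h hα.1.le
    calc r0^l * r0^α * X = r0^α * (r0^l * X) := by ring
      _ ≤ r0^α * (2 * B) := by gcongr
      _ ≤ d^α * (2 * B) := by gcongr
      _ = _ := by ring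
  · have h3 : d * r0^α ≤ r0 * d^α := by
      have e1 : d = d^α * d^(1-α) := by rw [← Real.rpow_add hd]; simp
      have e2 : r0 = r0^α * r0^(1-α) := by rw [← Real.rpow_add h0]; simp
      have e3 : d^(1-α) ≤ r0^(1-α) := Real.rpow_le_rpow hd.le h (by linarith [hα.2])
      calc d * r0^α = d^α * r0^α * d^(1-α) := by
            conv_lhs => rw [e1]
            ring
        _ ≤ d^α * r0^α * r0^(1-α) := by gcongr
        _ = r0 * d^α := by
            conv_rhs => rw [e2]
            ring
    refine le_of_mul_le_mul_left ?_ h0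
    calc r0 * (r0^l * r0^α * X) = r0^α * (r0^(l+1) * X) := by ring
      _ ≤ r0^α * (B * d) := by gcongr
      _ = B * (d * r0^α) := by ring
      _ ≤ B * (r0 * d^α) := by gcongr
      _ ≤ r0 * (2 * B * d^α) := by nlinarith [mul_nonneg hB (mul_nonneg h0.le hdα.le)]

lemma holder_deriv {n : ℕ} {u : Euc n → ℝ} {r r0 B : ℝ} (h0 : 0 < r0) (l : ℕ)
    (hu : ContDiffOn ℝ (⊤ : ℕ∞) u (Metric.ball 0 r))
    (hB : ∀ x ∈ Metric.ball (0 : Euc n) (r - r0), r0^(l+1) * nd (l+1) u x ≤ B)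
    {x y : Euc n} (hx : x ∈ Metric.ball (0 : Euc n) (r - r0)) (hy : y ∈ Metric.ball (0 : Euc n) (r - r0)) :
    r0^(l+1) * ‖iteratedFDeriv ℝ l u x - iteratedFDeriv ℝ l u y‖ ≤ B * ‖x - y‖ := by
  have hp : 0 < r0^(l+1) := by positivity
  have hss : Metric.ball (0 : Euc n) (r - r0) ⊆ Metric.ball 0 r :=
    Metric.ball_subset_ball (by linarith)
  have := (convex_ball (0 : Euc n) (r - r0)).norm_image_sub_le_of_norm_fderiv_le (𝕜 := ℝ)
    (f := iteratedFDeriv ℝ l u) (C := B / r0^(l+1)) (x := y) (y := x) ?_ ?_ hy hx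
  · calc _ ≤ r0^(l+1) * (B / r0^(l+1) * ‖x - y‖) := by gcongr
      _ = _ := by field_simp
  · intro z hz
    exact (hu.contDiffAt (Metric.isOpen_ball.mem_nhds (hss hz))).differentiableAt_iteratedFDeriv
      (by exact_mod_cast WithTop.coe_lt_top _)
  · intro z hz
    rw [norm_fderiv_iteratedFDeriv, le_div_iff₀ hp, mul_comm]
    exact hB z hz

/-- Estimates on the difference of two solutions of the Monge–Ampère equation with
unit right-hand side: with `λI ≤ D²w, D²w′ ≤ ΛI`, `|bw − b′w′| ≤ δ` and `C_α` a
Hölder-`α` bound for the Hessians on `B_r`, for `ℓ = 2, 3` and every `r₀ ∈ (0,r)`,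
`r₀^ℓ sup|Dℓ(w−w′)| + r₀^{ℓ+α} [Dℓ(w−w′)]_{C^α} ≤
  C λ^{−β̃₁} Λ^{β₁−β̃₁} (1 + r^α C_α)(δ + r²|b−b′|)/(b+b′)` on `B_{r−r₀}`. -/
theorem difference_of_unit_MA_solutions (n : ℕ) (hn : 2 ≤ n) (α : ℝ) (hα : α ∈ Set.Ioo (0:ℝ) 1) :
    ∃ β₁ βt₁ C : ℝ, 0 < β₁ ∧ 0 < βt₁ ∧ 0 < C ∧ βt₁ ≤ β₁ ∧
      ∀ r b b' δ lam Lam Cα : ℝ,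
        0 < r → 0 < b → 0 < b' → 0 < δ → 0 < lam → 0 < Lam → 0 < Cα →
        ∀ w w' : Euc n → ℝ,
          ContDiffOn ℝ (⊤ : ℕ∞) w (Metric.ball 0 r) → ContDiffOn ℝ (⊤ : ℕ∞) w' (Metric.ball 0 r) →
          (∀ x ∈ Metric.ball (0 : Euc n) r, |b * w x - b' * w' x| ≤ δ) →
          (∀ x ∈ Metric.ball (0 : Euc n) r, hessDet w x = 1 ∧ hessDet w' x = 1) →
          (∀ x ∈ Metric.ball (0 : Euc n) r,
            Matrix.PosSemidef (hessianMatrix w x - lam • (1 : Matrix (Fin n) (Fin n) ℝ)) ∧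
            Matrix.PosSemidef (Lam • (1 : Matrix (Fin n) (Fin n) ℝ) - hessianMatrix w x) ∧
            Matrix.PosSemidef (hessianMatrix w' x - lam • (1 : Matrix (Fin n) (Fin n) ℝ)) ∧
            Matrix.PosSemidef (Lam • (1 : Matrix (Fin n) (Fin n) ℝ) - hessianMatrix w' x)) →
          (∀ x ∈ Metric.ball (0 : Euc n) r, ∀ y ∈ Metric.ball (0 : Euc n) r,
            ‖iteratedFDeriv ℝ 2 w x - iteratedFDeriv ℝ 2 w y‖ ≤ Cα * ‖x - y‖ ^ α ∧
            ‖iteratedFDeriv ℝ 2 w' x - iteratedFDeriv ℝ 2 w' y‖ ≤ Cα * ‖x - y‖ ^ α) →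
          ∀ r₀ : ℝ, 0 < r₀ → r₀ < r → ∀ ℓ : ℕ, ℓ = 2 ∨ ℓ = 3 →
            ∀ x ∈ Metric.ball (0 : Euc n) (r - r₀),
              ∀ x' ∈ Metric.ball (0 : Euc n) (r - r₀),
                ∀ y' ∈ Metric.ball (0 : Euc n) (r - r₀), x' ≠ y' →
                  r₀ ^ (ℓ : ℝ) * ‖iteratedFDeriv ℝ ℓ (fun z => w z - w' z) x‖ +
                      r₀ ^ ((ℓ : ℝ) + α) *
                        (‖iteratedFDeriv ℝ ℓ (fun z => w z - w' z) x' -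
                            iteratedFDeriv ℝ ℓ (fun z => w z - w' z) y'‖ / ‖x' - y'‖ ^ α) ≤
                    C * lam ^ (-βt₁) * Lam ^ (β₁ - βt₁) * (1 + r ^ α * Cα) *
                      ((δ + r ^ 2 * |b - b'|) / (b + b')) := by
  obtain ⟨N, hN⟩ := pt_est n (by omega)
  refine ⟨2 * ((N+1:ℕ):ℝ), ((N+1:ℕ):ℝ), 96 * 2^N, by positivity, by positivity, by positivity, ?_, ?_⟩
  · have : (0:ℝ) ≤ ((N+1:ℕ):ℝ) := by positivity
    linarith
  intro r b b' δ lam Lam Cα hr hb hb' hδ hl hL hC w w' hw hw' hbd hdet hpsd _ r₀ h0 hr0 ℓ hℓ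
    x hx x' hx' y' hy' hne
  have hℓ1 : 2 ≤ ℓ := by omega
  have hℓ2 : ℓ + 1 ≤ 4 := by omega
  have P := hN r b b' δ lam Lam hb hb' hδ hl hL w w' hw hw' hbd hdet hpsd r₀ h0 hr0
  set ε := (δ + r^2 * |b - b'|)/(b + b') with hε
  have hε0 : 0 ≤ ε := by positivity
  set B := 32 * 2^N * (Lam/lam)^(N+1) * ε with hB
  have hB0 : 0 ≤ B := by positivity
  have hd : 0 < ‖x' - y'‖ := norm_pos_iff.mpr (sub_ne_zero.mpr hne)
  have t1 : r₀^ℓ * ‖iteratedFDeriv ℝ ℓ (fun z => w z - w' z) x‖ ≤ B := P x hx ℓ hℓ1 (by omega)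
  have t2 : r₀^ℓ * ‖iteratedFDeriv ℝ ℓ (fun z => w z - w' z) x' -
      iteratedFDeriv ℝ ℓ (fun z => w z - w' z) y'‖ ≤ 2 * B := by
    have a1 : r₀^ℓ * ‖iteratedFDeriv ℝ ℓ (fun z => w z - w' z) x'‖ ≤ B := P x' hx' ℓ hℓ1 (by omega)
    have a2 : r₀^ℓ * ‖iteratedFDeriv ℝ ℓ (fun z => w z - w' z) y'‖ ≤ B := P y' hy' ℓ hℓ1 (by omega)
    have a3 := mul_le_mul_of_nonneg_left (norm_sub_le (iteratedFDeriv ℝ ℓ (fun z => w z - w' z) x')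
      (iteratedFDeriv ℝ ℓ (fun z => w z - w' z) y')) (by positivity : 0 ≤ r₀^ℓ)
    linarith
  have t3 := holder_deriv h0 ℓ (hw.sub hw') (fun z hz => P z hz (ℓ+1) (by omega) hℓ2) hx' hy'
  have t4 := holder_arith ℓ h0 hd hα hB0 t2 t3
  rw [Real.rpow_natCast]
  have e1 : (2 * ((N+1:ℕ):ℝ) - ((N+1:ℕ):ℝ)) = ((N+1:ℕ):ℝ) := by ring
  rw [e1, Real.rpow_neg hl.le, Real.rpow_natCast, Real.rpow_natCast]
  have e2 : 96 * 2^N * (lam^(N+1))⁻¹ * Lam^(N+1) * (1 + r^α * Cα) * ε = 3 * B * (1 + r^α * Cα) := by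
    rw [hB, div_pow]; ring
  rw [e2]
  have h1 : 1 ≤ 1 + r^α * Cα := by
    have : 0 < r^α := Real.rpow_pos_of_pos hr α
    have := mul_pos this hC
    linarith
  have := le_mul_of_one_le_right (by positivity : 0 ≤ 3 * B) h1
  linarith
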